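/- arXiv:2205.05959 — 7 statements merged into one kernel-verified Lean document; each statement's English description precedes it below -/
import Mathlib

section
/- Let f ∈ ℝ[x,y] be a polynomial in two commuting variables such that f(a,b) ≥ 0 for all (a,b) ∈ ℝ². Then there exists k ∈ ℕ such that (1+x²)^k · f is a sum of squares of polynomials in ℝ[x,y]. -/
namespace BNS
open Polynomial

theorem isSumSq_map {R S : Type*} [CommSemiring R] [CommSemiring S] (φ : R →+* S) {a : R}
    (h : IsSumSq a) : IsSumSq (φ a) := by
  induction h with
  | zero => simp
  | sq_add a hs ih => rw [map_add, map_mul]; exact (IsSumSq.mul_self _).add ih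

theorem isSumSq_sq {R : Type*} [CommSemiring R] (a : R) : IsSumSq (a ^ 2) := by
  rw [sq]; exact IsSumSq.mul_self a

theorem nonneg_of_sq_mul {q p : ℝ[X]} (hq : q ≠ 0) (h : ∀ x, 0 ≤ (q ^ 2 * p).eval x) :
    ∀ x, 0 ≤ p.eval x := by
  intro x
  by_contra hx
  push Not at hx
  apply hq
  apply Polynomial.eq_zero_of_infinite_isRoot
  have hopen : IsOpen {y : ℝ | p.eval y < 0} :=
    isOpen_lt p.continuous continuous_const
  refine Set.Infinite.mono ?_ (infinite_of_mem_nhds x (hopen.mem_nhds hx))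
  intro y hy
  have h1 := h y
  simp only [Set.mem_ofPred_eq, eval_mul, eval_pow, IsRoot.def] at *
  by_contra h0
  have : 0 < q.eval y ^ 2 := by positivity
  nlinarith

theorem isSumSq_of_nonneg (p : ℝ[X]) (h : ∀ x, 0 ≤ p.eval x) : IsSumSq p := by
  induction hn : p.natDegree using Nat.strong_induction_on generalizing p with
  | _ n ih =>
  by_cases hn0 : n = 0
  · subst hn0
    obtain ⟨a, rfl⟩ := natDegree_eq_zero.1 hn
    have ha : 0 ≤ a := by simpa using h 0
    rw [show (C a : ℝ[X]) = C (√a) * C (√a) by rw [← C_mul, Real.mul_self_sqrt ha]]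
    exact IsSumSq.mul_self _
  by_cases hr : ∃ a, p.IsRoot a
  · obtain ⟨a, ha⟩ := hr
    obtain ⟨p1, rfl⟩ := dvd_iff_isRoot.2 ha
    have hp0 : (X - C a) * p1 ≠ 0 := by rintro h0; rw [h0] at hn; simp at hn; omega
    have hmin : IsLocalMin (fun x => ((X - C a) * p1).eval x) a := by
      filter_upwards with x
      simpa using h x
    have hd := hmin.deriv_eq_zero
    rw [Polynomial.deriv] at hd
    have h1 : p1.IsRoot a := by simpa [derivative_mul] using hd
    obtain ⟨p2, rfl⟩ := dvd_iff_isRoot.2 h1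
    rw [← mul_assoc, ← sq] at h hn hp0 ⊢
    have hp2 : p2 ≠ 0 := right_ne_zero_of_mul hp0
    refine (isSumSq_sq _).mul (ih p2.natDegree ?_ p2 (nonneg_of_sq_mul (X_sub_C_ne_zero a) h) rfl)
    rw [natDegree_mul (pow_ne_zero _ (X_sub_C_ne_zero a)) hp2, natDegree_pow] at hn
    simp at hn; omega
  · obtain ⟨z, hz⟩ := IsAlgClosed.exists_aeval_eq_zero ℂ p
      (by intro h0; exact hn0 (by rw [← hn]; exact natDegree_eq_zero_iff_degree_le_zero.2 h0.le))
    have him : z.im ≠ 0 := by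
      intro h0
      apply hr
      refine ⟨z.re, ?_⟩
      have : z = ((z.re : ℝ) : ℂ) := by apply Complex.ext <;> simp [h0]
      rw [this] at hz
      have h2 : algebraMap ℝ ℂ (p.eval z.re) = 0 := by
        rw [← hz, ← Polynomial.aeval_algebraMap_apply_eq_algebraMap_eval]; rfl
      simpa using h2
    obtain ⟨p2, hp2⟩ := Polynomial.quadratic_dvd_of_aeval_eq_zero_im_ne_zero p hz him
    have e : (X ^ 2 - C (2 * z.re) * X + C (‖z‖ ^ 2) : ℝ[X]) = (X - C z.re) ^ 2 + (C z.im) ^ 2 := by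
      rw [Complex.sq_norm, Complex.normSq_apply]
      simp only [C_add, C_mul, map_ofNat]; ring
    rw [e] at hp2
    have hpos : ∀ x : ℝ, 0 < ((X - C z.re) ^ 2 + (C z.im) ^ 2 : ℝ[X]).eval x := by
      intro x; simp; positivity
    have hne : ((X - C z.re) ^ 2 + (C z.im) ^ 2 : ℝ[X]) ≠ 0 := by
      intro h0; have := hpos 0; rw [h0] at this; simp at this
    have hp0 : p ≠ 0 := by rintro rfl; simp at hn; omega
    have hp20 : p2 ≠ 0 := by rintro rfl; simp at hp2; exact hp0 hp2
    have hdeg : ((X - C z.re) ^ 2 + (C z.im) ^ 2 : ℝ[X]).natDegree = 2 := by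
      rw [← e]; compute_degree!
    rw [hp2]
    refine ((isSumSq_sq _).add (isSumSq_sq _)).mul (ih p2.natDegree ?_ p2 ?_ rfl)
    · rw [hp2, natDegree_mul hne hp20, hdeg] at hn; omega
    · intro x
      have h1 := h x
      rw [hp2, eval_mul] at h1
      exact nonneg_of_mul_nonneg_right h1 (hpos x)

theorem abs_eval_le (P : ℝ[X]) (r : ℕ) (h : P.natDegree ≤ 2 * r) :
    ∃ C : ℝ, 0 < C ∧ ∀ x : ℝ, |P.eval x| ≤ C * (1 + x ^ 2) ^ r := by
  refine ⟨1 + ∑ i ∈ Finset.range (P.natDegree + 1), |P.coeff i|, by positivity, fun x => ?_⟩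
  rw [eval_eq_sum_range]
  refine (Finset.abs_sum_le_sum_abs _ _).trans ?_
  rw [add_mul, Finset.sum_mul]
  refine le_add_of_nonneg_of_le (by positivity) (Finset.sum_le_sum fun i hi => ?_)
  rw [abs_mul]
  refine mul_le_mul_of_nonneg_left ?_ (abs_nonneg _)
  rw [abs_pow]
  have hi' : i ≤ 2 * r := by rw [Finset.mem_range] at hi; omega
  rcases le_total |x| 1 with h1 | h1
  · exact (pow_le_one₀ (abs_nonneg _) h1).trans (one_le_pow₀ (by nlinarith [sq_nonneg x]))
  · refine (pow_le_pow_right₀ h1 hi').trans ?_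
    rw [pow_mul, sq_abs]
    exact pow_le_pow_left₀ (sq_nonneg x) (by linarith) _

theorem le_sq_eval (h : ℝ[X]) (hz : ∀ x, h.eval x ≠ 0) :
    ∃ m : ℝ, 0 < m ∧ ∀ x : ℝ, m * (1 + x ^ 2) ^ h.natDegree ≤ h.eval x ^ 2 := by
  have key : ∀ g : ℝ[X], (∀ x, g.eval x ≠ 0) → ∃ m : ℝ, 0 < m ∧ ∀ x ∈ Set.Icc (-1 : ℝ) 1,
      m ≤ g.eval x ^ 2 := by
    intro g hg
    obtain ⟨x0, -, hx0⟩ := (isCompact_Icc (a := (-1 : ℝ)) (b := 1)).exists_isMinOn ⟨0, by simp⟩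
      (f := fun x => g.eval x ^ 2) (by fun_prop)
    exact ⟨g.eval x0 ^ 2, by have := hg x0; positivity, fun x hx => hx0 hx⟩
  have h0 : h ≠ 0 := by rintro rfl; exact hz 0 (by simp)
  have hrev : ∀ x : ℝ, x ≠ 0 → h.eval x = x ^ h.natDegree * h.reverse.eval x⁻¹ := by
    intro x hx
    let := invertibleOfNonzero hx
    have := eval₂_reverse_mul_pow (RingHom.id ℝ) x h
    simp only [invOf_eq_inv, eval₂_id] at this
    rw [← this]; ring
  obtain ⟨m1, hm1, h1⟩ := key h hz
  obtain ⟨m2, hm2, h2⟩ := key h.reverse (by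
    intro x hx
    by_cases hx0 : x = 0
    · subst hx0
      rw [← coeff_zero_eq_eval_zero, coeff_zero_reverse] at hx
      exact h0 (leadingCoeff_eq_zero.1 hx)
    · have := hrev x⁻¹ (inv_ne_zero hx0)
      rw [inv_inv, hx, mul_zero] at this
      exact hz _ this)
  refine ⟨min m1 m2 / 2 ^ h.natDegree, by positivity, fun x => ?_⟩
  rw [div_mul_eq_mul_div, mul_div_assoc, ← div_pow]
  rcases le_total |x| 1 with hx | hx
  · refine le_trans ?_ (h1 x (abs_le.1 hx))
    have : ((1 + x ^ 2) / 2) ^ h.natDegree ≤ 1 := by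
      apply pow_le_one₀ (by positivity)
      have := (sq_le_one_iff_abs_le_one x).2 hx
      linarith
    calc _ ≤ min m1 m2 * 1 := by gcongr
      _ ≤ m1 := by simp
  · have hx0 : x ≠ 0 := by rintro rfl; norm_num at hx
    rw [hrev x hx0, mul_pow]
    have h3 := h2 x⁻¹ (abs_le.1 (by rw [abs_inv]; exact inv_le_one_of_one_le₀ hx))
    have : ((1 + x ^ 2) / 2) ^ h.natDegree ≤ (x ^ h.natDegree) ^ 2 := by
      rw [← pow_mul, mul_comm, pow_mul]
      apply pow_le_pow_left₀ (by positivity)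
      have := (one_le_sq_iff_one_le_abs x).2 hx
      linarith
    calc _ ≤ m2 * (x ^ h.natDegree) ^ 2 := by gcongr; simp
      _ ≤ _ := by rw [mul_comm]; gcongr

/-- real part of a polynomial: the part with real roots -/
theorem exists_realpart (w : ℝ[X]) (hw : w ≠ 0) : ∃ (ρ : ℝ[X]) (c : ℝ), 0 < c ∧ ρ ≠ 0 ∧
    (∀ x, c * ρ.eval x ^ 2 ≤ w.eval x ^ 2) ∧
    ∀ q : ℝ[X], (∀ x, q.eval x ≠ 0) → IsCoprime ρ q := by
  induction hn : w.natDegree generalizing w with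
  | zero =>
    obtain ⟨a, rfl⟩ := natDegree_eq_zero.1 hn
    have ha : a ≠ 0 := by simpa using hw
    exact ⟨1, a ^ 2, by positivity, one_ne_zero, by simp, fun q _ => isCoprime_one_left⟩
  | succ n ih =>
  by_cases hr : ∃ a, w.IsRoot a
  · obtain ⟨a, ha⟩ := hr
    obtain ⟨p1, rfl⟩ := dvd_iff_isRoot.2 ha
    have hp1 := right_ne_zero_of_mul hw
    rw [natDegree_mul (X_sub_C_ne_zero a) hp1, natDegree_X_sub_C] at hn
    obtain ⟨ρ, c, hc, hρ, h1, h2⟩ := ih p1 hp1 (by omega)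
    refine ⟨(X - C a) * ρ, c, hc, mul_ne_zero (X_sub_C_ne_zero a) hρ, fun x => ?_, fun q hq => ?_⟩
    · have := h1 x
      simp only [eval_mul, mul_pow]
      nlinarith [sq_nonneg ((X - C a).eval x)]
    · refine IsCoprime.mul_left ?_ (h2 q hq)
      rw [(irreducible_X_sub_C a).coprime_iff_not_dvd, dvd_iff_isRoot]
      exact hq a
  · push Not at hr
    obtain ⟨m, hm, h⟩ := le_sq_eval w hr
    refine ⟨1, m, hm, one_ne_zero, fun x => ?_, fun q _ => isCoprime_one_left⟩
    refine le_trans ?_ (h x)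
    simp only [eval_one, one_pow]
    gcongr
    exact one_le_pow₀ (by nlinarith [sq_nonneg x])

/-- Gluing lemma: Bezout with control. -/
theorem glue (h ω : ℝ[X]) (hz : ∀ x, h.eval x ≠ 0) (hco : IsCoprime ω h) (m : ℕ) (δ : ℝ)
    (hδ : 0 < δ) : ∃ (k : ℕ) (Q e : ℝ[X]), Q * h ^ 2 + ω ^ 2 * e = (1 + X ^ 2) ^ k ∧
      ∀ x : ℝ, |e.eval x| * (1 + x ^ 2) ^ m ≤ δ * (1 + x ^ 2) ^ k := by
  set p : ℝ[X] := 1 + X ^ 2 with hp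
  have hpe : ∀ x, p.eval x = 1 + x ^ 2 := by intro x; simp [hp]
  set r := h.natDegree with hr
  have h0 : h ≠ 0 := by rintro rfl; exact hz 0 (by simp)
  obtain ⟨α, β, hαβ⟩ := (hco.pow (m := 2) (n := 2))
  -- α * ω^2 + β * h^2 = 1
  set β' := (α * p ^ (r + m)) % (h ^ 2) with hβ'
  obtain ⟨α', hα'⟩ : ∃ α', α' * h ^ 2 + β' * ω ^ 2 = p ^ (r + m) := by
    refine ⟨β * p ^ (r + m) + (α * p ^ (r + m)) / (h ^ 2) * ω ^ 2, ?_⟩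
    have h1 := EuclideanDomain.div_add_mod (α * p ^ (r + m)) (h ^ 2)
    rw [← hβ'] at h1
    linear_combination (p ^ (r+m)) * hαβ + ω ^ 2 * h1
  have hdeg : β'.natDegree ≤ 2 * r := by
    have : β'.natDegree ≤ (h ^ 2).natDegree := by
      apply natDegree_le_natDegree
      exact (EuclideanDomain.mod_lt _ (pow_ne_zero 2 h0)).le
    rwa [natDegree_pow] at this
  obtain ⟨C₁, hC₁, hb⟩ := abs_eval_le β' r hdeg
  obtain ⟨M, hM, hq⟩ := abs_eval_le (h ^ 2) r (by rw [natDegree_pow])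
  obtain ⟨μ, hμ, hl⟩ := le_sq_eval h hz
  have hμM : μ ≤ M := by
    have h1 := hl 0
    have h2 := hq 0
    simp only [eval_pow] at h2
    rw [abs_of_nonneg (by positivity)] at h2
    simpa using h1.trans h2
  obtain ⟨n, hn⟩ := exists_pow_lt_of_lt_one (show 0 < δ / C₁ by positivity)
    (show 1 - μ / M < 1 by have : 0 < μ / M := by positivity
                           linarith)
  obtain ⟨T, hT⟩ : h ^ 2 ∣ p ^ (r * n) - (p ^ r - C M⁻¹ * h ^ 2) ^ n := by
    rw [pow_mul]
    refine Dvd.dvd.trans ?_ (sub_dvd_pow_sub_pow _ _ n)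
    exact ⟨C M⁻¹, by ring⟩
  refine ⟨r + m + r * n, α' * p ^ (r * n) + β' * ω ^ 2 * T, β' * (p ^ r - C M⁻¹ * h ^ 2) ^ n,
    ?_, fun x => ?_⟩
  · rw [pow_add, ← hα']
    linear_combination (- β' * ω ^ 2) * hT
  · have hpx : 0 < 1 + x ^ 2 := by positivity
    have e1 : |(p ^ r - C M⁻¹ * h ^ 2).eval x| ≤ (1 - μ / M) * (1 + x ^ 2) ^ r := by
      have h1 := hl x
      have h2 := hq x
      simp only [eval_pow] at h2
      rw [abs_of_nonneg (by positivity)] at h2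
      simp only [eval_sub, eval_pow, eval_mul, eval_C, hpe]
      have h3 : M⁻¹ * h.eval x ^ 2 ≤ (1 + x ^ 2) ^ r := by
        rw [inv_mul_le_iff₀ hM]; exact h2
      rw [abs_of_nonneg (by linarith)]
      have h4 : μ / M * (1 + x ^ 2) ^ r ≤ M⁻¹ * h.eval x ^ 2 := by
        rw [div_eq_inv_mul, mul_assoc]; gcongr
      linarith
    rw [eval_mul, eval_pow, abs_mul, abs_pow]
    have hθ : 0 ≤ 1 - μ / M := by
      rw [sub_nonneg, div_le_one hM]; exact hμM
    calc _ ≤ C₁ * (1 + x ^ 2) ^ r * ((1 - μ / M) * (1 + x ^ 2) ^ r) ^ n * (1 + x ^ 2) ^ m := by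
          gcongr; exact hb x
      _ = (C₁ * (1 - μ / M) ^ n) * (1 + x ^ 2) ^ (r + m + r * n) := by
          rw [mul_pow, pow_add, pow_add, pow_mul]; ring
      _ ≤ _ := by
          gcongr
          rw [lt_div_iff₀ hC₁] at hn; linarith
end BNS

namespace BNS
open Polynomial

theorem evalEval_zero_of_box {g : ℝ[X][X]} {s t : Set ℝ} (hs : s.Infinite) (ht : t.Infinite)
    (h : ∀ a ∈ s, ∀ b ∈ t, g.evalEval a b = 0) : g = 0 := by
  have h1 : ∀ a ∈ s, g.map (evalRingHom a) = 0 := by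
    intro a ha
    refine Polynomial.eq_zero_of_infinite_isRoot _ (ht.mono fun b hb => ?_)
    have := h a ha b hb
    rw [← map_evalRingHom_eval] at this
    exact this
  ext1 n
  rw [coeff_zero]
  refine Polynomial.eq_zero_of_infinite_isRoot _ (hs.mono fun a ha => ?_)
  have := congrArg (fun p => coeff p n) (h1 a ha)
  simpa using this

theorem continuous_evalEval (g : ℝ[X][X]) : Continuous fun p : ℝ × ℝ => g.evalEval p.1 p.2 := by
  have : (fun p : ℝ × ℝ => g.evalEval p.1 p.2) =
      fun p => ∑ i ∈ Finset.range (g.natDegree + 1), (g.coeff i).eval p.1 * p.2 ^ i := by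
    ext p
    rw [← map_evalRingHom_eval, eval_eq_sum_range' (n := g.natDegree + 1)
      (Nat.lt_succ_of_le natDegree_map_le)]
    simp
  rw [this]
  refine continuous_finsetSum _ fun i _ => ?_
  exact ((g.coeff i).continuous.comp continuous_fst).mul (continuous_snd.pow _)

theorem nn_of_sq_mul {g h : ℝ[X][X]} (hg : g ≠ 0) (H : ∀ a b, 0 ≤ (g ^ 2 * h).evalEval a b) :
    ∀ a b, 0 ≤ h.evalEval a b := by
  intro a b
  by_contra hx
  push Not at hx
  apply hg
  have hopen : IsOpen {p : ℝ × ℝ | h.evalEval p.1 p.2 < 0} :=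
    isOpen_lt (continuous_evalEval h) continuous_const
  have hmem : {p : ℝ × ℝ | h.evalEval p.1 p.2 < 0} ∈ nhds (a, b) := hopen.mem_nhds hx
  rw [nhds_prod_eq, Filter.mem_prod_iff] at hmem
  obtain ⟨s, hs, t, ht, hst⟩ := hmem
  refine evalEval_zero_of_box (infinite_of_mem_nhds a hs) (infinite_of_mem_nhds b ht) ?_
  intro x hx' y hy'
  have h1 : h.evalEval x y < 0 := hst (Set.mk_mem_prod hx' hy')
  have h2 := H x y
  simp only [evalEval_mul, evalEval_pow] at h2
  by_contra h0
  have : 0 < g.evalEval x y ^ 2 := by positivity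
  nlinarith

theorem IsSumSq_evalEval_nonneg {S : ℝ[X][X]} (h : IsSumSq S) (a b : ℝ) : 0 ≤ S.evalEval a b := by
  have := isSumSq_map (evalEvalRingHom a b) h
  exact this.nonneg

theorem C_dvd_of_map_eq_zero {p : ℝ[X][X]} {a : ℝ} (h : p.map (evalRingHom a) = 0) :
    ∃ p', p = C (X - C a) * p' := by
  have : C (X - C a) ∣ p := by
    rw [C_dvd_iff_dvd_coeff]
    intro i
    rw [dvd_iff_isRoot]
    have := congrArg (fun p => coeff p i) h
    simpa using this
  exact this

theorem real_formallyReal {S : ℝ[X]} (h : IsSumSq S) {a : ℝ[X]} (h0 : a * a + S = 0) :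
    a = 0 ∧ S = 0 := by
  have key : ∀ x, a.eval x = 0 ∧ S.eval x = 0 := by
    intro x
    have h1 := congrArg (eval x) h0
    have h2 : 0 ≤ S.eval x := (isSumSq_map (evalRingHom x) h).nonneg
    simp only [eval_add, eval_mul, eval_zero] at h1
    constructor <;> nlinarith [mul_self_nonneg (a.eval x)]
  exact ⟨Polynomial.funext fun x => by simp [(key x).1], Polynomial.funext fun x => by simp [(key x).2]⟩

theorem biv_formallyReal {S : ℝ[X][X]} (h : IsSumSq S) {a : ℝ[X][X]} (h0 : a * a + S = 0) :
    a = 0 := by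
  apply evalEval_zero_of_box Set.infinite_univ Set.infinite_univ
  intro x _ y _
  have h1 := congrArg (evalEval x y) h0
  have h2 := IsSumSq_evalEval_nonneg h x y
  simp only [evalEval_add, evalEval_mul, evalEval_zero] at h1
  nlinarith [mul_self_nonneg (a.evalEval x y)]

theorem divide_sq {S : ℝ[X][X]} (h : IsSumSq S) {a : ℝ} (h0 : S.map (evalRingHom a) = 0) :
    ∃ S', IsSumSq S' ∧ S = C (X - C a) ^ 2 * S' := by
  induction h with
  | zero => exact ⟨0, IsSumSq.zero, by simp⟩
  | sq_add p hs ih =>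
    rename_i s
    rw [Polynomial.map_add, Polynomial.map_mul] at h0
    have hs' : IsSumSq (s.map (evalRingHom a)) := isSumSq_map (mapRingHom (evalRingHom a)) hs
    obtain ⟨h1, h2⟩ := real_formallyReal hs' h0
    obtain ⟨p', rfl⟩ := C_dvd_of_map_eq_zero h1
    obtain ⟨S', hS', rfl⟩ := ih h2
    exact ⟨p' * p' + S', (IsSumSq.mul_self _).add hS', by ring⟩

theorem remove_real_zeros {F : ℝ[X][X]} {h : ℝ[X]} (h0 : h ≠ 0) (hs : IsSumSq (C h ^ 2 * F)) :
    ∃ h' : ℝ[X], (∀ x, h'.eval x ≠ 0) ∧ IsSumSq (C h' ^ 2 * F) := by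
  induction hn : h.natDegree generalizing h with
  | zero =>
    obtain ⟨a, rfl⟩ := natDegree_eq_zero.1 hn
    exact ⟨C a, by simpa using h0, hs⟩
  | succ n ih =>
  by_cases hr : ∃ a, h.IsRoot a
  · obtain ⟨a, ha⟩ := hr
    obtain ⟨p1, rfl⟩ := dvd_iff_isRoot.2 ha
    have hp1 := right_ne_zero_of_mul h0
    rw [natDegree_mul (X_sub_C_ne_zero a) hp1, natDegree_X_sub_C] at hn
    refine ih hp1 ?_ (by omega)
    obtain ⟨S', hS', he⟩ := divide_sq hs (a := a) (by simp)
    have : C p1 ^ 2 * F = S' := by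
      have hne : (C (X - C a) : ℝ[X][X]) ^ 2 ≠ 0 :=
        pow_ne_zero _ (C_ne_zero.2 (X_sub_C_ne_zero a))
      apply mul_left_cancel₀ hne
      rw [← he, C_mul]; ring
    rwa [this]
  · push Not at hr
    exact ⟨h, hr, hs⟩

theorem isSumSq_iff_fin {R : Type*} [CommSemiring R] {s : R} :
    IsSumSq s ↔ ∃ (m : ℕ) (v : Fin m → R), s = ∑ i, v i * v i := by
  constructor
  · intro h
    induction h with
    | zero => exact ⟨0, Fin.elim0, by simp⟩
    | sq_add a hs ih =>
      obtain ⟨m, v, rfl⟩ := ih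
      exact ⟨m + 1, Fin.cons a v, by simp [Fin.sum_univ_succ]⟩
  · rintro ⟨m, v, rfl⟩
    exact IsSumSq.sum_mul_self _ _

/-- Cassels' theorem for sums of squares. -/
theorem cassels {K : Type*} [Field K]
    (hreal : ∀ (s a : K[X]), IsSumSq s → a * a + s = 0 → a = 0)
    {F H : K[X]} (hH : H ≠ 0) (h : IsSumSq (H ^ 2 * F)) : IsSumSq F := by
  obtain ⟨m, v, hv⟩ := isSumSq_iff_fin.1 h
  clear h
  induction hn : H.natDegree using Nat.strong_induction_on generalizing H v with
  | _ n ih =>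
  set q := fun i => v i / H with hq
  set r := fun i => v i % H with hr
  have hdiv : ∀ i, v i = H * q i + r i := fun i => (EuclideanDomain.div_add_mod (v i) H).symm
  by_cases hr0 : ∀ i, r i = 0
  · have : F = ∑ i, q i * q i := by
      apply mul_left_cancel₀ (pow_ne_zero 2 hH)
      rw [hv, Finset.mul_sum]
      refine Finset.sum_congr rfl fun i _ => ?_
      rw [hdiv i, hr0 i]; ring
    rw [this]; exact IsSumSq.sum_mul_self _ _
  · set a := ∑ i, q i * q i - F with ha
    set b := 2 * (F * H - ∑ i, q i * v i) with hb
    have e1 : H * (a * H + b) = ∑ i, r i * r i := by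
      have : ∑ i, r i * r i = ∑ i, v i * v i - 2 * H * ∑ i, q i * v i
          + H ^ 2 * ∑ i, q i * q i := by
        rw [Finset.mul_sum, Finset.mul_sum, ← Finset.sum_sub_distrib, ← Finset.sum_add_distrib]
        refine Finset.sum_congr rfl fun i _ => ?_
        have : r i = v i - H * q i := by rw [hdiv i]; ring
        rw [this]; ring
      rw [this, ← hv]; simp only [ha, hb]; ring
    have e2 : (a * H + b) ^ 2 * F = ∑ i, (a * v i + b * q i) * (a * v i + b * q i) := by
      have : ∑ i, (a * v i + b * q i) * (a * v i + b * q i) = a ^ 2 * ∑ i, v i * v i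
          + 2 * a * b * ∑ i, q i * v i + b ^ 2 * ∑ i, q i * q i := by
        rw [Finset.mul_sum, Finset.mul_sum, Finset.mul_sum, ← Finset.sum_add_distrib,
          ← Finset.sum_add_distrib]
        refine Finset.sum_congr rfl fun i _ => ?_
        ring
      have h3 : ∑ i, q i * q i = a + F := by rw [ha]; ring
      rw [this, ← hv, h3]
      have h4 : b = 2 * (F * H - ∑ i, q i * v i) := hb
      linear_combination (- a * b) * h4
    have e3 : ∑ i, r i * r i ≠ 0 := by
      intro h0
      apply hr0
      intro i
      rw [← Finset.add_sum_erase _ _ (Finset.mem_univ i)] at h0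
      exact hreal _ _ (IsSumSq.sum_mul_self _ _) h0
    have hne : a * H + b ≠ 0 := by
      intro h0; rw [h0, mul_zero] at e1; exact e3 e1.symm
    have hdeg : (a * H + b).degree < H.degree := by
      have h1 : (∑ i, r i * r i).degree < H.degree + H.degree := by
        refine (degree_sum_le _ _).trans_lt ?_
        rw [Finset.sup_lt_iff]
        · intro i _
          rw [degree_mul]
          have := EuclideanDomain.mod_lt (v i) hH
          change (r i).degree < H.degree at this
          by_cases h0 : r i = 0
          · rw [h0, degree_zero, degree_eq_natDegree hH]
            exact WithBot.bot_lt_coe _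
          · rw [degree_eq_natDegree h0, degree_eq_natDegree hH] at *
            norm_cast at *
            omega
        · rw [degree_eq_natDegree hH]; exact WithBot.bot_lt_coe _
      rw [← e1, degree_mul, degree_eq_natDegree hH, degree_eq_natDegree hne] at h1
      rw [degree_eq_natDegree hH, degree_eq_natDegree hne]
      norm_cast at *
      omega
    exact ih _ (by rw [← hn]; exact natDegree_lt_natDegree hne hdeg) hne _ e2 rfl

abbrev KK := FractionRing ℝ[X]

/-- the inclusion of `ℝ[x][y]` into `ℝ(x)[y]`. -/
noncomputable abbrev toK (f : ℝ[X][X]) : KK[X] := f.map (algebraMap ℝ[X] KK)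

theorem toK_injective : Function.Injective toK :=
  Polynomial.map_injective _ (IsFractionRing.injective ℝ[X] KK)

theorem clear_one (p : KK[X]) : ∃ (r : ℝ[X]) (P : ℝ[X][X]), r ≠ 0 ∧ toK P = toK (C r) * p := by
  obtain ⟨b, hb, h⟩ := IsLocalization.integerNormalization_spec (nonZeroDivisors ℝ[X]) p
  refine ⟨b, _, nonZeroDivisors.ne_zero hb, h.trans ?_⟩
  rw [toK, Polynomial.map_C, Algebra.smul_def, IsScalarTower.algebraMap_apply ℝ[X] KK KK[X]]
  rfl

theorem clear_sumSq {s : KK[X]} (hs : IsSumSq s) : ∃ (r : ℝ[X]) (S : ℝ[X][X]), r ≠ 0 ∧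
    IsSumSq S ∧ toK S = toK (C r) ^ 2 * s := by
  induction hs with
  | zero => exact ⟨1, 0, one_ne_zero, IsSumSq.zero, by simp⟩
  | sq_add a hs ih =>
    obtain ⟨r, S, hr, hS, h⟩ := ih
    obtain ⟨t, P, ht, hP⟩ := clear_one a
    refine ⟨r * t, (C r * P) * (C r * P) + C t ^ 2 * S, mul_ne_zero hr ht,
      (IsSumSq.mul_self _).add ((isSumSq_sq _).mul hS), ?_⟩
    simp only [toK, Polynomial.map_add, Polynomial.map_mul, Polynomial.map_pow, C_mul] at *
    rw [h, hP]; ring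

theorem KK_real : ∀ (s a : KK[X]), IsSumSq s → a * a + s = 0 → a = 0 := by
  intro s a hs h0
  obtain ⟨r, S, hr, hS, h⟩ := clear_sumSq hs
  obtain ⟨t, P, ht, hP⟩ := clear_one a
  have h1 : (C r * P) * (C r * P) + C t ^ 2 * S = 0 := by
    apply toK_injective
    simp only [toK, Polynomial.map_add, Polynomial.map_mul, Polynomial.map_pow,
      Polynomial.map_zero] at *
    rw [h, hP]
    linear_combination ((C r).map (algebraMap ℝ[X] KK) ^ 2 * (C t).map (algebraMap ℝ[X] KK) ^ 2) * h0
  have h2 := biv_formallyReal ((isSumSq_sq _).mul hS) h1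
  have h3 : P = 0 := (mul_eq_zero.1 h2).resolve_left (C_ne_zero.2 hr)
  rw [h3] at hP
  simp only [toK, Polynomial.map_zero, Polynomial.map_C] at hP
  refine (mul_eq_zero.1 hP.symm).resolve_left ?_
  rw [C_eq_zero]
  simpa using ht

/-- If `g^2 f` is a sum of squares then `r^2 f` is, with `r` only depending on `x`. -/
theorem cassels_biv {f g : ℝ[X][X]} (hg : g ≠ 0) (h : IsSumSq (g ^ 2 * f)) :
    ∃ r : ℝ[X], r ≠ 0 ∧ IsSumSq (C r ^ 2 * f) := by
  have h1 : IsSumSq (toK g ^ 2 * toK f) := by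
    have := isSumSq_map (mapRingHom (algebraMap ℝ[X] KK)) h
    simpa [toK] using this
  have h2 := cassels KK_real (by
    intro h0; apply hg; apply toK_injective; rw [h0]; simp [toK]) h1
  obtain ⟨r, S, hr, hS, he⟩ := clear_sumSq h2
  refine ⟨r, hr, ?_⟩
  have : C r ^ 2 * f = S := by
    apply toK_injective
    rw [he]; simp [toK]
  rwa [this]
end BNS

namespace BNS
open Polynomial

theorem exists_order {L : Type*} [Field L] (h : ¬ IsSumSq (-1 : L)) :
    ∃ o : LinearOrder L, @IsStrictOrderedRing L _ o.toPartialOrder := by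
  classical
  -- preorderings as sets
  let Pre : Set (Set L) := {P | (∀ a b, a ∈ P → b ∈ P → a + b ∈ P) ∧
    (∀ a b, a ∈ P → b ∈ P → a * b ∈ P) ∧ (∀ a, a * a ∈ P) ∧ (-1 : L) ∉ P}
  have h0 : {s : L | IsSumSq s} ∈ Pre :=
    ⟨fun a b ha hb => IsSumSq.add ha hb, fun a b ha hb => IsSumSq.mul ha hb,
      fun a => IsSumSq.mul_self a, h⟩
  obtain ⟨P, -, hP⟩ := zorn_subset_nonempty Pre (by
    intro c hc hchain hne
    refine ⟨⋃₀ c, ⟨?_, ?_, ?_, ?_⟩, fun s hs => Set.subset_sUnion_of_mem hs⟩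
    · rintro a b ⟨s, hs, ha⟩ ⟨t, ht, hb⟩
      rcases hchain.total hs ht with h | h
      · exact ⟨t, ht, (hc ht).1 _ _ (h ha) hb⟩
      · exact ⟨s, hs, (hc hs).1 _ _ ha (h hb)⟩
    · rintro a b ⟨s, hs, ha⟩ ⟨t, ht, hb⟩
      rcases hchain.total hs ht with h | h
      · exact ⟨t, ht, (hc ht).2.1 _ _ (h ha) hb⟩
      · exact ⟨s, hs, (hc hs).2.1 _ _ ha (h hb)⟩
    · intro a
      obtain ⟨s, hs⟩ := hne
      exact ⟨s, hs, (hc hs).2.2.1 a⟩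
    · rintro ⟨s, hs, h1⟩
      exact (hc hs).2.2.2 h1) _ h0
  obtain ⟨hadd, hmul, hsq, hneg⟩ := hP.prop
  have hone : (1 : L) ∈ P := by simpa using hsq 1
  have hzero : (0 : L) ∈ P := by simpa using hsq 0
  have htot : ∀ a, a ∈ P ∨ -a ∈ P := by
    intro a
    by_contra hcon
    push Not at hcon
    obtain ⟨ha, hna⟩ := hcon
    -- P - a P
    let Q : Set L := {s | ∃ p ∈ P, ∃ q ∈ P, s = p - a * q}
    have hPQ : P ⊆ Q := fun p hp => ⟨p, hp, 0, hzero, by simp⟩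
    have haQ : -a ∈ Q := ⟨0, hzero, 1, hone, by simp⟩
    have hQ : Q ∈ Pre := by
      refine ⟨?_, ?_, fun b => hPQ (hsq b), ?_⟩
      · rintro _ _ ⟨p, hp, q, hq, rfl⟩ ⟨p', hp', q', hq', rfl⟩
        exact ⟨p + p', hadd _ _ hp hp', q + q', hadd _ _ hq hq', by ring⟩
      · rintro _ _ ⟨p, hp, q, hq, rfl⟩ ⟨p', hp', q', hq', rfl⟩
        exact ⟨p * p' + (a * a) * (q * q'),
          hadd _ _ (hmul _ _ hp hp') (hmul _ _ (hsq a) (hmul _ _ hq hq')),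
          p * q' + q * p', hadd _ _ (hmul _ _ hp hq') (hmul _ _ hq hp'), by ring⟩
      · rintro ⟨p, hp, q, hq, he⟩
        have hq0 : q ≠ 0 := by
          rintro rfl
          apply hneg
          rw [he]; simpa using hp
        apply ha
        have : a = (1 + p) * q * (q⁻¹ * q⁻¹) := by
          field_simp
          linear_combination he
        rw [this]
        exact hmul _ _ (hmul _ _ (hadd _ _ hone hp) hq) (hsq _)
    exact hna (hP.le_of_ge hQ hPQ haQ)
  have hanti : ∀ a, a ∈ P → -a ∈ P → a = 0 := by
    intro a ha hna
    by_contra h0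
    apply hneg
    have : (-1 : L) = a * (-a) * (a⁻¹ * a⁻¹) := by field_simp
    rw [this]
    exact hmul _ _ (hmul _ _ ha hna) (hsq _)
  let o : LinearOrder L :=
    { le := fun a b => b - a ∈ P
      le_refl := fun a => by simpa using hzero
      le_trans := fun a b c hab hbc => by
        have := hadd _ _ hbc hab
        simpa using this
      le_antisymm := fun a b hab hba => by
        have := hanti _ hab (by simpa using hba)
        exact (sub_eq_zero.1 this).symm
      le_total := fun a b => by
        have := htot (b - a)
        simpa using this
      toDecidableLE := Classical.decRel _ }
  refine ⟨o, ?_⟩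
  have : @IsOrderedRing L _ o.toPartialOrder := by
    refine @IsOrderedRing.of_mul_nonneg L _ o.toPartialOrder ?_ ?_ ?_
    · refine { add_le_add_left := ?_ }
      intro a b hab c
      change b + c - (a + c) ∈ P
      have : b - a ∈ P := hab
      simpa using this
    · refine @ZeroLEOneClass.mk L _ _ _ ?_
      change (1 : L) - 0 ∈ P
      simpa using hone
    · intro a b ha hb
      change a * b - 0 ∈ P
      have ha' : a - 0 ∈ P := ha
      have hb' : b - 0 ∈ P := hb
      rw [sub_zero] at *
      exact hmul _ _ ha' hb'
  exact @IsOrderedRing.toIsStrictOrderedRing L _ o.toPartialOrder this _ _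

/-- Core lemma: nonnegative polynomial cannot have a smooth zero over a DVR with residue
field `ℝ`. -/
theorem core_dvr {V : Type*} [CommRing V] [IsDomain V] [IsDiscreteValuationRing V] [Algebra ℝ V]
    (π : V →ₐ[ℝ] ℝ) (g : MvPolynomial (Fin 3) ℝ)
    (hg : ∀ a b c : ℝ, 0 ≤ MvPolynomial.eval ![a, b, c] g) (z x y : V)
    (h0 : MvPolynomial.aeval ![z, x, y] g = 0)
    (h1 : (derivative (MvPolynomial.aeval ![C z, C x, (X : V[X])] g)).eval y ≠ 0) : False := by
  obtain ⟨t, ht⟩ := IsDiscreteValuationRing.exists_irreducible V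
  have hmax : ∀ a : V, ¬ IsUnit a → t ∣ a := by
    intro a ha
    have : a ∈ IsLocalRing.maximalIdeal V := ha
    rwa [ht.maximalIdeal_eq, Ideal.mem_span_singleton] at this
  have hπ : ∀ a : V, π a = 0 → t ∣ a := by
    intro a ha
    refine hmax a fun hu => ?_
    exact (hu.map π).ne_zero ha
  have hπt : π t = 0 := by
    by_contra h
    have h2 := hπ (t - algebraMap ℝ V (π t)) (by simp)
    have h3 : t ∣ algebraMap ℝ V (π t) := by
      simpa using dvd_sub (dvd_refl t) h2
    exact ht.not_isUnit (isUnit_of_dvd_unit h3 ((IsUnit.mk0 _ h).map (algebraMap ℝ V)))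
  have happrox : ∀ (R : ℕ) (a : V), ∃ α : ℝ[X], t ^ R ∣ aeval t α - a := by
    intro R
    induction R with
    | zero => intro a; exact ⟨0, by simp⟩
    | succ R ih =>
      intro a
      obtain ⟨a', ha'⟩ := hπ (a - algebraMap ℝ V (π a)) (by simp)
      obtain ⟨α, b, hb⟩ := ih a'
      refine ⟨C (π a) + X * α, b, ?_⟩
      simp only [map_add, aeval_C, map_mul, aeval_X]
      linear_combination t * hb - ha'
  set φ := MvPolynomial.aeval ![C z, C x, (X : V[X])] g with hφ
  have hφe : ∀ s, φ.eval s = MvPolynomial.aeval ![z, x, s] g := by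
    intro s
    rw [hφ, ← coe_evalRingHom, MvPolynomial.map_aeval, MvPolynomial.aeval_def,
      MvPolynomial.coe_eval₂Hom]
    congr 1
    · ext r; simp [algebraMap_def]
    · ext i; fin_cases i <;> simp
  obtain ⟨k, c, hc⟩ := IsDiscreteValuationRing.eq_unit_mul_pow_irreducible h1 ht
  obtain ⟨ζ, hζ⟩ := happrox (2 * k + 2) z
  obtain ⟨ξ, hξ⟩ := happrox (2 * k + 2) x
  obtain ⟨η, hη⟩ := happrox (2 * k + 2) y
  set F : ℝ[X] := MvPolynomial.aeval ![ζ, ξ, η + X ^ (k + 1)] g with hF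
  have hFnn : ∀ s, 0 ≤ F.eval s := by
    intro s
    have := hg (ζ.eval s) (ξ.eval s) ((η + X ^ (k + 1)).eval s)
    convert this
    rw [hF, ← coe_evalRingHom, MvPolynomial.map_aeval, MvPolynomial.coe_eval₂Hom,
      MvPolynomial.eval, MvPolynomial.coe_eval₂Hom]
    congr 1
    · ext r; simp [algebraMap_def]
    · ext i; fin_cases i <;> simp
  have hFt : aeval t F = MvPolynomial.aeval ![aeval t ζ, aeval t ξ, aeval t η + t ^ (k + 1)] g := by
    rw [hF, ← AlgHom.comp_apply, MvPolynomial.comp_aeval]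
    congr 2
    ext i; fin_cases i <;> simp
  have hcong : t ^ (2 * k + 2) ∣ aeval t F - φ.eval (y + t ^ (k + 1)) := by
    rw [hFt, hφe, ← Ideal.mem_span_singleton, ← Ideal.Quotient.eq]
    rw [← Ideal.Quotient.mkₐ_eq_mk ℝ, ← AlgHom.comp_apply, ← AlgHom.comp_apply,
      MvPolynomial.comp_aeval, MvPolynomial.comp_aeval]
    congr 2
    ext i
    fin_cases i
    · simp only [Ideal.Quotient.mkₐ_eq_mk, Function.comp]
      exact Ideal.Quotient.eq.2 (Ideal.mem_span_singleton.2 hζ)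
    · simp only [Ideal.Quotient.mkₐ_eq_mk, Function.comp]
      exact Ideal.Quotient.eq.2 (Ideal.mem_span_singleton.2 hξ)
    · simp only [Ideal.Quotient.mkₐ_eq_mk, Function.comp]
      refine Ideal.Quotient.eq.2 (Ideal.mem_span_singleton.2 ?_)
      simpa using hη
  obtain ⟨w, hw⟩ := hcong
  obtain ⟨r, hr⟩ := φ.binomExpansion y (t ^ (k + 1))
  rw [hφe y, h0, hc] at hr
  have hval : aeval t F = t ^ (2 * k + 1) * (c + t * (r + w)) := by
    rw [hr] at hw
    linear_combination hw
  have hunit : IsUnit ((c : V) + t * (r + w)) := by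
    by_contra hcon
    have h2 := hmax _ hcon
    rw [dvd_add_left (dvd_mul_right _ _)] at h2
    exact ht.not_isUnit (isUnit_of_dvd_unit h2 c.isUnit)
  have hF0 : F ≠ 0 := by
    intro h
    rw [h, map_zero] at hval
    exact (mul_ne_zero (pow_ne_zero _ ht.ne_zero) hunit.ne_zero) hval.symm
  obtain ⟨G, hG, hG0⟩ := exists_eq_pow_rootMultiplicity_mul_and_not_dvd F hF0 0
  set m := F.rootMultiplicity 0
  rw [C_0, sub_zero] at hG hG0
  have hG1 : G.eval 0 ≠ 0 := by
    rw [← coeff_zero_eq_eval_zero]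
    rwa [X_dvd_iff] at hG0
  have hGu : IsUnit (aeval t G) := by
    by_contra hcon
    obtain ⟨b, hb⟩ := hmax _ hcon
    have h3 : π (aeval t G) = G.eval 0 := by
      rw [← aeval_algHom_apply, hπt]; simp
    rw [hb, map_mul, hπt, zero_mul] at h3
    exact hG1 h3.symm
  have hm : m = 2 * k + 1 := by
    rw [hG, map_mul, map_pow, aeval_X] at hval
    have := IsDiscreteValuationRing.unit_mul_pow_congr_pow ht ht hGu.unit hunit.unit m (2 * k + 1)
      (by simp only [IsUnit.unit_spec]; linear_combination hval)
    exact this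
  have hXG : ∀ s, 0 ≤ (X * G).eval s := by
    refine nonneg_of_sq_mul (q := X ^ k) (pow_ne_zero _ X_ne_zero) ?_
    intro s
    have := hFnn s
    rw [hG, hm] at this
    convert this using 2
    ring
  have hmin : IsLocalMin (fun x => (X * G).eval x) 0 := by
    filter_upwards with s
    simpa using hXG s
  have hd := hmin.deriv_eq_zero
  rw [Polynomial.deriv] at hd
  apply hG1
  simpa [derivative_mul] using hd
end BNS

namespace BNS
open Polynomial

/-- evaluation of a bivariate polynomial in an `ℝ`-algebra -/
noncomputable def ev {F : Type*} [CommRing F] [Algebra ℝ F] (a b : F) : ℝ[X][X] →+* F :=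
  eval₂RingHom (aeval a : ℝ[X] →ₐ[ℝ] F).toRingHom b

theorem ev_real (a b : ℝ) (f : ℝ[X][X]) : ev a b f = f.evalEval a b := by
  rw [ev, ← map_evalRingHom_eval, coe_eval₂RingHom, eval_map]
  congr 1

theorem homog (f : ℝ[X][X]) : ∃ (M : ℕ) (g : MvPolynomial (Fin 3) ℝ),
    ∀ (F : Type) [Field F] [Algebra ℝ F] (z a b : F), z ≠ 0 →
      MvPolynomial.aeval ![z, a, b] g = z ^ M * ev (a / z) (b / z) f := by
  have hadd : ∀ p q : ℝ[X][X], (∃ (M : ℕ) (g : MvPolynomial (Fin 3) ℝ),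
    ∀ (F : Type) [Field F] [Algebra ℝ F] (z a b : F), z ≠ 0 →
      MvPolynomial.aeval ![z, a, b] g = z ^ M * ev (a / z) (b / z) p) →
    (∃ (M : ℕ) (g : MvPolynomial (Fin 3) ℝ),
    ∀ (F : Type) [Field F] [Algebra ℝ F] (z a b : F), z ≠ 0 →
      MvPolynomial.aeval ![z, a, b] g = z ^ M * ev (a / z) (b / z) q) →
    (∃ (M : ℕ) (g : MvPolynomial (Fin 3) ℝ),
    ∀ (F : Type) [Field F] [Algebra ℝ F] (z a b : F), z ≠ 0 →
      MvPolynomial.aeval ![z, a, b] g = z ^ M * ev (a / z) (b / z) (p + q)) := by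
    rintro p q ⟨M, g, hg⟩ ⟨N, k, hk⟩
    refine ⟨M + N, MvPolynomial.X 0 ^ N * g + MvPolynomial.X 0 ^ M * k, ?_⟩
    intro F _ _ z a b hz
    simp only [map_add, map_mul, map_pow, hg F z a b hz, hk F z a b hz, MvPolynomial.aeval_X,
      Matrix.cons_val_zero]
    ring
  have hmul : ∀ p q : ℝ[X][X], (∃ (M : ℕ) (g : MvPolynomial (Fin 3) ℝ),
    ∀ (F : Type) [Field F] [Algebra ℝ F] (z a b : F), z ≠ 0 →
      MvPolynomial.aeval ![z, a, b] g = z ^ M * ev (a / z) (b / z) p) →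
    (∃ (M : ℕ) (g : MvPolynomial (Fin 3) ℝ),
    ∀ (F : Type) [Field F] [Algebra ℝ F] (z a b : F), z ≠ 0 →
      MvPolynomial.aeval ![z, a, b] g = z ^ M * ev (a / z) (b / z) q) →
    (∃ (M : ℕ) (g : MvPolynomial (Fin 3) ℝ),
    ∀ (F : Type) [Field F] [Algebra ℝ F] (z a b : F), z ≠ 0 →
      MvPolynomial.aeval ![z, a, b] g = z ^ M * ev (a / z) (b / z) (p * q)) := by
    rintro p q ⟨M, g, hg⟩ ⟨N, k, hk⟩
    refine ⟨M + N, g * k, ?_⟩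
    intro F _ _ z a b hz
    simp only [map_mul, hg F z a b hz, hk F z a b hz]
    ring
  have hX : ∃ (M : ℕ) (g : MvPolynomial (Fin 3) ℝ),
    ∀ (F : Type) [Field F] [Algebra ℝ F] (z a b : F), z ≠ 0 →
      MvPolynomial.aeval ![z, a, b] g = z ^ M * ev (a / z) (b / z) X := by
    refine ⟨1, MvPolynomial.X 2, ?_⟩
    intro F _ _ z a b hz
    simp [ev]
    field_simp
  have hCX : ∃ (M : ℕ) (g : MvPolynomial (Fin 3) ℝ),
    ∀ (F : Type) [Field F] [Algebra ℝ F] (z a b : F), z ≠ 0 →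
      MvPolynomial.aeval ![z, a, b] g = z ^ M * ev (a / z) (b / z) (C X) := by
    refine ⟨1, MvPolynomial.X 1, ?_⟩
    intro F _ _ z a b hz
    simp [ev]
    field_simp
  have hCC : ∀ r : ℝ, ∃ (M : ℕ) (g : MvPolynomial (Fin 3) ℝ),
    ∀ (F : Type) [Field F] [Algebra ℝ F] (z a b : F), z ≠ 0 →
      MvPolynomial.aeval ![z, a, b] g = z ^ M * ev (a / z) (b / z) (C (C r)) := by
    intro r
    refine ⟨0, MvPolynomial.C r, ?_⟩
    intro F _ _ z a b hz
    simp [ev]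
  have hC : ∀ p : ℝ[X], ∃ (M : ℕ) (g : MvPolynomial (Fin 3) ℝ),
    ∀ (F : Type) [Field F] [Algebra ℝ F] (z a b : F), z ≠ 0 →
      MvPolynomial.aeval ![z, a, b] g = z ^ M * ev (a / z) (b / z) (C p) := by
    intro p
    induction p using Polynomial.induction_on with
    | C r => exact hCC r
    | add p q hp hq => rw [C_add]; exact hadd _ _ hp hq
    | monomial n r h =>
      rw [pow_succ, ← mul_assoc, C_mul]
      exact hmul _ _ h hCX
  induction f using Polynomial.induction_on with
  | C r => exact hC r
  | add p q hp hq => exact hadd _ _ hp hq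
  | monomial n r h =>
    rw [pow_succ, ← mul_assoc]
    exact hmul _ _ h hX

/-- Homogenization of a nonnegative polynomial. -/
theorem homog_nn (f : ℝ[X][X]) (hf : ∀ a b, 0 ≤ f.evalEval a b) :
    ∃ (M : ℕ) (g : MvPolynomial (Fin 3) ℝ), (∀ a b c : ℝ, 0 ≤ MvPolynomial.eval ![a, b, c] g) ∧
    ∀ (F : Type) [Field F] [Algebra ℝ F] (z a b : F), z ≠ 0 →
      MvPolynomial.aeval ![z, a, b] g = z ^ M * ev (a / z) (b / z) f := by
  obtain ⟨M, g, hg⟩ := homog f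
  have key : ∀ (F : Type) [Field F] [Algebra ℝ F] (z a b : F), z ≠ 0 →
      MvPolynomial.aeval ![z, a, b] (MvPolynomial.X 0 ^ (M + 2) * g)
        = z ^ (2 * (M + 1)) * ev (a / z) (b / z) f := by
    intro F _ _ z a b hz
    simp only [map_mul, map_pow, hg F z a b hz, MvPolynomial.aeval_X, Matrix.cons_val_zero]
    ring
  refine ⟨_, _, ?_, key⟩
  intro z a b
  by_cases hz : z = 0
  · subst hz; simp
  · have := key ℝ z a b hz
    rw [MvPolynomial.aeval_eq_eval] at this
    change MvPolynomial.eval _ _ = _ at this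
    rw [this, ev_real, pow_mul]
    exact mul_nonneg (by positivity) (hf _ _)

/-- derivative in the last variable -/
noncomputable def dl {F : Type*} [CommRing F] [Algebra ℝ F] (z x y : F)
    (g : MvPolynomial (Fin 3) ℝ) : F :=
  (derivative (MvPolynomial.aeval ![C z, C x, (X : F[X])] g)).eval y

theorem dl_map {F G : Type*} [CommRing F] [Algebra ℝ F] [CommRing G] [Algebra ℝ G] (φ : F →ₐ[ℝ] G)
    (z x y : F) (g : MvPolynomial (Fin 3) ℝ) : φ (dl z x y g) = dl (φ z) (φ x) (φ y) g := by
  have h1 : (mapAlgHom φ (MvPolynomial.aeval ![C z, C x, (X : F[X])] g)) =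
      MvPolynomial.aeval ![C (φ z), C (φ x), (X : G[X])] g := by
    rw [← AlgHom.comp_apply]
    congr 1
    ext i
    fin_cases i <;> simp
  rw [dl, dl, ← h1, coe_mapAlgHom, derivative_map]
  exact (eval_map_apply (f := φ.toRingHom) _).symm

theorem aeval_map3 {F G : Type*} [CommRing F] [Algebra ℝ F] [CommRing G] [Algebra ℝ G]
    (φ : F →ₐ[ℝ] G)
    (z x y : F) (g : MvPolynomial (Fin 3) ℝ) : φ (MvPolynomial.aeval ![z, x, y] g) =
      MvPolynomial.aeval ![φ z, φ x, φ y] g := by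
  rw [← AlgHom.comp_apply]
  congr 1
  ext i
  fin_cases i <;> simp

theorem dl_homog {f : ℝ[X][X]} {M : ℕ} {g : MvPolynomial (Fin 3) ℝ}
    (H : ∀ (F : Type) [Field F] [Algebra ℝ F] (z a b : F), z ≠ 0 →
      MvPolynomial.aeval ![z, a, b] g = z ^ M * ev (a / z) (b / z) f)
    {L : Type} [Field L] [CharZero L] [Algebra ℝ L] (z x y : L) (hz : z ≠ 0) :
    dl z x y g = z ^ M * z⁻¹ * ev (x / z) (y / z) (derivative f) := by
  have h1 : (MvPolynomial.aeval ![C z, C x, (X : L[X])] g) =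
      C (z ^ M) * (f.map (aeval (x / z) : ℝ[X] →ₐ[ℝ] L).toRingHom).comp (C z⁻¹ * X) := by
    apply Polynomial.funext
    intro t
    have h2 : eval t (MvPolynomial.aeval ![C z, C x, (X : L[X])] g) =
      MvPolynomial.aeval ![z, x, t] g := by
      have := aeval_map3 ((aeval t : L[X] →ₐ[L] L).restrictScalars ℝ) (C z) (C x) X g
      simpa [← coe_aeval_eq_eval] using this
    rw [h2, H L z x t hz]
    simp only [eval_mul, eval_C, eval_comp, eval_X, ev, coe_eval₂RingHom, eval_map]
    congr 2
    rw [div_eq_inv_mul]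
  rw [dl, h1]
  simp only [derivative_C_mul, derivative_comp, derivative_map, eval_mul, eval_C, eval_comp, eval_X,
    ev, coe_eval₂RingHom, eval_map, derivative_X, mul_one]
  rw [div_eq_inv_mul y]
  ring
end BNS

namespace BNS
open Polynomial

theorem core_ded {B : Type} [CommRing B] [IsDedekindDomain B] [Algebra ℝ B] (π : B →ₐ[ℝ] ℝ)
    (V : Type) [CommRing V] [IsDomain V] [Algebra B V] [Algebra ℝ V] [IsScalarTower ℝ B V] (p : Ideal B)
    [p.IsPrime] (hpπ : p = RingHom.ker π) (hp0 : p ≠ ⊥) [IsLocalization.AtPrime V p]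
    (g : MvPolynomial (Fin 3) ℝ)
    (hg : ∀ a b c : ℝ, 0 ≤ MvPolynomial.eval ![a, b, c] g) (z x y : B)
    (h0 : MvPolynomial.aeval ![z, x, y] g = 0)
    (h1 : dl z x y g ≠ 0) : False := by
  have : IsDiscreteValuationRing V :=
    IsLocalization.AtPrime.isDiscreteValuationRing_of_dedekind_domain B hp0 _
  have hunit : ∀ s : p.primeCompl, IsUnit (π.toRingHom s) := by
    intro s
    refine isUnit_iff_ne_zero.2 fun h => s.2 ?_
    have hs : (s : B) ∈ RingHom.ker π := h
    exact hpπ.ge hs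
  let πV : V →ₐ[ℝ] ℝ :=
    { IsLocalization.lift (M := p.primeCompl) (S := V) hunit with
      commutes' := fun r => by
        change IsLocalization.lift (M := p.primeCompl) (S := V) hunit _ = _
        rw [IsScalarTower.algebraMap_apply ℝ B V, IsLocalization.lift_eq]
        exact π.commutes r }
  let κ : B →ₐ[ℝ] V := IsScalarTower.toAlgHom ℝ B V
  have hκ : Function.Injective κ :=
    IsLocalization.injective V p.primeCompl_le_nonZeroDivisors
  refine core_dvr πV g hg (κ z) (κ x) (κ y) ?_ ?_
  · rw [← aeval_map3, h0, map_zero]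
  · change dl (κ z) (κ x) (κ y) g ≠ 0
    rw [← dl_map]
    rwa [Ne, map_eq_zero_iff _ hκ]

theorem core_field {L : Type} [Field L] [LinearOrder L] [IsStrictOrderedRing L] [Algebra ℝ L]
    (j : KK →+* L) (hj : j.Finite)
    (hj0 : ∀ r : ℝ, j (algebraMap ℝ[X] KK (C r)) = algebraMap ℝ L r)
    (hu : 0 ≤ ArchimedeanClass.mk (j (algebraMap ℝ[X] KK X)))
    (f : ℝ[X][X]) (hf : ∀ a b, 0 ≤ f.evalEval a b) (x y : L) (h0 : ev x y f = 0)
    (h1 : ev x y (derivative f) ≠ 0) : False := by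
  let _ : Algebra KK L := j.toAlgebra
  let _ : Algebra ℝ[X] L := (j.comp (algebraMap ℝ[X] KK)).toAlgebra
  have : IsScalarTower ℝ[X] KK L := IsScalarTower.of_algebraMap_eq fun _ => rfl
  have : IsScalarTower ℝ ℝ[X] L := IsScalarTower.of_algebraMap_eq fun r => (hj0 r).symm
  have : FiniteDimensional KK L := hj
  have : CharZero KK := charZero_of_injective_algebraMap (IsFractionRing.injective ℝ[X] KK)
  have hded : IsDedekindDomain (integralClosure ℝ[X] L) := integralClosure.isDedekindDomain ℝ[X] KK L
  have hfr : IsFractionRing (integralClosure ℝ[X] L) L :=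
    integralClosure.isFractionRing_of_finite_extension KK L
  set B := integralClosure ℝ[X] L with hB
  -- order
  have hmono : Monotone (algebraMap ℝ L) := by
    intro a b hab
    have : algebraMap ℝ L b - algebraMap ℝ L a = (algebraMap ℝ L (Real.sqrt (b - a))) ^ 2 := by
      rw [← map_sub, ← map_pow, Real.sq_sqrt (sub_nonneg.2 hab)]
    rw [← sub_nonneg, this]
    positivity
  let io : ℝ →+*o L := { algebraMap ℝ L with monotone' := hmono }
  have hio : ∀ r, 0 ≤ ArchimedeanClass.mk (algebraMap ℝ L r) := by
    intro r
    exact ArchimedeanClass.mk_map_nonneg_of_archimedean io r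
  let v := (ArchimedeanClass.addValuation L).toValuation
  have hv : ∀ a : L, a ∈ v.integer ↔ 0 ≤ ArchimedeanClass.mk a := by
    intro a
    exact Iff.rfl
  have hpol : ∀ p : ℝ[X], algebraMap ℝ[X] L p ∈ v.integer := by
    intro p
    induction p using Polynomial.induction_on with
    | C r => 
      rw [hv]
      change 0 ≤ ArchimedeanClass.mk (j (algebraMap ℝ[X] KK (C r)))
      rw [hj0]; exact hio r
    | add p q hp hq => rw [map_add]; exact add_mem hp hq
    | monomial n r h =>
      rw [pow_succ, ← mul_assoc, map_mul]
      exact mul_mem h ((hv _).2 hu)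
  have hfin : ∀ b : B, 0 ≤ ArchimedeanClass.mk (b : L) := by
    intro b
    let _ : Algebra ℝ[X] v.integer := ((algebraMap ℝ[X] L).codRestrict v.integer hpol).toAlgebra
    have : IsScalarTower ℝ[X] v.integer L := IsScalarTower.of_algebraMap_eq fun _ => rfl
    have hb : IsIntegral ℝ[X] (b : L) := b.2
    have := hb.tower_top (A := v.integer)
    exact (hv _).1 ((Valuation.integer.integers v).mem_of_integral this)
  let π : B →ₐ[ℝ] ℝ :=
    { toFun := fun b => ArchimedeanClass.stdPart (b : L)
      map_one' := by simp
      map_zero' := by simp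
      map_mul' := fun a b => by
        simpa using ArchimedeanClass.stdPart_mul (hfin a) (hfin b)
      map_add' := fun a b => by
        simpa using ArchimedeanClass.stdPart_add (hfin a) (hfin b)
      commutes' := fun r => by
        exact ArchimedeanClass.stdPart_map_real io r }
  let p : Ideal B := RingHom.ker π
  have hp : p.IsPrime := RingHom.ker_isPrime _
  have hinjB : Function.Injective (algebraMap ℝ[X] B) := by
    have : Function.Injective (algebraMap ℝ[X] L) :=
      j.injective.comp (IsFractionRing.injective ℝ[X] KK)
    intro a b hab
    apply this
    rw [IsScalarTower.algebraMap_apply ℝ[X] B L, hab, ← IsScalarTower.algebraMap_apply ℝ[X] B L]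
  have hp0 : p ≠ ⊥ := by
    intro hbot
    let r : ℝ := π (algebraMap ℝ[X] B X)
    have hmem : algebraMap ℝ[X] B (X - C r) ∈ p := by
      change π _ = 0
      have h2 : algebraMap ℝ[X] B (C r) = algebraMap ℝ B r := by
        rw [IsScalarTower.algebraMap_apply ℝ ℝ[X] B]; rfl
      rw [map_sub, map_sub, h2, π.commutes]
      simp [r]
    rw [hbot, Ideal.mem_bot] at hmem
    rw [map_eq_zero_iff _ hinjB] at hmem
    exact X_sub_C_ne_zero r hmem
  obtain ⟨M, g, hg, H⟩ := homog_nn f hf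
  obtain ⟨d, hd⟩ := IsLocalization.exist_integer_multiples_of_finset (nonZeroDivisors B) {x, y}
  obtain ⟨X', hX'⟩ := hd x (by simp)
  obtain ⟨Y', hY'⟩ := hd y (by simp)
  have hd0 : (d : B) ≠ 0 := nonZeroDivisors.coe_ne_zero d
  let ι : B →ₐ[ℝ] L := IsScalarTower.toAlgHom ℝ B L
  have hι : Function.Injective ι := Subtype.val_injective
  have hdL : ι d ≠ 0 := by rwa [Ne, map_eq_zero_iff _ hι]
  have hx : ι X' / ι d = x := by
    rw [div_eq_iff hdL, mul_comm]
    rw [Algebra.smul_def] at hX'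
    exact hX'
  have hy : ι Y' / ι d = y := by
    rw [div_eq_iff hdL, mul_comm]
    rw [Algebra.smul_def] at hY'
    exact hY'
  have hB0 : MvPolynomial.aeval ![(d : B), X', Y'] g = 0 := by
    apply hι
    rw [aeval_map3, H L _ _ _ hdL, hx, hy, h0, mul_zero, map_zero]
  have hB1 : dl (d : B) X' Y' g ≠ 0 := by
    intro h
    have h2 := dl_map ι (d : B) X' Y' g
    rw [h, map_zero, dl_homog H _ _ _ hdL, hx, hy] at h2
    refine mul_ne_zero (mul_ne_zero (pow_ne_zero _ hdL) (inv_ne_zero hdL)) h1 h2.symm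
  exact core_ded π (Localization.AtPrime p) p rfl hp0 g hg _ _ _ hB0 hB1
end BNS

namespace BNS
open Polynomial

theorem exists_inv_hom : ∃ σ : KK →+* KK, Function.Surjective σ ∧
    (∀ r : ℝ, σ (algebraMap ℝ[X] KK (C r)) = algebraMap ℝ[X] KK (C r)) ∧
    σ (algebraMap ℝ[X] KK X) = (algebraMap ℝ[X] KK X)⁻¹ := by
  have ht : Transcendental ℝ (algebraMap ℝ[X] KK X) := by
    rw [transcendental_iff_injective]
    have : (aeval (algebraMap ℝ[X] KK X) : ℝ[X] →ₐ[ℝ] KK) = IsScalarTower.toAlgHom ℝ ℝ[X] KK := by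
      ext; simp
    rw [this]
    exact IsFractionRing.injective ℝ[X] KK
  have ht' : Transcendental ℝ (algebraMap ℝ[X] KK X)⁻¹ := by
    intro h
    exact ht (IsAlgebraic.inv_iff.1 h)
  rw [transcendental_iff_injective] at ht'
  let a : ℝ[X] →+* KK := (aeval (algebraMap ℝ[X] KK X)⁻¹ : ℝ[X] →ₐ[ℝ] KK).toRingHom
  let σ : KK →+* KK := IsFractionRing.lift (A := ℝ[X]) (g := a) ht'
  have h1 : ∀ p, σ (algebraMap ℝ[X] KK p) = a p := fun p => IsFractionRing.lift_algebraMap ht' p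
  have hC : ∀ r : ℝ, σ (algebraMap ℝ[X] KK (C r)) = algebraMap ℝ[X] KK (C r) := by
    intro r
    rw [h1]
    change aeval _ (C r) = _
    rw [aeval_C, IsScalarTower.algebraMap_apply ℝ ℝ[X] KK]; rfl
  have hX : σ (algebraMap ℝ[X] KK X) = (algebraMap ℝ[X] KK X)⁻¹ := by
    rw [h1]
    change aeval _ X = _
    rw [aeval_X]
  refine ⟨σ, ?_, hC, hX⟩
  have hinv : σ.comp σ = RingHom.id KK := by
    apply IsLocalization.ringHom_ext (nonZeroDivisors ℝ[X])
    apply Polynomial.ringHom_ext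
    · intro r
      simp [hC]
    · simp [hX]
  intro b
  exact ⟨σ b, by simpa using congrArg (fun φ : KK →+* KK => φ b) hinv⟩

theorem nonreal_gen {L : Type} [Field L] (i : KK →+* L) (hi : i.Finite) (y : L) (f : ℝ[X][X])
    (hf : ∀ a b, 0 ≤ f.evalEval a b)
    (h0 : eval₂ (i.comp (algebraMap ℝ[X] KK)) y f = 0)
    (h1 : eval₂ (i.comp (algebraMap ℝ[X] KK)) y (derivative f) ≠ 0) : IsSumSq (-1 : L) := by
  by_contra hcon
  obtain ⟨o, ho⟩ := exists_order hcon
  let _ : Algebra ℝ L := ((i.comp (algebraMap ℝ[X] KK)).comp C).toAlgebra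
  have hev : ∀ g, ev (i (algebraMap ℝ[X] KK X)) y g = eval₂ (i.comp (algebraMap ℝ[X] KK)) y g := by
    intro g
    rw [ev, coe_eval₂RingHom]
    congr 1
    apply Polynomial.ringHom_ext
    · intro r
      simp
      rfl
    · simp
  by_cases hx : 0 ≤ ArchimedeanClass.mk (i (algebraMap ℝ[X] KK X))
  · exact core_field i hi (fun r => rfl) hx f hf _ y ((hev f).trans h0) (by rwa [hev])
  · obtain ⟨σ, hσ, hC, hX⟩ := exists_inv_hom
    refine core_field (i.comp σ) (hi.comp (RingHom.Finite.of_surjective σ hσ)) (fun r => ?_) ?_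
      f hf _ y ((hev f).trans h0) (by rwa [hev])
    · simp only [RingHom.comp_apply, hC]; rfl
    · simp only [RingHom.comp_apply, hX, map_inv₀, ArchimedeanClass.mk_inv]
      simp only [not_le] at hx
      have hx0 : i (algebraMap ℝ[X] KK X) ≠ 0 := by
        rw [Ne, map_eq_zero, map_eq_zero_iff _ (IsFractionRing.injective ℝ[X] KK)]
        exact X_ne_zero
      rw [← ArchimedeanClass.mk_inv]
      by_contra hn
      simp only [not_le] at hn
      have h2 := ArchimedeanClass.mk_mul (i (algebraMap ℝ[X] KK X)) (i (algebraMap ℝ[X] KK X))⁻¹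
      rw [mul_inv_cancel₀ hx0, ArchimedeanClass.mk_one] at h2
      have h3 := add_le_add_right hn.le (ArchimedeanClass.mk (i (algebraMap ℝ[X] KK X)))
      rw [← h2, add_zero] at h3
      exact absurd hx (not_lt.2 h3)

theorem nonreal (f : ℝ[X][X])
    (hf : ∀ a b, 0 ≤ f.evalEval a b) (hirr : Irreducible (toK f)) :
    IsSumSq (-1 : AdjoinRoot (toK f)) := by
  have : Fact (Irreducible (toK f)) := ⟨hirr⟩
  have hc : CharZero KK := charZero_of_injective_algebraMap (IsFractionRing.injective ℝ[X] KK)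
  have he : ∀ g : ℝ[X][X], eval₂ ((AdjoinRoot.of (toK f)).comp (algebraMap ℝ[X] KK))
      (AdjoinRoot.root (toK f)) g = AdjoinRoot.mk (toK f) (toK g) := by
    intro g
    rw [← eval₂_map]
    exact AdjoinRoot.aeval_eq (f := toK f) (toK g)
  refine nonreal_gen (AdjoinRoot.of (toK f)) ?_ (AdjoinRoot.root (toK f)) f hf ?_ ?_
  · exact RingHom.finite_algebraMap.2 (AdjoinRoot.powerBasis hirr.ne_zero).finite
  · rw [he, AdjoinRoot.mk_self]
  · rw [he, Ne, AdjoinRoot.mk_eq_zero]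
    have hsep := hirr.separable
    rw [Polynomial.Separable, derivative_map] at hsep
    intro hd
    exact hirr.not_isUnit (hsep.isUnit_of_dvd' dvd_rfl hd)
end BNS

namespace BNS
open Polynomial

theorem natDegree_toK (f : ℝ[X][X]) : (toK f).natDegree = f.natDegree :=
  natDegree_map_eq_of_injective (IsFractionRing.injective ℝ[X] KK) f

theorem isUnit_toK_C {r : ℝ[X]} (hr : r ≠ 0) : IsUnit (toK (C r)) := by
  rw [toK, Polynomial.map_C, isUnit_C, isUnit_iff_ne_zero]
  rwa [Ne, map_eq_zero_iff _ (IsFractionRing.injective ℝ[X] KK)]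

theorem clear_one_deg (p : KK[X]) : ∃ (r : ℝ[X]) (P : ℝ[X][X]), r ≠ 0 ∧
    toK P = toK (C r) * p ∧ P.natDegree = p.natDegree := by
  obtain ⟨r, P, hr, h⟩ := clear_one p
  refine ⟨r, P, hr, h, ?_⟩
  rw [← natDegree_toK, h]
  rw [toK, Polynomial.map_C]
  apply natDegree_C_mul
  rwa [Ne, map_eq_zero_iff _ (IsFractionRing.injective ℝ[X] KK)]

theorem toK_squarefree {f : ℝ[X][X]} (hsq : ∀ g, g ^ 2 ∣ f → g.natDegree = 0) (h0 : f ≠ 0) :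
    Squarefree (toK f) := by
  have hf0 : toK f ≠ 0 := fun h => h0 (toK_injective (h.trans (by simp [toK])))
  obtain ⟨inst⟩ : Nonempty (NormalizedGCDMonoid ℝ[X]) := inferInstance
  intro p hp
  have hp0 : p ≠ 0 := by
    rintro rfl
    simp at hp
    exact hf0 hp
  obtain ⟨r, P, hr, hP, hdeg⟩ := clear_one_deg p
  have hP0 : P ≠ 0 := by
    rintro rfl
    have : toK (C r) * p ≠ 0 := mul_ne_zero (isUnit_toK_C hr).ne_zero hp0
    rw [← hP] at this
    simp [toK] at this
  have h1 : toK P.primPart ∣ p := by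
    have : toK P.primPart ∣ toK (C r) * p := by
      rw [← hP]
      exact Polynomial.map_dvd _ P.primPart_dvd
    exact ((isUnit_toK_C hr).dvd_mul_left).1 this
  have h2 : toK (P.primPart * P.primPart) ∣ toK f := by
    rw [toK, Polynomial.map_mul]
    exact (mul_dvd_mul h1 h1).trans hp
  have h3 := (P.isPrimitive_primPart.mul P.isPrimitive_primPart).dvd_of_fraction_map_dvd_fraction_map h2
  have h4 := hsq P.primPart (by rwa [sq])
  rw [natDegree_primPart, hdeg] at h4
  rw [Polynomial.isUnit_iff_degree_eq_zero, degree_eq_natDegree hp0, h4]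
  rfl

theorem exists_disc {f : ℝ[X][X]} (hsq : ∀ g, g ^ 2 ∣ f → g.natDegree = 0) (h0 : f ≠ 0) :
    ∃ (u v : ℝ[X][X]) (D : ℝ[X]), D ≠ 0 ∧ u * f + v * derivative f = C D := by
  have hc : CharZero KK := charZero_of_injective_algebraMap (IsFractionRing.injective ℝ[X] KK)
  have h1 : (toK f).Separable := PerfectField.separable_iff_squarefree.2 (toK_squarefree hsq h0)
  obtain ⟨a, b, hab⟩ := h1
  obtain ⟨r, A, hr, hA⟩ := clear_one a
  obtain ⟨s, B, hs, hB⟩ := clear_one b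
  refine ⟨C s * A, C r * B, s * r, mul_ne_zero hs hr, ?_⟩
  apply toK_injective
  simp only [toK, Polynomial.map_add, Polynomial.map_mul, C_mul, derivative_map] at *
  rw [hA, hB]
  linear_combination ((C r).map (algebraMap ℝ[X] KK) * (C s).map (algebraMap ℝ[X] KK)) * hab

theorem deriv_zero_of_min (p : ℝ[X]) (h : ∀ y, 0 ≤ p.eval y) {y : ℝ} (hy : p.eval y = 0) :
    p.derivative.eval y = 0 := by
  have : IsLocalMin (fun t => p.eval t) y := by
    apply Filter.Eventually.of_forall
    intro t
    simpa [hy] using h t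
  have h2 := this.deriv_eq_zero
  rwa [Polynomial.deriv] at h2

theorem evalEval_derivative (f : ℝ[X][X]) (x y : ℝ) :
    (derivative f).evalEval x y = (derivative (f.map (evalRingHom x))).eval y := by
  rw [← map_evalRingHom_eval, derivative_map]

theorem pos_of_disc {f u v : ℝ[X][X]} {D : ℝ[X]} (hf : ∀ a b, 0 ≤ f.evalEval a b)
    (h : u * f + v * derivative f = C D) {x : ℝ} (hx : D.eval x ≠ 0) (y : ℝ) :
    0 < f.evalEval x y := by
  refine lt_of_le_of_ne (hf x y) fun h0 => hx ?_
  have h1 : (derivative f).evalEval x y = 0 := by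
    rw [evalEval_derivative]
    apply deriv_zero_of_min
    · intro t
      rw [map_evalRingHom_eval]; exact hf x t
    · rw [map_evalRingHom_eval, ← h0]
  have h2 := congrArg (evalEval x y) h
  rw [evalEval_add, evalEval_mul, evalEval_mul, h1, ← h0, evalEval_C] at h2
  rw [← h2]; ring

theorem lift_sumSq {F : KK[X]} (hF : 0 < F.natDegree) {s : AdjoinRoot F} (hs : IsSumSq s) :
    ∃ S : KK[X], IsSumSq S ∧ AdjoinRoot.mk F S = s ∧ S.natDegree + 2 ≤ 2 * F.natDegree := by
  induction hs with
  | zero => exact ⟨0, IsSumSq.zero, by simp, by simp; omega⟩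
  | sq_add a hs ih =>
    obtain ⟨S, hS, h1, h2⟩ := ih
    obtain ⟨p, rfl⟩ := AdjoinRoot.mk_surjective a
    have hd : (p % F).natDegree < F.natDegree := natDegree_mod_lt p hF.ne'
    refine ⟨(p % F) * (p % F) + S, (IsSumSq.mul_self _).add hS, ?_, ?_⟩
    · have : AdjoinRoot.mk F (p % F) = AdjoinRoot.mk F p := by
        rw [AdjoinRoot.mk_eq_mk]
        exact ⟨-(p / F), by linear_combination EuclideanDomain.mod_add_div p F⟩
      rw [map_add, map_mul, this, h1]
    · have h3 := natDegree_add_le ((p % F) * (p % F)) S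
      have h4 := natDegree_mul_le (p := p % F) (q := p % F)
      rcases le_max_iff.1 h3 with h | h <;> omega

theorem artin_irr {f : ℝ[X][X]} (hf : ∀ a b, 0 ≤ f.evalEval a b) (hirr : Irreducible (toK f)) :
    ∃ (R : ℝ[X]) (T g : ℝ[X][X]), R ≠ 0 ∧ IsSumSq T ∧ C R ^ 2 + T = f * g ∧
      g.natDegree < f.natDegree := by
  have hn : 0 < (toK f).natDegree := Irreducible.natDegree_pos hirr
  obtain ⟨S, hS, h1, h2⟩ := lift_sumSq hn (nonreal f hf hirr)
  have h3 : toK f ∣ 1 + S := by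
    rw [← AdjoinRoot.mk_eq_zero, map_add, h1, map_one]; ring
  obtain ⟨G, hG⟩ := h3
  have h4 : 1 + S ≠ 0 := by
    intro h
    have := KK_real S 1 hS (by rwa [mul_one])
    exact one_ne_zero this
  have hG0 : G ≠ 0 := by rintro rfl; rw [mul_zero] at hG; exact h4 hG
  have hdeg : G.natDegree < (toK f).natDegree := by
    have h5 := natDegree_mul hirr.ne_zero hG0
    rw [← hG] at h5
    have h6 := natDegree_add_le 1 S
    rw [natDegree_one] at h6
    rcases le_max_iff.1 h6 with h | h <;> omega
  obtain ⟨r, S', hr, hS', he⟩ := clear_sumSq hS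
  obtain ⟨t, G', ht, hG', hd⟩ := clear_one_deg G
  refine ⟨t * r, C t ^ 2 * S', C (t * r ^ 2) * G', mul_ne_zero ht hr, (isSumSq_sq _).mul hS', ?_, ?_⟩
  · apply toK_injective
    simp only [toK, Polynomial.map_add, Polynomial.map_mul, Polynomial.map_pow, C_mul, C_pow] at *
    rw [he, hG']
    linear_combination ((C r).map (algebraMap ℝ[X] KK) ^ 2 * (C t).map (algebraMap ℝ[X] KK) ^ 2) * hG
  · rw [natDegree_C_mul (mul_ne_zero ht (pow_ne_zero _ hr)), hd]
    rwa [natDegree_toK] at hdeg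

theorem sign_aux {a b : ℝ[X]} (h : ∀ y, 0 < a.eval y * b.eval y) (y : ℝ) :
    0 < a.eval 0 * a.eval y := by
  by_contra hc
  push Not at hc
  have hz : ∀ t, a.eval t ≠ 0 := fun t ht => by
    have := h t
    rw [ht, zero_mul] at this
    exact lt_irrefl _ this
  have h0 : (0:ℝ) ∈ Set.uIcc (a.eval 0) (a.eval y) := by
    rw [Set.mem_uIcc]
    rcases mul_nonpos_iff.1 hc with h | h
    · right; exact ⟨h.2, h.1⟩
    · left; exact h
  obtain ⟨t, -, ht⟩ := intermediate_value_uIcc (a := (0:ℝ)) (b := y) (f := fun t => a.eval t)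
    a.continuous.continuousOn h0
  exact hz t ht

theorem eval_zero_evalEval (a : ℝ[X][X]) (x : ℝ) : (a.eval 0).eval x = a.evalEval x 0 := by
  rw [evalEval]; simp

theorem artin : ∀ (n : ℕ) (f : ℝ[X][X]), f.natDegree = n → (∀ a b, 0 ≤ f.evalEval a b) →
    ∃ r : ℝ[X], r ≠ 0 ∧ IsSumSq (C r ^ 2 * f) := by
  intro n
  induction n using Nat.strong_induction_on with
  | _ n ih =>
  intro f hn hf
  by_cases h00 : f = 0
  · exact ⟨1, one_ne_zero, by rw [h00, mul_zero]; exact IsSumSq.zero⟩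
  by_cases hn0 : n = 0
  · rw [hn0] at hn
    obtain ⟨a, rfl⟩ := natDegree_eq_zero.1 hn
    refine ⟨1, one_ne_zero, ?_⟩
    rw [C_1, one_pow, one_mul]
    apply isSumSq_map
    apply isSumSq_of_nonneg
    intro x
    have := hf x 0
    rwa [evalEval_C] at this
  by_cases hsq : ∀ g, g ^ 2 ∣ f → g.natDegree = 0
  swap
  · push Not at hsq
    obtain ⟨g, ⟨h, hh⟩, hg⟩ := hsq
    have hg0 : g ≠ 0 := by rintro rfl; simp at hg
    have hh0 : h ≠ 0 := by rintro rfl; rw [mul_zero] at hh; exact h00 hh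
    obtain ⟨r, hr, hs⟩ := ih h.natDegree (by
      rw [← hn, hh, natDegree_mul (pow_ne_zero _ hg0) hh0, natDegree_pow]; omega) h rfl
      (nn_of_sq_mul hg0 (by rwa [← hh]))
    refine ⟨r, hr, ?_⟩
    rw [hh, show C r ^ 2 * (g ^ 2 * h) = g ^ 2 * (C r ^ 2 * h) by ring]
    exact (isSumSq_sq _).mul hs
  by_cases hirr : Irreducible (toK f)
  · obtain ⟨R, T, g, hR, hT, he, hd⟩ := artin_irr hf hirr
    have hg0 : g ≠ 0 := by
      rintro rfl
      rw [mul_zero] at he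
      have := biv_formallyReal hT (a := C R) (by rwa [← sq])
      exact hR (C_eq_zero.1 this)
    obtain ⟨q, hq, hs⟩ := ih g.natDegree (by omega) (C R ^ 2 * g) (by
      rw [← C_pow, natDegree_C_mul (pow_ne_zero _ hR)]) (by
      intro x y
      rw [evalEval_mul, evalEval_pow, evalEval_C]
      by_cases hx : R.eval x = 0
      · simp [hx]
      · have h1 := congrArg (evalEval x y) he
        rw [evalEval_add, evalEval_mul, evalEval_pow, evalEval_C] at h1
        have h2 := IsSumSq_evalEval_nonneg hT x y
        have h3 : 0 < R.eval x ^ 2 := by positivity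
        have h4 : 0 < f.evalEval x y * g.evalEval x y := by linarith
        have h5 : 0 ≤ g.evalEval x y := by
          by_contra hneg
          exact absurd h4 (not_lt.2 (mul_nonpos_of_nonneg_of_nonpos (hf x y) (not_le.1 hneg).le))
        positivity)
    refine cassels_biv (g := C q * C R * g) (mul_ne_zero (mul_ne_zero (C_ne_zero.2 hq)
      (C_ne_zero.2 hR)) hg0) ?_
    have : (C q * C R * g) ^ 2 * f = (C R ^ 2 + T) * (C q ^ 2 * (C R ^ 2 * g)) := by
      rw [he]; ring
    rw [this]
    exact ((isSumSq_sq _).add hT).mul hs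
  · obtain ⟨u, v, D, hD, hdisc⟩ := exists_disc hsq h00
    have hnu : ¬ IsUnit (toK f) := by
      intro h
      have := natDegree_eq_zero_of_isUnit h
      rw [natDegree_toK] at this
      omega
    have hf0 : toK f ≠ 0 := fun h => h00 (toK_injective (h.trans (by simp [toK])))
    rw [irreducible_iff] at hirr
    push Not at hirr
    obtain ⟨p, q, hpq, hp, hq⟩ := hirr hnu
    have hp0 : p ≠ 0 := by rintro rfl; rw [zero_mul] at hpq; exact hf0 hpq
    have hq0 : q ≠ 0 := by rintro rfl; rw [mul_zero] at hpq; exact hf0 hpq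
    have hdp : p.natDegree ≠ 0 := by
      intro h; apply hp
      rw [Polynomial.isUnit_iff_degree_eq_zero, degree_eq_natDegree hp0, h]; rfl
    have hdq : q.natDegree ≠ 0 := by
      intro h; apply hq
      rw [Polynomial.isUnit_iff_degree_eq_zero, degree_eq_natDegree hq0, h]; rfl
    have hdeg := natDegree_mul hp0 hq0
    rw [← hpq, natDegree_toK, hn] at hdeg
    obtain ⟨r, A, hr, hA, hdA⟩ := clear_one_deg p
    obtain ⟨s, B, hs, hB, hdB⟩ := clear_one_deg q
    obtain ⟨c, hc⟩ : ∃ c, c = r * s := ⟨_, rfl⟩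
    have hc0 : c ≠ 0 := by rw [hc]; exact mul_ne_zero hr hs
    have hAB : C c * f = A * B := by
      apply toK_injective
      rw [hc]
      simp only [toK, Polynomial.map_mul, C_mul] at *
      rw [hA, hB, hpq]; ring
    obtain ⟨a, ha⟩ : ∃ a, a = C c * A := ⟨_, rfl⟩
    have hab : C c ^ 2 * f = a * B := by rw [ha]; linear_combination C c * hAB
    have hda : a.natDegree = p.natDegree := by rw [ha, natDegree_C_mul hc0, hdA]
    have hpos : ∀ x, (c * D).eval x ≠ 0 → ∀ y, 0 < (a.map (evalRingHom x)).eval y *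
        (B.map (evalRingHom x)).eval y := by
      intro x hx y
      rw [eval_mul] at hx
      have h1 := pos_of_disc hf hdisc (right_ne_zero_of_mul hx) y
      have h2 := congrArg (evalEval x y) hab
      rw [evalEval_mul, evalEval_mul, evalEval_pow, evalEval_C] at h2
      rw [map_evalRingHom_eval, map_evalRingHom_eval, ← h2]
      have := left_ne_zero_of_mul hx
      positivity
    have hcD : c * D ≠ 0 := mul_ne_zero hc0 hD
    obtain ⟨x0, hx0⟩ : ∃ x, (c * D).eval x ≠ 0 := by
      by_contra h
      push Not at h
      exact hcD (Polynomial.funext (by simpa using h))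
    obtain ⟨α, hα⟩ : ∃ α, α = a.eval 0 := ⟨_, rfl⟩
    obtain ⟨β, hβ⟩ : ∃ β, β = B.eval 0 := ⟨_, rfl⟩
    have hα0 : α ≠ 0 := by
      intro h
      have := hpos x0 hx0 0
      rw [map_evalRingHom_eval, ← eval_zero_evalEval, ← hα, h] at this
      simp at this
    have hβ0 : β ≠ 0 := by
      intro h
      have := hpos x0 hx0 0
      rw [map_evalRingHom_eval, map_evalRingHom_eval, ← eval_zero_evalEval B, ← hβ, h] at this
      simp at this
    have hαβ : IsSumSq (C (α * β)) := by
      apply isSumSq_map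
      have : α * β = c ^ 2 * f.eval 0 := by
        have := congrArg (eval 0) hab
        simp only [eval_mul, eval_pow, eval_C] at this
        rw [hα, hβ, this]
      rw [this]
      refine (isSumSq_sq _).mul (isSumSq_of_nonneg _ fun x => ?_)
      rw [eval_zero_evalEval]; exact hf x 0
    obtain ⟨q1, hq1, hs1⟩ := ih a.natDegree (by omega) (C ((c * D) ^ 2 * α) * a)
      (natDegree_C_mul (mul_ne_zero (pow_ne_zero _ hcD) hα0)) (by
        intro x y
        rw [evalEval_mul, evalEval_C, eval_mul, eval_pow]
        by_cases hx : (c * D).eval x = 0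
        · simp [hx]
        · have := sign_aux (hpos x hx) y
          rw [map_evalRingHom_eval, map_evalRingHom_eval, ← eval_zero_evalEval, ← hα] at this
          rw [mul_assoc]
          positivity)
    obtain ⟨q2, hq2, hs2⟩ := ih B.natDegree (by omega) (C ((c * D) ^ 2 * β) * B)
      (natDegree_C_mul (mul_ne_zero (pow_ne_zero _ hcD) hβ0)) (by
        intro x y
        rw [evalEval_mul, evalEval_C, eval_mul, eval_pow]
        by_cases hx : (c * D).eval x = 0
        · simp [hx]
        · have := sign_aux (a := B.map (evalRingHom x)) (b := a.map (evalRingHom x))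
            (fun y => by rw [mul_comm]; exact hpos x hx y) y
          rw [map_evalRingHom_eval, map_evalRingHom_eval, ← eval_zero_evalEval, ← hβ] at this
          rw [mul_assoc]
          positivity)
    refine ⟨q1 * q2 * (c * D) ^ 2 * (α * β) * c, ?_, ?_⟩
    · exact mul_ne_zero (mul_ne_zero (mul_ne_zero (mul_ne_zero hq1 hq2) (pow_ne_zero _ hcD))
        (mul_ne_zero hα0 hβ0)) hc0
    · have h := (hs1.mul hs2).mul hαβ
      refine (congrArg IsSumSq ?_).mpr h
      simp only [C_mul, C_pow]
      linear_combination (C q1 * C q2 * (C c * C D) ^ 2 * (C α * C β)) ^ 2 * hab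
end BNS

namespace BNS
open Polynomial

theorem bd_mono {a x C C' : ℝ} {N N' : ℕ} (h : a ≤ C * (1 + x ^ 2) ^ N) (hC0 : 0 ≤ C) (hC : C ≤ C')
    (hN : N ≤ N') : a ≤ C' * (1 + x ^ 2) ^ N' := by
  refine h.trans ?_
  have h1 : (1 : ℝ) ≤ 1 + x ^ 2 := by nlinarith [sq_nonneg x]
  have h2 : (1 + x ^ 2) ^ N ≤ (1 + x ^ 2) ^ N' := pow_le_pow_right₀ h1 hN
  have h3 : 0 ≤ (1 + x ^ 2) ^ N := by positivity
  exact mul_le_mul hC h2 h3 (hC0.trans hC)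

theorem bd_one (P : ℝ[X]) : ∃ (C : ℝ) (N : ℕ), 0 < C ∧ ∀ x, |P.eval x| ≤ C * (1 + x ^ 2) ^ N := by
  obtain ⟨C, hC, h⟩ := abs_eval_le P P.natDegree (by omega)
  exact ⟨C, _, hC, h⟩

theorem bd_two (P : ℝ[X][X]) : ∃ (C : ℝ) (N : ℕ), 0 < C ∧
    ∀ x y, |y| ≤ 2 → |P.evalEval x y| ≤ C * (1 + x ^ 2) ^ N := by
  induction P using Polynomial.induction_on' with
  | add p q hp hq =>
    obtain ⟨C1, N1, hC1, h1⟩ := hp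
    obtain ⟨C2, N2, hC2, h2⟩ := hq
    refine ⟨C1 + C2, N1 + N2, by positivity, fun x y hy => ?_⟩
    rw [evalEval_add, add_mul]
    refine (abs_add_le _ _).trans (add_le_add ?_ ?_)
    · exact bd_mono (h1 x y hy) hC1.le le_rfl (by omega)
    · exact bd_mono (h2 x y hy) hC2.le le_rfl (by omega)
  | monomial n a =>
    obtain ⟨C1, N, hC1, h1⟩ := bd_one a
    refine ⟨C1 * 2 ^ n, N, by positivity, fun x y hy => ?_⟩
    rw [← C_mul_X_pow_eq_monomial, evalEval_mul, evalEval_pow, evalEval_C, evalEval_X, abs_mul,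
      abs_pow, mul_right_comm]
    exact mul_le_mul (h1 x) (pow_le_pow_left₀ (abs_nonneg _) hy n) (by positivity) (by positivity)

/-- Second order Taylor bound. -/
theorem bd_taylor (P : ℝ[X][X]) : ∃ (C : ℝ) (N : ℕ), 0 < C ∧
    ∀ x y s, |y| ≤ 1 → |s| ≤ 1 →
      |P.evalEval x (y + s) - P.evalEval x y - s * (derivative P).evalEval x y| ≤
        C * (1 + x ^ 2) ^ N * s ^ 2 := by
  induction P using Polynomial.induction_on with
  | C a =>
    refine ⟨1, 0, one_pos, fun x y s _ _ => ?_⟩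
    simp [evalEval_C]
    positivity
  | add p q hp hq =>
    obtain ⟨C1, N1, hC1, h1⟩ := hp
    obtain ⟨C2, N2, hC2, h2⟩ := hq
    refine ⟨C1 + C2, N1 + N2, by positivity, fun x y s hy hs => ?_⟩
    have e1 := h1 x y s hy hs
    have e2 := h2 x y s hy hs
    have e3 : C1 * (1 + x ^ 2) ^ N1 * s ^ 2 ≤ C1 * (1 + x ^ 2) ^ (N1 + N2) * s ^ 2 :=
      mul_le_mul_of_nonneg_right (bd_mono le_rfl hC1.le le_rfl (by omega)) (sq_nonneg s)
    have e4 : C2 * (1 + x ^ 2) ^ N2 * s ^ 2 ≤ C2 * (1 + x ^ 2) ^ (N1 + N2) * s ^ 2 :=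
      mul_le_mul_of_nonneg_right (bd_mono le_rfl hC2.le le_rfl (by omega)) (sq_nonneg s)
    rw [derivative_add]
    simp only [evalEval_add]
    rw [abs_le] at *
    constructor <;> linarith [e1.1, e1.2, e2.1, e2.2]
  | monomial n a ih =>
    rw [pow_succ, ← mul_assoc]
    generalize C a * X ^ n = P at ih
    obtain ⟨C1, N1, hC1, h1⟩ := ih
    obtain ⟨C2, N2, hC2, h2⟩ := bd_two (derivative P)
    refine ⟨2 * C1 + C2, N1 + N2, by positivity, fun x y s hy hs => ?_⟩
    have e1 := h1 x y s hy hs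
    have e2 := h2 x y (by linarith)
    rw [derivative_mul, derivative_X, mul_one]
    simp only [evalEval_add, evalEval_mul, evalEval_X]
    have key : P.evalEval x (y + s) * (y + s) - P.evalEval x y * y -
        s * ((derivative P).evalEval x y * y + P.evalEval x y) =
        (y + s) * (P.evalEval x (y + s) - P.evalEval x y - s * (derivative P).evalEval x y) +
        (derivative P).evalEval x y * s ^ 2 := by ring
    rw [key]
    have hys : |y + s| ≤ 2 := (abs_add_le _ _).trans (by linarith)
    have e3 : C1 * (1 + x ^ 2) ^ N1 * s ^ 2 ≤ C1 * (1 + x ^ 2) ^ (N1 + N2) * s ^ 2 :=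
      mul_le_mul_of_nonneg_right (bd_mono le_rfl hC1.le le_rfl (by omega)) (sq_nonneg s)
    have e4 : C2 * (1 + x ^ 2) ^ N2 * s ^ 2 ≤ C2 * (1 + x ^ 2) ^ (N1 + N2) * s ^ 2 :=
      mul_le_mul_of_nonneg_right (bd_mono le_rfl hC2.le le_rfl (by omega)) (sq_nonneg s)
    refine (abs_add_le _ _).trans ?_
    rw [abs_mul, abs_mul, abs_of_nonneg (sq_nonneg s)]
    have e5 := mul_le_mul hys e1 (abs_nonneg _) (by norm_num)
    have e6 := mul_le_mul_of_nonneg_right e2 (sq_nonneg s)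
    nlinarith

theorem lemmaB {F u v : ℝ[X][X]} {D : ℝ[X]} (hF : ∀ a b, 0 ≤ F.evalEval a b)
    (h : u * F + v * derivative F = C D) :
    ∃ (K : ℝ) (M : ℕ), 0 < K ∧ ∀ x y, |y| ≤ 1 →
      D.eval x ^ 2 ≤ K * (1 + x ^ 2) ^ M * F.evalEval x y := by
  obtain ⟨C1, N1, hC1, h1⟩ := bd_two u
  obtain ⟨C2, N2, hC2, h2⟩ := bd_two v
  obtain ⟨C3, N3, hC3, h3⟩ := bd_two F
  obtain ⟨C4, N4, hC4, h4⟩ := bd_two (derivative F)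
  obtain ⟨C5, N5, hC5, h5⟩ := bd_taylor F
  obtain ⟨C0, hC0⟩ : ∃ C0, C0 = C1 + C2 + C3 + C4 + C5 := ⟨_, rfl⟩
  obtain ⟨N, hN⟩ : ∃ N, N = N1 + N2 + N3 + N4 + N5 := ⟨_, rfl⟩
  have hC0' : 0 < C0 := by rw [hC0]; positivity
  refine ⟨10 * C0 ^ 3, 3 * N, by positivity, fun x y hy => ?_⟩
  obtain ⟨B, hB⟩ : ∃ B, B = C0 * (1 + x ^ 2) ^ N := ⟨_, rfl⟩
  have hBpos : 0 < B := by rw [hB]; positivity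
  have hy2 : |y| ≤ 2 := by linarith
  have b1 : |u.evalEval x y| ≤ B := by
    rw [hB]; exact bd_mono (h1 x y hy2) hC1.le (by linarith) (by omega)
  have b2 : |v.evalEval x y| ≤ B := by
    rw [hB]; exact bd_mono (h2 x y hy2) hC2.le (by linarith) (by omega)
  have b3 : |F.evalEval x y| ≤ B := by
    rw [hB]; exact bd_mono (h3 x y hy2) hC3.le (by linarith) (by omega)
  have b4 : |(derivative F).evalEval x y| ≤ B := by
    rw [hB]; exact bd_mono (h4 x y hy2) hC4.le (by linarith) (by omega)
  have b5 : ∀ s, |s| ≤ 1 →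
      |F.evalEval x (y + s) - F.evalEval x y - s * (derivative F).evalEval x y| ≤ B * s ^ 2 := by
    intro s hs
    refine (h5 x y s hy hs).trans (mul_le_mul_of_nonneg_right ?_ (sq_nonneg s))
    rw [hB]; exact bd_mono le_rfl hC5.le (by linarith) (by omega)
  have hD := congrArg (evalEval x y) h
  rw [evalEval_add, evalEval_mul, evalEval_mul, evalEval_C] at hD
  have e0 := hF x y
  have e1 := fun s => hF x (y + s)
  have hKB : 10 * C0 ^ 3 * (1 + x ^ 2) ^ (3 * N) = 10 * B ^ 3 := by
    rw [hB, mul_pow, ← pow_mul, mul_comm N 3]; ring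
  rw [hKB]
  generalize F.evalEval x y = φ at *
  generalize (derivative F).evalEval x y = ψ at *
  generalize u.evalEval x y = U at *
  generalize v.evalEval x y = W at *
  have hψ : ψ ^ 2 ≤ 4 * B * φ := by
    have hs : |-ψ / (2 * B)| ≤ 1 := by
      rw [abs_div, abs_neg, abs_of_pos (show 0 < 2 * B by positivity), div_le_one (by positivity)]
      linarith
    have h6 := (abs_le.1 (b5 _ hs)).2
    have h7 := e1 (-ψ / (2 * B))
    have h8 : 0 ≤ φ + (-ψ / (2 * B)) * ψ + B * (-ψ / (2 * B)) ^ 2 := by linarith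
    have h9 : φ + (-ψ / (2 * B)) * ψ + B * (-ψ / (2 * B)) ^ 2 = φ - ψ ^ 2 / (4 * B) := by
      field_simp; ring
    rw [h9, sub_nonneg, div_le_iff₀ (by positivity)] at h8
    linarith
  have hU : U ^ 2 ≤ B ^ 2 := sq_le_sq' (abs_le.1 b1).1 (abs_le.1 b1).2
  have hW : W ^ 2 ≤ B ^ 2 := sq_le_sq' (abs_le.1 b2).1 (abs_le.1 b2).2
  have hφ : φ ≤ B := (abs_le.1 b3).2
  rw [← hD]
  have s1 : (U * φ + W * ψ) ^ 2 ≤ 2 * (U ^ 2 * φ ^ 2) + 2 * (W ^ 2 * ψ ^ 2) := by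
    nlinarith [sq_nonneg (U * φ - W * ψ)]
  have s2 : U ^ 2 * φ ^ 2 ≤ B ^ 2 * (B * φ) :=
    mul_le_mul hU (by nlinarith) (sq_nonneg _) (sq_nonneg _)
  have s3 : W ^ 2 * ψ ^ 2 ≤ B ^ 2 * (4 * B * φ) :=
    mul_le_mul hW hψ (sq_nonneg _) (sq_nonneg _)
  nlinarith
end BNS

namespace BNS
open Polynomial

theorem even_natDegree_one {p : ℝ[X]} (h : ∀ x, 0 ≤ p.eval x) : Even p.natDegree := by
  by_contra hodd
  rw [Nat.not_even_iff_odd] at hodd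
  have hp0 : p ≠ 0 := by rintro rfl; simp at hodd
  let q := p * p.comp (-X)
  have hlc : (p.comp (-X)).leadingCoeff = -p.leadingCoeff := by
    rw [leadingCoeff_comp (by rw [natDegree_neg, natDegree_X]; exact one_ne_zero)]
    rw [leadingCoeff_neg, leadingCoeff_X, hodd.neg_one_pow]
    ring
  have hl0 := leadingCoeff_ne_zero.2 hp0
  have hc0 : p.comp (-X) ≠ 0 := by
    rw [← leadingCoeff_ne_zero, hlc]; simpa using hl0
  have h1 : 0 < q.degree := by
    rw [← natDegree_pos_iff_degree_pos, natDegree_mul hp0 hc0]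
    have := hodd.pos
    omega
  have h2 : q.leadingCoeff ≤ 0 := by
    rw [leadingCoeff_mul, hlc]
    nlinarith [mul_self_nonneg p.leadingCoeff]
  have h3 := q.tendsto_atBot_of_leadingCoeff_nonpos h1 h2
  obtain ⟨x, hx⟩ := (h3.eventually (Filter.eventually_lt_atBot 0)).exists
  have : 0 ≤ q.eval x := by
    simp only [q, eval_mul]
    refine mul_nonneg (h x) ?_
    rw [eval_comp]; exact h _
  linarith

theorem exists_eval_ne {p : ℝ[X]} (hp : p ≠ 0) : ∃ x, p.eval x ≠ 0 := by
  by_contra h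
  push Not at h
  exact hp (Polynomial.funext (by simpa using h))

theorem even_natDegree {f : ℝ[X][X]} (hf : ∀ a b, 0 ≤ f.evalEval a b) : Even f.natDegree := by
  by_cases h0 : f = 0
  · simp [h0]
  obtain ⟨x, hx⟩ := exists_eval_ne (leadingCoeff_ne_zero.2 h0)
  have : (f.map (evalRingHom x)).natDegree = f.natDegree :=
    natDegree_map_of_leadingCoeff_ne_zero _ hx
  rw [← this]
  apply even_natDegree_one
  intro y
  rw [map_evalRingHom_eval]; exact hf x y

theorem reverse_evalEval (f : ℝ[X][X]) (x : ℝ) {y : ℝ} (hy : y ≠ 0) :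
    f.reverse.evalEval x y⁻¹ * y ^ f.natDegree = f.evalEval x y := by
  have : Invertible y := invertibleOfNonzero hy
  have h := eval₂_reverse_mul_pow (evalRingHom x) y f
  rw [invOf_eq_inv, ← eval_map, ← eval_map, map_evalRingHom_eval, map_evalRingHom_eval] at h
  exact h

theorem reverse_nn {f : ℝ[X][X]} (hf : ∀ a b, 0 ≤ f.evalEval a b) :
    ∀ a b, 0 ≤ f.reverse.evalEval a b := by
  apply nn_of_sq_mul (g := X) X_ne_zero
  intro x y
  rw [evalEval_mul, evalEval_pow, evalEval_X]
  by_cases hy : y = 0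
  · simp [hy]
  · have h := reverse_evalEval f x (inv_ne_zero hy)
    rw [inv_inv] at h
    have h1 := hf x y⁻¹
    have h2 : 0 < y⁻¹ ^ f.natDegree := (even_natDegree hf).pow_pos (inv_ne_zero hy)
    have h3 : 0 ≤ f.reverse.evalEval x y := by
      by_contra hneg
      push Not at hneg
      nlinarith
    positivity

theorem reverse_reverse_of {f : ℝ[X][X]} (h : f.coeff 0 ≠ 0) : f.reverse.reverse = f := by
  have h1 : f.natTrailingDegree = 0 := natTrailingDegree_eq_zero.2 (Or.inr h)
  have h2 : f.reverse.natDegree = f.natDegree := by rw [reverse_natDegree, h1, Nat.sub_zero]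
  ext1 n
  rw [coeff_reverse, coeff_reverse, h2, revAt_invol]

theorem reverse_sqfree {f : ℝ[X][X]} (hsq : ∀ g, g ^ 2 ∣ f → g.natDegree = 0)
    (h : f.coeff 0 ≠ 0) : ∀ g, g ^ 2 ∣ f.reverse → g.natDegree = 0 := by
  rintro g ⟨k, hk⟩
  have h1 : g.reverse ^ 2 ∣ f := by
    refine ⟨k.reverse, ?_⟩
    rw [← reverse_reverse_of h, hk, reverse_mul_of_domain, sq, reverse_mul_of_domain, sq]
  have h2 := hsq _ h1
  have h3 : g.coeff 0 ≠ 0 := by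
    intro h0
    have h4 := congrArg (fun p => coeff p 0) hk
    simp only [coeff_zero_reverse, mul_coeff_zero, sq, h0, zero_mul] at h4
    rw [leadingCoeff_eq_zero] at h4
    rw [h4] at h
    simp at h
  rw [reverse_natDegree, natTrailingDegree_eq_zero.2 (Or.inr h3), Nat.sub_zero] at h2
  exact h2

noncomputable def tau (d : ℕ) (y : ℝ) : ℝ := ∑ j ∈ Finset.range (d + 1), y ^ (2 * j)

theorem tau_nonneg (d : ℕ) (y : ℝ) : 0 ≤ tau d y :=
  Finset.sum_nonneg fun j _ => by rw [pow_mul]; positivity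

theorem tau_le_one (d : ℕ) {y : ℝ} (hy : |y| ≤ 1) : tau d y ≤ d + 1 := by
  have : tau d y ≤ ∑ j ∈ Finset.range (d + 1), (1 : ℝ) := by
    refine Finset.sum_le_sum fun j _ => ?_
    rw [pow_mul, ← sq_abs]
    exact pow_le_one₀ (by positivity) (pow_le_one₀ (abs_nonneg _) hy)
  simpa using this

theorem tau_le_pow (d : ℕ) {y : ℝ} (hy : 1 ≤ |y|) : tau d y ≤ (d + 1) * y ^ (2 * d) := by
  have : tau d y ≤ ∑ j ∈ Finset.range (d + 1), y ^ (2 * d) := by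
    refine Finset.sum_le_sum fun j hj => ?_
    rw [pow_mul, pow_mul, ← sq_abs]
    refine pow_le_pow_right₀ (one_le_pow₀ hy) ?_
    have := Finset.mem_range.1 hj
    omega
  simpa using this

theorem lower_bound {f : ℝ[X][X]} (hf : ∀ a b, 0 ≤ f.evalEval a b) (h0 : f ≠ 0)
    (hsq : ∀ g, g ^ 2 ∣ f → g.natDegree = 0) {d : ℕ} (hd : f.natDegree = 2 * d) :
    ∃ (w : ℝ[X]) (K : ℝ) (N : ℕ), w ≠ 0 ∧ 0 < K ∧ ∀ x y,
      w.eval x ^ 2 * tau d y ≤ K * (1 + x ^ 2) ^ N * f.evalEval x y := by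
  obtain ⟨u, v, D, hD, hdisc⟩ := exists_disc hsq h0
  have hc0 : f.coeff 0 ≠ 0 := by
    intro h
    obtain ⟨x, hx⟩ := exists_eval_ne hD
    have h1 := pos_of_disc hf hdisc hx 0
    rw [← eval_zero_evalEval, ← coeff_zero_eq_eval_zero, h] at h1
    simp at h1
  obtain ⟨u', v', D', hD', hdisc'⟩ := exists_disc (reverse_sqfree hsq hc0)
    (by rwa [Ne, reverse_eq_zero])
  obtain ⟨K, M, hK, hB⟩ := lemmaB hf hdisc
  obtain ⟨K', M', hK', hB'⟩ := lemmaB (reverse_nn hf) hdisc'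
  obtain ⟨C1, N1, hC1, h1⟩ := bd_one (D ^ 2)
  obtain ⟨C2, N2, hC2, h2⟩ := bd_one (D' ^ 2)
  simp only [eval_pow, abs_pow, sq_abs] at h1 h2
  obtain ⟨KK1, hKK⟩ : ∃ k : ℝ, k = (C2 * K + C1 * K') * (d + 1) := ⟨_, rfl⟩
  refine ⟨D * D', (C2 * K + C1 * K') * (d + 1), (N2 + M) + (N1 + M'), mul_ne_zero hD hD', by positivity, ?_⟩
  intro x y
  rw [eval_mul, mul_pow]
  have hfx := hf x y
  have pq : ∀ n : ℕ, (0:ℝ) < (1 + x ^ 2) ^ n := fun n => by positivity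
  rcases le_total |y| 1 with hy | hy
  · have a1 := hB x y hy
    have a2 : D.eval x ^ 2 * D'.eval x ^ 2 ≤
        (K * (1 + x ^ 2) ^ M * f.evalEval x y) * (C2 * (1 + x ^ 2) ^ N2) :=
      mul_le_mul a1 (h2 x) (by positivity) ((sq_nonneg _).trans a1)
    have a3 := mul_le_mul a2 (tau_le_one d hy) (tau_nonneg d y) (by positivity)
    refine a3.trans ?_
    have a4 : C2 * K * (d + 1) * (1 + x ^ 2) ^ (N2 + M) ≤
        (C2 * K + C1 * K') * (d + 1) * (1 + x ^ 2) ^ ((N2 + M) + (N1 + M')) :=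
      bd_mono le_rfl (by positivity) (by nlinarith [mul_pos hC1 hK']) (by omega)
    calc _ = C2 * K * (d + 1) * (1 + x ^ 2) ^ (N2 + M) * f.evalEval x y := by rw [pow_add]; ring
      _ ≤ _ := mul_le_mul_of_nonneg_right a4 hfx
  · have hy0 : y ≠ 0 := by rintro rfl; simp at hy; linarith
    have hyi : |y⁻¹| ≤ 1 := by rw [abs_inv]; exact inv_le_one_of_one_le₀ hy
    have hr := reverse_evalEval f x hy0
    rw [hd] at hr
    have a1 := hB' x y⁻¹ hyi
    have a2 : D.eval x ^ 2 * D'.eval x ^ 2 ≤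
        (C1 * (1 + x ^ 2) ^ N1) * (K' * (1 + x ^ 2) ^ M' * f.reverse.evalEval x y⁻¹) :=
      mul_le_mul (h1 x) a1 (by positivity) (by positivity)
    have hrn := reverse_nn hf x y⁻¹
    have a3 := mul_le_mul a2 (tau_le_pow d hy) (tau_nonneg d y) (by positivity)
    refine a3.trans ?_
    have a4 : C1 * K' * (d + 1) * (1 + x ^ 2) ^ (N1 + M') ≤
        (C2 * K + C1 * K') * (d + 1) * (1 + x ^ 2) ^ ((N2 + M) + (N1 + M')) :=
      bd_mono le_rfl (by positivity) (by nlinarith [mul_pos hC2 hK]) (by omega)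
    calc _ = C1 * K' * (d + 1) * (1 + x ^ 2) ^ (N1 + M') *
          (f.reverse.evalEval x y⁻¹ * y ^ (2 * d)) := by rw [pow_add]; ring
      _ = C1 * K' * (d + 1) * (1 + x ^ 2) ^ (N1 + M') * f.evalEval x y := by rw [hr]
      _ ≤ _ := mul_le_mul_of_nonneg_right a4 hfx

theorem lower_bound' {f : ℝ[X][X]} (hf : ∀ a b, 0 ≤ f.evalEval a b) (h0 : f ≠ 0)
    (hsq : ∀ g, g ^ 2 ∣ f → g.natDegree = 0) {d : ℕ} (hd : f.natDegree = 2 * d) :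
    ∃ (ω : ℝ[X]) (N : ℕ), (∀ q : ℝ[X], (∀ x, q.eval x ≠ 0) → IsCoprime ω q) ∧ ∀ x y,
      ω.eval x ^ 2 * tau d y ≤ (1 + x ^ 2) ^ N * f.evalEval x y := by
  obtain ⟨w, K, N, hw, hK, hb⟩ := lower_bound hf h0 hsq hd
  obtain ⟨ρ, c, hc, hρ0, hρ, hco⟩ := exists_realpart w hw
  have hcK : 0 < Real.sqrt (c / K) := Real.sqrt_pos.2 (by positivity)
  refine ⟨C (Real.sqrt (c / K)) * ρ, N, ?_, ?_⟩
  · intro q hq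
    exact (isCoprime_mul_unit_left_left (isUnit_C.2 (isUnit_iff_ne_zero.2 hcK.ne')) _ _).2 (hco q hq)
  · intro x y
    rw [eval_mul, eval_C, mul_pow, Real.sq_sqrt (by positivity)]
    have h1 := mul_le_mul_of_nonneg_right (hρ x) (tau_nonneg d y)
    have h2 := h1.trans (hb x y)
    have h3 : c / K * ρ.eval x ^ 2 * tau d y = (c * ρ.eval x ^ 2 * tau d y) / K := by ring
    rw [h3, div_le_iff₀ hK]
    linarith
end BNS

namespace BNS
open Polynomial

noncomputable def tauP (d : ℕ) : ℝ[X][X] := ∑ j ∈ Finset.range (d + 1), X ^ (2 * j)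

theorem isSumSq_sum {R ι : Type*} [CommSemiring R] (s : Finset ι) (f : ι → R)
    (h : ∀ i ∈ s, IsSumSq (f i)) : IsSumSq (∑ i ∈ s, f i) := by
  classical
  induction s using Finset.induction_on with
  | empty => simpa using IsSumSq.zero
  | insert a s ha ih =>
    rw [Finset.sum_insert ha]
    exact (h a (Finset.mem_insert_self _ _)).add (ih fun i hi => h i (Finset.mem_insert_of_mem hi))

theorem isSumSq_pow_even (j : ℕ) : IsSumSq ((X : ℝ[X][X]) ^ (2 * j)) := by
  rw [mul_comm, pow_mul]; exact isSumSq_sq _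

theorem isSumSq_C_of_nonneg {a : ℝ[X]} (h : ∀ x, 0 ≤ a.eval x) : IsSumSq (C a) :=
  isSumSq_map C (isSumSq_of_nonneg a h)

theorem evalEval_tauP (d : ℕ) (x y : ℝ) : (tauP d).evalEval x y = tau d y := by
  rw [tauP, tau, evalEval_finset_sum]
  simp [evalEval_pow, evalEval_X]

theorem absorb_one {d : ℕ} {η g : ℝ[X]} (h : ∀ x, |g.eval x| ≤ η.eval x) {i : ℕ} (hi : i ≤ 2 * d) :
    IsSumSq (C η * tauP d + C g * X ^ i) := by
  have hη : ∀ x, 0 ≤ η.eval x := fun x => (abs_nonneg _).trans (h x)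
  have hsub : ∀ s : Finset ℕ, IsSumSq (C η * ∑ j ∈ s, (X : ℝ[X][X]) ^ (2 * j)) := fun s =>
    (isSumSq_C_of_nonneg hη).mul (isSumSq_sum _ _ fun j _ => isSumSq_pow_even j)
  rcases Nat.even_or_odd' i with ⟨j, rfl | rfl⟩
  · have hj : j ∈ Finset.range (d + 1) := Finset.mem_range.2 (by omega)
    have e := Finset.add_sum_erase _ (fun j => (X : ℝ[X][X]) ^ (2 * j)) hj
    have : C η * tauP d + C g * X ^ (2 * j) = C (η + g) * X ^ (2 * j) +
        C η * ∑ k ∈ (Finset.range (d + 1)).erase j, X ^ (2 * k) := by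
      rw [tauP, ← e, C_add]; ring
    rw [this]
    refine IsSumSq.add ((isSumSq_C_of_nonneg fun x => ?_).mul (isSumSq_pow_even j)) (hsub _)
    rw [eval_add]
    have := (abs_le.1 (h x)).1
    linarith
  · have hj : j ∈ Finset.range (d + 1) := Finset.mem_range.2 (by omega)
    have hj1 : j + 1 ∈ (Finset.range (d + 1)).erase j := by
      rw [Finset.mem_erase, Finset.mem_range]; omega
    have e := Finset.add_sum_erase _ (fun j => (X : ℝ[X][X]) ^ (2 * j)) hj
    have e1 := Finset.add_sum_erase _ (fun j => (X : ℝ[X][X]) ^ (2 * j)) hj1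
    have c4 : (C (C (1 / 2 : ℝ)) : ℝ[X][X]) * 2 = 1 := by
      rw [show (2 : ℝ[X][X]) = C (C 2) by simp only [map_ofNat], ← C_mul, ← C_mul]; norm_num
    have : C η * tauP d + C g * X ^ (2 * j + 1) =
        X ^ (2 * j) * (C (C (1 / 2) * (η + C (1 / 2) * g)) * (1 + X) ^ 2 +
          C (C (1 / 2) * (η - C (1 / 2) * g)) * (1 - X) ^ 2) +
        C η * ∑ k ∈ ((Finset.range (d + 1)).erase j).erase (j + 1), X ^ (2 * k) := by
      rw [tauP, ← e, ← e1]
      simp only [C_add, C_mul, C_sub]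
      have e3 : (X : ℝ[X][X]) ^ (2 * (j + 1)) = X ^ (2 * j) * X ^ 2 := by ring
      rw [e3, pow_succ (X : ℝ[X][X]) (2 * j)]
      linear_combination (-(X ^ (2 * j) * C η * (1 + X ^ 2)) -
        X ^ (2 * j) * X * C g * (C (C (1 / 2 : ℝ)) * 2 + 1)) * c4
    rw [this]
    refine IsSumSq.add ((isSumSq_pow_even j).mul (IsSumSq.add ?_ ?_)) (hsub _)
    · refine (isSumSq_C_of_nonneg fun x => ?_).mul (isSumSq_sq _)
      simp only [eval_mul, eval_add, eval_C]
      have := (abs_le.1 (h x)).1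
      have := hη x
      nlinarith
    · refine (isSumSq_C_of_nonneg fun x => ?_).mul (isSumSq_sq _)
      simp only [eval_mul, eval_sub, eval_C]
      have := (abs_le.1 (h x)).2
      have := hη x
      nlinarith

theorem absorb {d : ℕ} {η A : ℝ[X]} {P : ℝ[X][X]} (hP : P.natDegree ≤ 2 * d)
    (h : ∀ i x, |(P.coeff i).eval x| ≤ η.eval x)
    (hA : ∀ x, (2 * d + 1) * η.eval x ≤ A.eval x) : IsSumSq (C A * tauP d + P) := by
  have hsum : P = ∑ i ∈ Finset.range (2 * d + 1), C (P.coeff i) * X ^ i :=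
    as_sum_range_C_mul_X_pow' P (by omega)
  have : C A * tauP d + P = C (A - (2 * d + 1 : ℕ) * η) * tauP d +
      ∑ i ∈ Finset.range (2 * d + 1), (C η * tauP d + C (P.coeff i) * X ^ i) := by
    rw [Finset.sum_add_distrib, ← hsum, Finset.sum_const, Finset.card_range, nsmul_eq_mul]
    simp only [C_sub, C_mul, map_natCast]
    ring
  rw [this]
  refine IsSumSq.add ((isSumSq_C_of_nonneg fun x => ?_).mul
    (isSumSq_sum _ _ fun j _ => isSumSq_pow_even j)) (isSumSq_sum _ _ fun i hi => ?_)
  · have := hA x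
    simp only [eval_sub, eval_mul, eval_natCast]
    push_cast
    linarith
  · exact absorb_one (h i) (by have := Finset.mem_range.1 hi; omega)

theorem bd_coeffs (P : ℝ[X][X]) : ∃ (C : ℝ) (N : ℕ), 0 < C ∧
    ∀ i x, |(P.coeff i).eval x| ≤ C * (1 + x ^ 2) ^ N := by
  induction P using Polynomial.induction_on' with
  | add p q hp hq =>
    obtain ⟨C1, N1, hC1, h1⟩ := hp
    obtain ⟨C2, N2, hC2, h2⟩ := hq
    refine ⟨C1 + C2, N1 + N2, by positivity, fun i x => ?_⟩
    rw [coeff_add, eval_add, add_mul]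
    refine (abs_add_le _ _).trans (add_le_add ?_ ?_)
    · exact bd_mono (h1 i x) hC1.le le_rfl (by omega)
    · exact bd_mono (h2 i x) hC2.le le_rfl (by omega)
  | monomial n a =>
    obtain ⟨C1, N, hC1, h1⟩ := bd_one a
    refine ⟨C1, N, hC1, fun i x => ?_⟩
    rw [coeff_monomial]
    split_ifs
    · exact h1 x
    · simp; positivity

theorem main_sqfree {f : ℝ[X][X]} (hf : ∀ a b, 0 ≤ f.evalEval a b) (h0 : f ≠ 0)
    (hsq : ∀ g, g ^ 2 ∣ f → g.natDegree = 0) :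
    ∃ k : ℕ, IsSumSq (C ((1 + X ^ 2) ^ k) * f) := by
  obtain ⟨d, hd⟩ := even_natDegree hf
  rw [← two_mul] at hd
  obtain ⟨ω, N, hco, hb⟩ := lower_bound' hf h0 hsq hd
  obtain ⟨f', hf'⟩ : ∃ f', f' = C ((1 + X ^ 2) ^ N) * f := ⟨_, rfl⟩
  have hFnn : ∀ a b, 0 ≤ (f' - C (ω ^ 2) * tauP d).evalEval a b := by
    intro x y
    have := hb x y
    rw [hf', evalEval_sub, evalEval_mul, evalEval_mul, evalEval_C, evalEval_C, evalEval_tauP]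
    simp only [eval_pow, eval_add, eval_one, eval_X]
    linarith
  obtain ⟨r, hr, hs⟩ := artin _ _ rfl hFnn
  obtain ⟨h, hz, hS⟩ := remove_real_zeros hr hs
  obtain ⟨C1, m1, hC1, h1⟩ := bd_one (ω ^ 2)
  obtain ⟨C2, m2, hC2, h2⟩ := bd_coeffs f'
  obtain ⟨δ, hδ, hδ1, hδ2⟩ : ∃ δ : ℝ, 0 < δ ∧ C1 * δ ≤ 1 / 2 ∧ (2 * d + 1) * (C2 * δ) ≤ 1 / 2 := by
    refine ⟨1 / (2 * (C1 + (2 * d + 1) * C2)), by positivity, ?_, ?_⟩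
    · rw [mul_one_div, div_le_div_iff₀ (by positivity) (by positivity)]
      nlinarith [mul_pos (show (0:ℝ) < 2 * d + 1 by positivity) hC2]
    · rw [mul_one_div, ← mul_div_assoc, div_le_div_iff₀ (by positivity) (by positivity)]
      nlinarith
  obtain ⟨k, Q, e, hQ, he⟩ := glue h ω hz (hco h hz) (m1 + m2) δ hδ
  have hQx : ∀ x, Q.eval x * h.eval x ^ 2 + ω.eval x ^ 2 * e.eval x = (1 + x ^ 2) ^ k := by
    intro x
    have := congrArg (eval x) hQ
    simpa using this
  have bnd : ∀ x (t a : ℝ) (m : ℕ), m ≤ m1 + m2 → 0 ≤ a → |t| ≤ a * (1 + x ^ 2) ^ m →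
      |e.eval x * t| ≤ a * δ * (1 + x ^ 2) ^ k := by
    intro x t a m hm ha ht
    have b1 := bd_mono ht ha le_rfl hm
    rw [abs_mul]
    calc _ ≤ |e.eval x| * (a * (1 + x ^ 2) ^ (m1 + m2)) :=
          mul_le_mul_of_nonneg_left b1 (abs_nonneg _)
      _ = a * (|e.eval x| * (1 + x ^ 2) ^ (m1 + m2)) := by ring
      _ ≤ a * (δ * (1 + x ^ 2) ^ k) := mul_le_mul_of_nonneg_left (he x) ha
      _ = _ := by ring
  have pk : ∀ x : ℝ, (0:ℝ) < (1 + x ^ 2) ^ k := fun x => by positivity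
  have hQh : ∀ x, 1 / 2 * (1 + x ^ 2) ^ k ≤ Q.eval x * h.eval x ^ 2 := by
    intro x
    have b1 := bnd x (ω.eval x ^ 2) C1 m1 (by omega) hC1.le (by simpa using h1 x)
    have b2 := (abs_le.1 b1).2
    have b3 := hQx x
    have b4 := mul_le_mul_of_nonneg_right hδ1 (pk x).le
    linarith
  have hQnn : ∀ x, 0 ≤ Q.eval x := by
    intro x
    have b1 := hQh x
    have b2 := pk x
    have b3 : 0 < h.eval x ^ 2 := by have := hz x; positivity
    by_contra hneg
    push Not at hneg
    nlinarith
  have hfin : IsSumSq (C (Q * h ^ 2) * tauP d + C e * f') := by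
    refine absorb (η := C (C2 * δ) * (1 + X ^ 2) ^ k) ?_ ?_ ?_
    · refine (natDegree_C_mul_le _ _).trans ?_
      rw [hf']
      refine (natDegree_C_mul_le _ _).trans ?_
      exact hd.le
    · intro i x
      rw [coeff_C_mul, eval_mul]
      have := bnd x _ C2 m2 (by omega) hC2.le (h2 i x)
      simpa using this
    · intro x
      have b1 := hQh x
      have b4 := mul_le_mul_of_nonneg_right hδ2 (pk x).le
      simp only [eval_mul, eval_C, eval_pow, eval_add, eval_one, eval_X]
      linarith
  refine ⟨k + N, ?_⟩
  have key : C ((1 + X ^ 2) ^ (k + N)) * f = C Q * (C h ^ 2 * (f' - C (ω ^ 2) * tauP d)) +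
      C ω ^ 2 * (C (Q * h ^ 2) * tauP d + C e * f') := by
    rw [pow_add, ← hQ, C_mul, mul_assoc, ← hf']
    simp only [C_add, C_mul, C_pow]
    ring
  rw [key]
  exact ((isSumSq_C_of_nonneg hQnn).mul hS).add ((isSumSq_sq _).mul hfin)

theorem main_biv : ∀ (n : ℕ) (f : ℝ[X][X]), f.natDegree = n → (∀ a b, 0 ≤ f.evalEval a b) →
    ∃ k : ℕ, IsSumSq (C ((1 + X ^ 2) ^ k) * f) := by
  intro n
  induction n using Nat.strong_induction_on with
  | _ n ih =>
  intro f hn hf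
  by_cases h00 : f = 0
  · exact ⟨0, by rw [h00, mul_zero]; exact IsSumSq.zero⟩
  by_cases hsq : ∀ g, g ^ 2 ∣ f → g.natDegree = 0
  · exact main_sqfree hf h00 hsq
  · push Not at hsq
    obtain ⟨g, ⟨h, hh⟩, hg⟩ := hsq
    have hg0 : g ≠ 0 := by rintro rfl; simp at hg
    have hh0 : h ≠ 0 := by rintro rfl; rw [mul_zero] at hh; exact h00 hh
    obtain ⟨k, hs⟩ := ih h.natDegree (by
      rw [← hn, hh, natDegree_mul (pow_ne_zero _ hg0) hh0, natDegree_pow]; omega) h rfl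
      (nn_of_sq_mul hg0 (by rwa [← hh]))
    refine ⟨k, ?_⟩
    rw [hh, mul_left_comm]
    exact (isSumSq_sq _).mul hs

theorem main_mv (f : MvPolynomial (Fin 2) ℝ)
    (hf : ∀ a b : ℝ, 0 ≤ MvPolynomial.eval ![a, b] f) :
    ∃ k : ℕ, IsSumSq ((1 + MvPolynomial.X 0 ^ 2) ^ k * f) := by
  let Φ : MvPolynomial (Fin 2) ℝ →ₐ[ℝ] ℝ[X][X] := MvPolynomial.aeval ![C X, X]
  let Ψ : ℝ[X][X] →+* MvPolynomial (Fin 2) ℝ :=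
    eval₂RingHom (aeval (MvPolynomial.X 0) : ℝ[X] →ₐ[ℝ] MvPolynomial (Fin 2) ℝ).toRingHom
      (MvPolynomial.X 1)
  have hΨΦ : ∀ g, Ψ (Φ g) = g := by
    intro g
    induction g using MvPolynomial.induction_on with
    | C a => 
      simp only [Φ, MvPolynomial.aeval_C]
      rw [IsScalarTower.algebraMap_apply ℝ ℝ[X] ℝ[X][X]]
      simp [Ψ, Polynomial.algebraMap_eq, MvPolynomial.algebraMap_eq]
    | add p q hp hq => rw [map_add, map_add, hp, hq]
    | mul_X p i hp =>
      rw [map_mul, map_mul, hp]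
      congr 1
      fin_cases i <;> simp [Φ, Ψ]
  have hev : ∀ g a b, (Φ g).evalEval a b = MvPolynomial.eval ![a, b] g := by
    intro g a b
    induction g using MvPolynomial.induction_on with
    | C r => 
      simp only [Φ, MvPolynomial.aeval_C, MvPolynomial.eval_C]
      rw [IsScalarTower.algebraMap_apply ℝ ℝ[X] ℝ[X][X]]
      simp [Polynomial.algebraMap_eq, evalEval_C]
    | add p q hp hq => rw [map_add, map_add, evalEval_add, hp, hq]
    | mul_X p i hp =>
      rw [map_mul, map_mul, evalEval_mul, hp]
      congr 1
      fin_cases i <;> simp [Φ, evalEval_C, evalEval_X]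
  obtain ⟨k, hk⟩ := main_biv _ (Φ f) rfl (fun a b => by rw [hev]; exact hf a b)
  refine ⟨k, ?_⟩
  have := isSumSq_map Ψ hk
  rw [map_mul, hΨΦ] at this
  have e : Ψ (C ((1 + X ^ 2) ^ k)) = (1 + MvPolynomial.X 0 ^ 2) ^ k := by
    simp only [Ψ, coe_eval₂RingHom, eval₂_C]
    simp
  rw [← e]
  exact this
end BNS

open MvPolynomial

/-- **Theorem C / Theorem `t:bivar`.** If `f ∈ ℝ[x,y]` is nonnegative on `ℝ²`, then there
exists `k ∈ ℕ` such that `(1 + x²)^k * f` is a sum of squares of polynomials in `ℝ[x,y]`. -/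
theorem bivariate_nonneg_sos_with_denominator (f : MvPolynomial (Fin 2) ℝ)
    (hf : ∀ a b : ℝ, 0 ≤ eval ![a, b] f) :
    ∃ k : ℕ, IsSumSq ((1 + X 0 ^ 2) ^ k * f) := by
  exact BNS.main_mv f hf
end

section
/- Let n ≥ 1 and let φ : ℝ[t₁,…,tₙ] → ℝ be a linear functional with φ(1) = 1. Then the following are equivalent: (a) there exists a Borel probability measure μ on ℝⁿ such that every polynomial is μ-integrable and φ(p) = ∫_{ℝⁿ} p dμ for all p ∈ ℝ[t₁,…,tₙ]; (b) φ(f) ≥ 0 for every f in the cone C. -/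
open MvPolynomial MeasureTheory

noncomputable def havPolyEv (n : ℕ) : MvPolynomial (Fin n) ℝ →ₗ[ℝ] ((Fin n → ℝ) → ℝ) where
  toFun p := fun x => eval x p
  map_add' p q := by ext x; simp
  map_smul' c p := by ext x; simp [smul_eval]

def havPB (n : ℕ) : Submodule ℝ ((Fin n → ℝ) → ℝ) where
  carrier := {g | ∃ p : MvPolynomial (Fin n) ℝ, ∀ x, |g x| ≤ eval x p}
  zero_mem' := ⟨0, by simp⟩
  add_mem' := by
    rintro f g ⟨p, hp⟩ ⟨q, hq⟩
    exact ⟨p + q, fun x => by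
      simpa using (abs_add_le (f x) (g x)).trans (add_le_add (hp x) (hq x))⟩
  smul_mem' := by
    rintro c f ⟨p, hp⟩
    exact ⟨C |c| * p, fun x => by
      simpa [abs_mul] using mul_le_mul_of_nonneg_left (hp x) (abs_nonneg c)⟩

lemma havPolyEv_mem (n : ℕ) (p : MvPolynomial (Fin n) ℝ) : havPolyEv n p ∈ havPB n :=
  ⟨1 + p ^ 2, fun x => by
    simp only [havPolyEv, LinearMap.coe_mk, AddHom.coe_mk, map_add, map_one, map_pow]
    rw [abs_le]; constructor <;> nlinarith [sq_nonneg (eval x p - 1), sq_nonneg (eval x p + 1)]⟩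

noncomputable def havEv (n : ℕ) : MvPolynomial (Fin n) ℝ →ₗ[ℝ] havPB n :=
  (havPolyEv n).codRestrict (havPB n) (havPolyEv_mem n)

lemma havEv_apply (n : ℕ) (p : MvPolynomial (Fin n) ℝ) (x : Fin n → ℝ) :
    (havEv n p).1 x = eval x p := rfl

lemma havEv_inj (n : ℕ) : Function.Injective (havEv n) := by
  intro p q h
  apply MvPolynomial.funext
  intro x
  rw [← havEv_apply, ← havEv_apply, h]

lemma hav_extend (n : ℕ) (φ : MvPolynomial (Fin n) ℝ →ₗ[ℝ] ℝ)
    (hpos : ∀ p : MvPolynomial (Fin n) ℝ, (∀ x, 0 ≤ eval x p) → 0 ≤ φ p) :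
    ∃ L : havPB n →ₗ[ℝ] ℝ, (∀ p, L (havEv n p) = φ p) ∧
      ∀ g : havPB n, (∀ x, 0 ≤ g.1 x) → 0 ≤ L g := by
  let s : PointedCone ℝ (havPB n) :=
    { carrier := {g | ∀ x, 0 ≤ g.1 x}
      zero_mem' := fun x => le_refl _
      add_mem' := fun {f g} hf hg x => add_nonneg (hf x) (hg x)
      smul_mem' := fun c f hf x => mul_nonneg c.2 (hf x) }
  let e := LinearEquiv.ofInjective (havEv n) (havEv_inj n)
  let f : havPB n →ₗ.[ℝ] ℝ := ⟨LinearMap.range (havEv n), φ.comp e.symm.toLinearMap⟩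
  have hf : ∀ p, f (e p) = φ p := fun p => by
    change φ (e.symm (e p)) = φ p
    rw [e.symm_apply_apply]
  obtain ⟨g, h1, h2⟩ := riesz_extension s f (by
    intro x hx
    obtain ⟨p, rfl⟩ := e.surjective x
    rw [hf]
    exact hpos p hx) (by
    rintro ⟨y, p, hp⟩
    refine ⟨e p, fun x => ?_⟩
    change 0 ≤ eval x p + y x
    linarith [(abs_le.1 (hp x)).1])
  refine ⟨g, fun p => ?_, fun q hq => h2 q hq⟩
  rw [← hf p, ← h1 (e p)]
  rfl

open CompactlySupported in
lemma hav_cc_mem (n : ℕ) (f : C_c(Fin n → ℝ, ℝ)) : (f : (Fin n → ℝ) → ℝ) ∈ havPB n := by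
  obtain ⟨c, hc⟩ := f.2.exists_bound_of_continuous f.1.2
  exact ⟨C c, fun x => by simpa using hc x⟩

open CompactlySupported in
def havCc (n : ℕ) : C_c(Fin n → ℝ, ℝ) →ₗ[ℝ] havPB n where
  toFun f := ⟨f, hav_cc_mem n f⟩
  map_add' _ _ := rfl
  map_smul' _ _ := rfl

noncomputable def havQ (n : ℕ) : MvPolynomial (Fin n) ℝ := 1 + ∑ i, X i ^ 2

lemma havQ_pos (n : ℕ) (x : Fin n → ℝ) : 1 ≤ eval x (havQ n) := by
  simp only [havQ, map_add, map_one, map_sum, map_pow, eval_X]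
  have : 0 ≤ ∑ i, x i ^ 2 := Finset.sum_nonneg fun i _ => sq_nonneg _
  linarith

noncomputable def havChi (n : ℕ) (r : ℕ) (x : Fin n → ℝ) : ℝ := max 0 (1 - eval x (havQ n) / (r + 1))

open CompactlySupported in
lemma hav_cc (n r : ℕ) (p : MvPolynomial (Fin n) ℝ) :
    ∃ g : C_c(Fin n → ℝ, ℝ), ∀ x, g x = eval x p * havChi n r x := by
  have hc : Continuous fun x : Fin n → ℝ => eval x p * havChi n r x := by
    have := (havQ n).continuous_eval
    have := p.continuous_eval
    unfold havChi
    fun_prop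
  refine ⟨⟨⟨_, hc⟩, ?_⟩, fun x => rfl⟩
  refine HasCompactSupport.intro (isCompact_closedBall (0 : Fin n → ℝ) (r + 1)) fun x hx => ?_
  simp only [Metric.mem_closedBall, dist_zero_right, not_le] at hx
  have hr : (0:ℝ) < r + 1 := by positivity
  have : (r + 1 : ℝ) ≤ eval x (havQ n) := by
    obtain ⟨i, hi⟩ : ∃ i, (r + 1 : ℝ) < ‖x i‖ := by
      by_contra! h
      exact absurd ((pi_norm_le_iff_of_nonneg hr.le).2 h) (not_le.2 hx)
    have h2 : x i ^ 2 ≤ ∑ i, x i ^ 2 :=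
      Finset.single_le_sum (f := fun i => x i ^ 2) (fun j _ => sq_nonneg _) (Finset.mem_univ i)
    simp only [havQ, map_add, map_one, map_sum, map_pow, eval_X]
    have h3 : ‖x i‖ ^ 2 = x i ^ 2 := by simp
    nlinarith
  have h4 : havChi n r x = 0 := by
    unfold havChi
    apply max_eq_left
    rw [sub_nonpos, le_div_iff₀ hr]
    linarith
  simp [h4]

lemma haviland (n : ℕ) (φ : MvPolynomial (Fin n) ℝ →ₗ[ℝ] ℝ) (hφ1 : φ 1 = 1)
    (hpos : ∀ p : MvPolynomial (Fin n) ℝ, (∀ x, 0 ≤ eval x p) → 0 ≤ φ p) :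
    ∃ μ : Measure (Fin n → ℝ), IsProbabilityMeasure μ ∧
      ∀ p : MvPolynomial (Fin n) ℝ,
        Integrable (fun x => eval x p) μ ∧ φ p = ∫ x, eval x p ∂μ := by
  obtain ⟨L, hL1, hL2⟩ := hav_extend n φ hpos
  let Λ := PositiveLinearMap.mk₀ (L.comp (havCc n)) (fun f hf => hL2 _ fun x => (CompactlySupportedContinuousMap.le_def.1 hf) x)
  let μ := RealRMK.rieszMeasure Λ
  have hμ : ∀ f, ∫ x, f x ∂μ = L (havCc n f) := RealRMK.integral_rieszMeasure Λ
  have hLm : ∀ f g : havPB n, (∀ x, f.1 x ≤ g.1 x) → L f ≤ L g := fun f g h => by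
    have := hL2 (g - f) fun x => sub_nonneg.2 (h x)
    rw [map_sub] at this
    linarith
  have key : ∀ p : MvPolynomial (Fin n) ℝ, (∀ x, 0 ≤ eval x p) →
      ∫⁻ x, ENNReal.ofReal (eval x p) ∂μ = ENNReal.ofReal (φ p) := by
    intro p hp
    choose g hg using fun r => hav_cc n r p
    have hchi0 : ∀ r x, 0 ≤ havChi n r x := fun r x => le_max_left _ _
    have hg0 : ∀ r x, 0 ≤ g r x := fun r x => by
      rw [hg]; exact mul_nonneg (hp x) (hchi0 r x)
    have e1 : ∀ r, ∫⁻ x, ENNReal.ofReal (g r x) ∂μ = ENNReal.ofReal (L (havCc n (g r))) := by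
      intro r
      rw [← hμ, ofReal_integral_eq_lintegral_ofReal _ (ae_of_all _ (hg0 r))]
      exact (g r).1.2.integrable_of_hasCompactSupport (g r).2
    have hchi1 : ∀ r x, havChi n r x ≤ 1 := fun r x => by
      have := havQ_pos n x
      have : 0 ≤ eval x (havQ n) / (r + 1) := by positivity
      exact max_le zero_le_one (by linarith)
    have hchi2 : ∀ (r : ℕ) x, 1 - eval x (havQ n) / (r + 1) ≤ havChi n r x :=
      fun r x => le_max_right _ _
    have lim0 : ∀ c : ℝ, Filter.Tendsto (fun r : ℕ => c / ((r : ℝ) + 1)) Filter.atTop (nhds 0) :=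
      fun c => by simpa [div_eq_mul_inv] using tendsto_one_div_add_atTop_nhds_zero_nat.const_mul c
    have t1 : Filter.Tendsto (fun r => ∫⁻ x, ENNReal.ofReal (g r x) ∂μ) Filter.atTop
        (nhds (∫⁻ x, ENNReal.ofReal (eval x p) ∂μ)) := by
      apply lintegral_tendsto_of_tendsto_of_monotone
      · intro r
        exact ((g r).1.2.measurable.ennreal_ofReal).aemeasurable
      · refine ae_of_all _ fun x r r' hr => ENNReal.ofReal_le_ofReal ?_
        rw [hg, hg]
        refine mul_le_mul_of_nonneg_left ?_ (hp x)
        have := havQ_pos n x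
        have : (r : ℝ) ≤ r' := by exact_mod_cast hr
        unfold havChi
        gcongr
      · refine ae_of_all _ fun x => ENNReal.tendsto_ofReal ?_
        have h1 : Filter.Tendsto (fun r => havChi n r x) Filter.atTop (nhds 1) := by
          refine tendsto_of_tendsto_of_tendsto_of_le_of_le ?_ tendsto_const_nhds
            (fun r => hchi2 r x) (fun r => hchi1 r x)
          simpa using (lim0 (eval x (havQ n))).const_sub 1
        simpa [hg] using h1.const_mul (eval x p)
    have t2 : Filter.Tendsto (fun r => L (havCc n (g r))) Filter.atTop (nhds (φ p)) := by
      refine tendsto_of_tendsto_of_tendsto_of_le_of_le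
        (g := fun r : ℕ => φ p - φ (p * havQ n) / (r + 1)) (h := fun _ => φ p) ?_
        tendsto_const_nhds (fun r => ?_) (fun r => ?_)
      · simpa using (lim0 (φ (p * havQ n))).const_sub (φ p)
      · have : φ p - φ (p * havQ n) / (r + 1)
            = L (havEv n (p - ((r : ℝ) + 1)⁻¹ • (p * havQ n))) := by
          rw [hL1, map_sub, map_smul, smul_eq_mul]; ring
        simp only [this]
        refine hLm _ _ fun x => ?_
        change eval x (p - ((r : ℝ) + 1)⁻¹ • (p * havQ n)) ≤ g r x
        rw [hg, map_sub, smul_eval, map_mul]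
        calc _ = eval x p * (1 - eval x (havQ n) / (r + 1)) := by ring
          _ ≤ _ := mul_le_mul_of_nonneg_left (hchi2 r x) (hp x)
      · simp only [← hL1]
        refine hLm _ _ fun x => ?_
        change g r x ≤ eval x p
        rw [hg]
        exact mul_le_of_le_one_right (hp x) (hchi1 r x)
    simp only [e1] at t1
    exact tendsto_nhds_unique t1 (ENNReal.tendsto_ofReal t2)
  have key2 : ∀ p : MvPolynomial (Fin n) ℝ, (∀ x, 0 ≤ eval x p) →
      Integrable (fun x => eval x p) μ ∧ φ p = ∫ x, eval x p ∂μ := by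
    intro p hp
    have hm : AEStronglyMeasurable (fun x => eval x p) μ :=
      p.continuous_eval.aestronglyMeasurable
    constructor
    · refine ⟨hm, ?_⟩
      rw [hasFiniteIntegral_iff_ofReal (ae_of_all _ hp), key p hp]
      exact ENNReal.ofReal_lt_top
    · rw [integral_eq_lintegral_of_nonneg_ae (ae_of_all _ hp) hm, key p hp,
        ENNReal.toReal_ofReal (hpos p hp)]
  refine ⟨μ, ⟨?_⟩, fun p => ?_⟩
  · have := key 1 (by simp)
    simpa [hφ1] using this
  · obtain ⟨i1, j1⟩ := key2 ((p + 1) ^ 2) fun x => by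
      rw [map_pow]; positivity
    obtain ⟨i2, j2⟩ := key2 ((p - 1) ^ 2) fun x => by
      rw [map_pow]; positivity
    have hp : p = (1 / 4 : ℝ) • ((p + 1) ^ 2 - (p - 1) ^ 2) := by
      have : (p + 1) ^ 2 - (p - 1) ^ 2 = (4 : ℝ) • p := by
        rw [Algebra.smul_def, map_ofNat]; ring
      rw [this, smul_smul]; norm_num
    have hpe : (fun x => eval x p) =
        fun x => (1 / 4 : ℝ) * (eval x ((p + 1) ^ 2) - eval x ((p - 1) ^ 2)) := by
      funext x
      simp; ring
    constructor
    · rw [hpe]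
      exact (i1.sub i2).const_mul _
    · rw [hpe, integral_const_mul, integral_sub i1 i2, ← j1, ← j2]
      conv_lhs => rw [hp]
      rw [map_smul, map_sub, smul_eq_mul]

noncomputable def havOm (M j : ℕ) : ℂ := Complex.exp (((Real.pi * j / M : ℝ) : ℂ) * Complex.I)

lemma havOm_ne (M j : ℕ) : havOm M j ≠ 0 := Complex.exp_ne_zero _

lemma hav_orth_sum (M : ℕ) (hM : 0 < M) (d : ℤ) (hd : |d| < M) :
    ∑ j ∈ Finset.range M, havOm M j ^ (2 * d) = if d = 0 then (M : ℂ) else 0 := by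
  have hM' : M ≠ 0 := hM.ne'
  split_ifs with h
  · simp [h]
  · set ζ : ℂ := Complex.exp (2 * Real.pi * Complex.I / M) with hζ
    have hp : IsPrimitiveRoot ζ M := Complex.isPrimitiveRoot_exp M hM'
    have e : ∀ j, havOm M j ^ (2 * d) = (ζ ^ d) ^ j := by
      intro j
      rw [havOm, ← Complex.exp_int_mul, hζ, ← Complex.exp_int_mul, ← Complex.exp_nat_mul]
      congr 1
      push_cast
      ring
    simp only [e]
    have h1 : ζ ^ d ≠ 1 := by
      rw [Ne, hp.zpow_eq_one_iff_dvd]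
      intro hdv
      exact h (Int.eq_zero_of_abs_lt_dvd hdv hd)
    rw [geom_sum_eq h1]
    have : (ζ ^ d) ^ M = 1 := by
      rw [← zpow_natCast, ← zpow_mul, mul_comm, zpow_mul, hp.zpow_eq_one, one_zpow]
    simp [this]

lemma hav_orth (m k a b : ℕ) (hab : a + b = 2 * m) {R : Type*} [CommRing R] [Algebra ℂ R]
    (u v : R) :
    ∑ j ∈ Finset.range (2 * m + 4 * k + 1),
      (havOm (2 * m + 4 * k + 1) j ^ a * (havOm (2 * m + 4 * k + 1) j)⁻¹ ^ b) •
      ((havOm (2 * m + 4 * k + 1) j)⁻¹ • u + havOm (2 * m + 4 * k + 1) j • v) ^ (2 * m + 4 * k)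
    = (((2 * m + 4 * k + 1 : ℕ) : ℂ) * ((2 * m + 4 * k).choose (a + 2 * k) : ℂ)) •
        (u ^ (a + 2 * k) * v ^ (b + 2 * k)) := by
  set M := 2 * m + 4 * k + 1 with hM
  simp only [add_pow, Finset.smul_sum]
  rw [Finset.sum_comm]
  have hterm : ∀ l ∈ Finset.range (2 * m + 4 * k + 1), ∑ j ∈ Finset.range M,
      (havOm M j ^ a * (havOm M j)⁻¹ ^ b) • (((havOm M j)⁻¹ • u) ^ l *
        (havOm M j • v) ^ (2 * m + 4 * k - l) * ((2 * m + 4 * k).choose l : R))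
      = if l = a + 2 * k then
        ((M : ℂ) * ((2 * m + 4 * k).choose (a + 2 * k) : ℂ)) • (u ^ (a + 2 * k) * v ^ (b + 2 * k))
        else 0 := by
    intro l hl
    rw [Finset.mem_range] at hl
    have h1 : ∀ j, (havOm M j ^ a * (havOm M j)⁻¹ ^ b) • (((havOm M j)⁻¹ • u) ^ l *
        (havOm M j • v) ^ (2 * m + 4 * k - l) * ((2 * m + 4 * k).choose l : R))
        = (havOm M j ^ (2 * ((a : ℤ) + 2 * k - l))) •
          (((2 * m + 4 * k).choose l : ℂ) • (u ^ l * v ^ (2 * m + 4 * k - l))) := by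
      intro j
      have hw := havOm_ne M j
      generalize havOm M j = w at *
      have h2 : w ^ (2 * ((a : ℤ) + 2 * k - l))
          = w ^ a * w⁻¹ ^ b * (w⁻¹ ^ l * w ^ (2 * m + 4 * k - l)) := by
        simp only [← zpow_natCast, inv_zpow', ← zpow_add₀ hw]
        congr 1
        push_cast [Nat.cast_sub (show l ≤ 2 * m + 4 * k by omega)]
        omega
      rw [h2, smul_pow, smul_pow, Nat.cast_smul_eq_nsmul, nsmul_eq_mul]
      simp only [Algebra.smul_def, map_mul, map_pow]
      ring
    simp only [h1]
    rw [← Finset.sum_smul, hav_orth_sum M (by omega) _ (by rw [abs_lt]; omega)]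
    by_cases h : l = a + 2 * k
    · subst h
      have h3 : 2 * m + 4 * k - (a + 2 * k) = b + 2 * k := by omega
      simp [h3, mul_smul]
    · rw [if_neg h, if_neg (by omega), zero_smul]
  rw [Finset.sum_congr rfl hterm, Finset.sum_ite_eq' , if_pos (by rw [Finset.mem_range]; omega)]

lemma hav_ratio_aux (m d : ℕ) :
    Filter.Tendsto (fun k : ℕ => ((2 * m + 4 * k).choose (m + 2 * k + d) : ℝ) /
      ((2 * m + 4 * k).choose (m + 2 * k) : ℝ)) Filter.atTop (nhds 1) := by
  have hpos : ∀ k : ℕ, ((2 * m + 4 * k).choose (m + 2 * k) : ℝ) ≠ 0 := fun k => by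
    exact_mod_cast (Nat.choose_pos (by omega)).ne'
  induction d with
  | zero => simp [hpos]
  | succ d ih =>
    have h2 : Filter.Tendsto (fun k : ℕ => 1 - (2 * (d : ℝ) + 1) / ((m + d + 2 * k : ℕ) + 1 : ℝ))
        Filter.atTop (nhds 1) := by
      have h0 := (tendsto_one_div_add_atTop_nhds_zero_nat (𝕜 := ℝ)).comp
        (Filter.tendsto_atTop_mono (f := fun k : ℕ => k) (g := fun k : ℕ => m + d + 2 * k)
          (fun k => by omega) Filter.tendsto_id)
      have h1 := (h0.const_mul (2 * (d : ℝ) + 1)).const_sub 1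
      simpa [div_eq_mul_inv] using h1
    have h3 := ih.mul h2
    rw [mul_one] at h3
    refine h3.congr' ?_
    filter_upwards [Filter.eventually_ge_atTop d] with k hk
    have h4 := Nat.choose_succ_right_eq (2 * m + 4 * k) (m + 2 * k + d)
    have h5 : 2 * m + 4 * k - (m + 2 * k + d) = m + 2 * k - d := by omega
    rw [h5] at h4
    have h6 : ((2 * m + 4 * k).choose (m + 2 * k + d + 1) : ℝ) * (m + 2 * k + d + 1)
        = (2 * m + 4 * k).choose (m + 2 * k + d) * (m + 2 * k - d) := by
      have := congrArg (Nat.cast : ℕ → ℝ) h4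
      push_cast [Nat.cast_sub (show d ≤ m + 2 * k by omega)] at this
      exact this
    have h7 : ((m : ℝ) + 2 * k + d + 1) ≠ 0 := by positivity
    have h8 : ((m + d + 2 * k : ℕ) + 1 : ℝ) = (m : ℝ) + 2 * k + d + 1 := by push_cast; ring
    rw [h8, ← add_assoc]
    have h9 : ((2 * m + 4 * k).choose (m + 2 * k + d + 1) : ℝ)
        = (2 * m + 4 * k).choose (m + 2 * k + d) * (m + 2 * k - d) / ((m : ℝ) + 2 * k + d + 1) := by
      rw [← h6]; field_simp
    have := hpos k
    rw [h9]
    field_simp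
    ring

lemma hav_ratio (m a : ℕ) (ha : a ≤ 2 * m) :
    Filter.Tendsto (fun k : ℕ => ((2 * m + 4 * k).choose (a + 2 * k) : ℝ) /
      ((2 * m + 4 * k).choose (m + 2 * k) : ℝ)) Filter.atTop (nhds 1) := by
  rcases le_total m a with h | h
  · refine (hav_ratio_aux m (a - m)).congr fun k => ?_
    rw [show m + 2 * k + (a - m) = a + 2 * k by omega]
  · refine (hav_ratio_aux m (m - a)).congr fun k => ?_
    rw [Nat.choose_symm_of_eq_add (show 2 * m + 4 * k = (m + 2 * k + (m - a)) + (a + 2 * k) by omega)]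

noncomputable def havRe (n : ℕ) : MvPolynomial (Fin n) ℂ →ₗ[ℝ] MvPolynomial (Fin n) ℝ where
  toFun p := ∑ s ∈ p.support, monomial s (coeff s p).re
  map_add' p q := by
    have h : ∀ (p : MvPolynomial (Fin n) ℂ) t,
        coeff t (∑ s ∈ p.support, monomial s (coeff s p).re) = (coeff t p).re := by
      intro p t
      simp only [coeff_sum, coeff_monomial, Finset.sum_ite_eq']
      split_ifs with h
      · rfl
      · simp [notMem_support_iff.1 h]
    ext t
    rw [h, coeff_add, coeff_add, h, h, Complex.add_re]
  map_smul' c p := by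
    have h : ∀ (p : MvPolynomial (Fin n) ℂ) t,
        coeff t (∑ s ∈ p.support, monomial s (coeff s p).re) = (coeff t p).re := by
      intro p t
      simp only [coeff_sum, coeff_monomial, Finset.sum_ite_eq']
      split_ifs with h
      · rfl
      · simp [notMem_support_iff.1 h]
    ext t
    rw [h, coeff_smul, coeff_smul, h, Complex.smul_re, RingHom.id_apply]

lemma havRe_coeff (n : ℕ) (p : MvPolynomial (Fin n) ℂ) (t : Fin n →₀ ℕ) :
    coeff t (havRe n p) = (coeff t p).re := by
  change coeff t (∑ s ∈ p.support, monomial s (coeff s p).re) = (coeff t p).re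
  simp only [coeff_sum, coeff_monomial, Finset.sum_ite_eq']
  split_ifs with h
  · rfl
  · simp [notMem_support_iff.1 h]

lemma havRe_map_mul (n : ℕ) (p : MvPolynomial (Fin n) ℝ) (q : MvPolynomial (Fin n) ℂ) :
    havRe n (map Complex.ofRealHom p * q) = p * havRe n q := by
  ext t
  rw [havRe_coeff, coeff_mul, coeff_mul, Complex.re_sum]
  refine Finset.sum_congr rfl fun x _ => ?_
  rw [coeff_map, havRe_coeff, Complex.ofRealHom_eq_coe, Complex.re_ofReal_mul]

lemma havRe_map (n : ℕ) (p : MvPolynomial (Fin n) ℝ) :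
    havRe n (map Complex.ofRealHom p) = p := by
  ext t
  rw [havRe_coeff, coeff_map, Complex.ofRealHom_eq_coe, Complex.ofReal_re]

/-- bihomogenized form of `f` in the variables `p_i = inl i`, `q_i = inr i` -/
noncomputable def havP (n m : ℕ) (f : MvPolynomial (Fin n) ℝ) :
    MvPolynomial (Fin n ⊕ Fin n) ℂ :=
  ∑ α ∈ f.support, C ((coeff α f : ℝ) : ℂ) * ∏ i,
    ((C (1 / 2 : ℂ) * (X (Sum.inl i) + X (Sum.inr i))) ^ (2 * m - α i) *
     (C (1 / (2 * Complex.I)) * (X (Sum.inl i) - X (Sum.inr i))) ^ (α i))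

lemma havP_supp (n m : ℕ) (f : MvPolynomial (Fin n) ℝ)
    (hf : ∀ α ∈ f.support, ∀ i, α i ≤ 2 * m)
    (s : Fin n ⊕ Fin n →₀ ℕ) (hs : s ∈ (havP n m f).support) (i : Fin n) :
    s (Sum.inl i) + s (Sum.inr i) = 2 * m := by
  let w : Fin n ⊕ Fin n → ℕ := Sum.elim (Pi.single i 1) (Pi.single i 1)
  have hX1 : ∀ k, IsWeightedHomogeneous w (X (Sum.inl k) : MvPolynomial (Fin n ⊕ Fin n) ℂ)
      ((Pi.single i 1 : Fin n → ℕ) k) := fun k => isWeightedHomogeneous_X ℂ w (Sum.inl k)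
  have hX2 : ∀ k, IsWeightedHomogeneous w (X (Sum.inr k) : MvPolynomial (Fin n ⊕ Fin n) ℂ)
      ((Pi.single i 1 : Fin n → ℕ) k) := fun k => isWeightedHomogeneous_X ℂ w (Sum.inr k)
  have h : IsWeightedHomogeneous w (havP n m f) (2 * m) := by
    refine IsWeightedHomogeneous.sum _ _ _ fun α hα => ?_
    refine IsWeightedHomogeneous.C_mul ?_ _
    have := IsWeightedHomogeneous.prod Finset.univ _ _ (fun k (_ : k ∈ Finset.univ) =>
      (((((hX1 k).add (hX2 k)).C_mul (1 / 2)).pow (2 * m - α k)).mul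
      ((((hX1 k).sub (hX2 k)).C_mul (1 / (2 * Complex.I))).pow (α k))))
    convert this using 1
    rw [Finset.sum_eq_single i]
    · have := hf α hα i
      simp; omega
    · intro k _ hk
      simp [hk]
    · simp
  have h2 := h (mem_support_iff.1 hs)
  rw [Finsupp.weight_apply, Finsupp.sum_fintype _ _ (by simp), Fintype.sum_sum_type] at h2
  simpa [w, Pi.single_apply] using h2

lemma havP_aeval (n m : ℕ) (f : MvPolynomial (Fin n) ℝ) {R : Type*} [CommRing R] [Algebra ℂ R]
    (p q : Fin n → R) :
    ∑ s ∈ (havP n m f).support, coeff s (havP n m f) •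
      ∏ i, (p i ^ s (Sum.inl i) * q i ^ s (Sum.inr i)) =
    ∑ α ∈ f.support, ((coeff α f : ℝ) : ℂ) • ∏ i,
      (((1 / 2 : ℂ) • (p i + q i)) ^ (2 * m - α i) *
       ((1 / (2 * Complex.I)) • (p i - q i)) ^ (α i)) := by
  have h1 : aeval (Sum.elim p q) (havP n m f) = ∑ s ∈ (havP n m f).support,
      coeff s (havP n m f) • ∏ i, (p i ^ s (Sum.inl i) * q i ^ s (Sum.inr i)) := by
    rw [aeval_def, eval₂_eq']
    refine Finset.sum_congr rfl fun s _ => ?_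
    rw [Fintype.prod_sum_type, Algebra.smul_def, Finset.prod_mul_distrib]
    rfl
  rw [← h1, havP]
  simp only [map_sum, map_mul, map_prod, map_pow, map_add, map_sub, aeval_X, Sum.elim_inl,
    Sum.elim_inr, algHom_C, Algebra.smul_def]

lemma havP_uv (n m : ℕ) (f : MvPolynomial (Fin n) ℝ) :
    ∑ s ∈ (havP n m f).support, coeff s (havP n m f) •
      ∏ i : Fin n, ((1 + C Complex.I * X i) ^ s (Sum.inl i) *
        (1 - C Complex.I * X i : MvPolynomial (Fin n) ℂ) ^ s (Sum.inr i)) =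
    map Complex.ofRealHom f := by
  rw [havP_aeval n m f (fun i : Fin n => (1 + C Complex.I * X i : MvPolynomial (Fin n) ℂ))
    (fun i => 1 - C Complex.I * X i)]
  conv_rhs => rw [f.as_sum, map_sum]
  refine Finset.sum_congr rfl fun α _ => ?_
  rw [map_monomial, monomial_eq, smul_eq_C_mul, Finsupp.prod_fintype _ _ (by simp)]
  congr 1
  refine Finset.prod_congr rfl fun i _ => ?_
  have e1 : (1 / 2 : ℂ) • ((1 + C Complex.I * X i) + (1 - C Complex.I * X i) :
      MvPolynomial (Fin n) ℂ) = 1 := by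
    rw [show ((1 + C Complex.I * X i) + (1 - C Complex.I * X i) : MvPolynomial (Fin n) ℂ)
      = C 2 by rw [map_ofNat]; ring, smul_eq_C_mul, ← C_mul]
    norm_num
  have e2 : (1 / (2 * Complex.I)) • ((1 + C Complex.I * X i) - (1 - C Complex.I * X i) :
      MvPolynomial (Fin n) ℂ) = X i := by
    rw [show ((1 + C Complex.I * X i) - (1 - C Complex.I * X i) : MvPolynomial (Fin n) ℂ)
      = C (2 * Complex.I) * X i by rw [C_mul, map_ofNat]; ring, smul_eq_C_mul, ← mul_assoc, ← C_mul]
    rw [one_div, inv_mul_cancel₀ (by simp), C_1, one_mul]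
  rw [e1, e2, one_pow, one_mul]

noncomputable def havc (M j : ℕ) : ℝ := Real.cos (Real.pi * j / M)
noncomputable def havs (M j : ℕ) : ℝ := Real.sin (Real.pi * j / M)

lemma havOm_eq (M j : ℕ) : havOm M j = havc M j + havs M j * Complex.I := by
  rw [havOm, Complex.exp_mul_I, havc, havs, Complex.ofReal_cos, Complex.ofReal_sin]

lemma havOm_inv (M j : ℕ) : (havOm M j)⁻¹ = havc M j - havs M j * Complex.I := by
  rw [havOm, ← Complex.exp_neg, ← neg_mul, Complex.exp_mul_I, havc, havs, Complex.ofReal_cos,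
    Complex.ofReal_sin, Complex.cos_neg, Complex.sin_neg]
  ring

lemma havc_ne (N j : ℕ) : havc (2 * N + 1) j ≠ 0 := by
  rw [havc, Ne, Real.cos_eq_zero_iff]
  rintro ⟨k, hk⟩
  have hpi := Real.pi_ne_zero
  have h0 : ((2 * N + 1 : ℕ) : ℝ) ≠ 0 := by positivity
  field_simp at hk
  have h1 : (2 * j : ℤ) = (2 * N + 1) * (2 * k + 1) := by
    have : ((2 * j : ℤ) : ℝ) = (((2 * N + 1) * (2 * k + 1) : ℤ) : ℝ) := by
      push_cast at hk ⊢; linarith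
    exact_mod_cast this
  have h2 : (2 * j : ℤ) = 2 * (N * (2 * k + 1) + k) + 1 := by rw [h1]; ring
  omega

/-- the homogenized value -/
lemma havP_om (n m N : ℕ) (f : MvPolynomial (Fin n) ℝ)
    (hf : ∀ α ∈ f.support, ∀ i, α i ≤ 2 * m)
    (hpos : ∀ x, 0 ≤ eval x f) (J : Fin n → ℕ) :
    ∃ r : ℝ, 0 ≤ r ∧ ∑ s ∈ (havP n m f).support, coeff s (havP n m f) •
      ∏ i : Fin n, (havOm (2 * N + 1) (J i) ^ s (Sum.inl i) *
        (havOm (2 * N + 1) (J i))⁻¹ ^ s (Sum.inr i)) = (r : ℂ) := by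
  refine ⟨(∏ i, havc (2 * N + 1) (J i) ^ (2 * m)) *
    eval (fun i => havs (2 * N + 1) (J i) / havc (2 * N + 1) (J i)) f,
    mul_nonneg (Finset.prod_nonneg fun i _ => by rw [pow_mul]; positivity) (hpos _), ?_⟩
  rw [havP_aeval n m f (fun i : Fin n => havOm (2 * N + 1) (J i))
    (fun i => (havOm (2 * N + 1) (J i))⁻¹), eval_eq', Finset.mul_sum, Complex.ofReal_sum]
  refine Finset.sum_congr rfl fun α hα => ?_
  rw [mul_left_comm, ← Finset.prod_mul_distrib, smul_eq_mul, Complex.ofReal_mul, Complex.ofReal_prod]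
  congr 1
  refine Finset.prod_congr rfl fun i _ => ?_
  have e1 : (1 / 2 : ℂ) • (havOm (2 * N + 1) (J i) + (havOm (2 * N + 1) (J i))⁻¹)
      = havc (2 * N + 1) (J i) := by
    rw [havOm_eq, ← havOm_eq, havOm_inv, havOm_eq, smul_eq_mul]; ring
  have e2 : (1 / (2 * Complex.I)) • (havOm (2 * N + 1) (J i) - (havOm (2 * N + 1) (J i))⁻¹)
      = havs (2 * N + 1) (J i) := by
    rw [havOm_inv, havOm_eq, smul_eq_mul]
    have := Complex.I_ne_zero
    field_simp
    ring
  rw [e1, e2]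
  have hc := havc_ne N (J i)
  have e3 : havc (2 * N + 1) (J i) ^ (2 * m) * (havs (2 * N + 1) (J i) / havc (2 * N + 1) (J i)) ^ (α i)
      = havc (2 * N + 1) (J i) ^ (2 * m - α i) * havs (2 * N + 1) (J i) ^ (α i) := by
    rw [div_pow, ← Nat.sub_add_cancel (hf α hα i), pow_add, Nat.add_sub_cancel]
    field_simp
  rw [e3]
  push_cast
  rfl

lemma hav_pos (n : ℕ) (φ : MvPolynomial (Fin n) ℝ →ₗ[ℝ] ℝ)
    (h : ∀ f : MvPolynomial (Fin n) ℝ,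
      (∃ k : ℕ, IsSumSq ((∏ i : Fin n, (1 + X i ^ 2)) ^ (2 * k) * f)) → 0 ≤ φ f)
    (f : MvPolynomial (Fin n) ℝ) (hpos : ∀ x, 0 ≤ eval x f) : 0 ≤ φ f := by
  obtain ⟨m, hf⟩ : ∃ m, ∀ α ∈ f.support, ∀ i, α i ≤ 2 * m := by
    refine ⟨f.totalDegree, fun α hα i => ?_⟩
    have h1 := le_totalDegree hα
    have h2 : α i ≤ α.sum fun _ e => e := by
      by_cases hi : i ∈ α.support
      · exact Finset.single_le_sum (f := fun i => α i) (fun _ _ => Nat.zero_le _) hi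
      · simp [Finsupp.notMem_support_iff.1 hi]
    omega
  set P := havP n m f with hP
  have hsupp := havP_supp n m f hf
  let E : (Fin n ⊕ Fin n →₀ ℕ) → MvPolynomial (Fin n) ℂ := fun s =>
    ∏ i : Fin n, ((1 + C Complex.I * X i) ^ s (Sum.inl i) *
        (1 - C Complex.I * X i : MvPolynomial (Fin n) ℂ) ^ s (Sum.inr i))
  let b : ℕ → (Fin n ⊕ Fin n →₀ ℕ) → ℝ := fun k s =>
    ∏ i : Fin n, (((2 * m + 4 * k + 1 : ℕ) : ℝ) * ((2 * m + 4 * k).choose (s (Sum.inl i) + 2 * k) : ℝ))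
  let G : ℕ → MvPolynomial (Fin n) ℂ := fun k => ∑ s ∈ P.support, b k s • (coeff s P • E s)
  have step : ∀ k, 0 ≤ φ (havRe n (G k)) := by
    intro k
    apply h
    refine ⟨k, ?_⟩
    choose F hF0 hF using havP_om n m (m + 2 * k) f hf hpos
    rw [show 2 * (m + 2 * k) + 1 = 2 * m + 4 * k + 1 by ring] at hF
    set M := 2 * m + 4 * k + 1 with hM
    let S : MvPolynomial (Fin n) ℝ := ∑ J ∈ Fintype.piFinset (fun _ : Fin n => Finset.range M),
      C (F J) * ∏ i, (C (2 * havc M (J i)) + C (2 * havs M (J i)) * X i) ^ (2 * m + 4 * k)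
    have hS : IsSumSq S := by
      refine IsSumSq.sum fun J _ => IsSquare.isSumSq ?_
      refine ⟨C (Real.sqrt (F J)) *
        ∏ i, (C (2 * havc M (J i)) + C (2 * havs M (J i)) * X i) ^ (m + 2 * k), ?_⟩
      rw [mul_mul_mul_comm, ← C_mul, Real.mul_self_sqrt (hF0 J), ← Finset.prod_mul_distrib]
      congr 1
      refine Finset.prod_congr rfl fun i _ => ?_
      rw [← pow_add]
      congr 1
      ring
    have hlin : ∀ j i, map Complex.ofRealHom (C (2 * havc M j) + C (2 * havs M j) * X i)
        = (havOm M j)⁻¹ • (1 + C Complex.I * X i : MvPolynomial (Fin n) ℂ) +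
          havOm M j • (1 - C Complex.I * X i : MvPolynomial (Fin n) ℂ) := by
      intro j i
      have hI : (C Complex.I * C Complex.I : MvPolynomial (Fin n) ℂ) = -1 := by
        rw [← C_mul, Complex.I_mul_I, C_neg, C_1]
      rw [havOm_inv, havOm_eq]
      simp only [map_add, map_mul, map_C, map_X, smul_eq_C_mul, Complex.ofRealHom_eq_coe,
        map_sub, Complex.ofReal_ofNat, map_ofNat]
      linear_combination (2 * C (havs M j : ℂ) * X i) * hI
    have hmapS : map Complex.ofRealHom S
        = map Complex.ofRealHom ((∏ i : Fin n, (1 + X i ^ 2)) ^ (2 * k)) * G k := by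
      have e0 : ∀ s ∈ P.support, ∑ J ∈ Fintype.piFinset (fun _ : Fin n => Finset.range M),
          (∏ i : Fin n, (havOm M (J i) ^ s (Sum.inl i) * (havOm M (J i))⁻¹ ^ s (Sum.inr i))) •
          ∏ i : Fin n, ((havOm M (J i))⁻¹ • (1 + C Complex.I * X i : MvPolynomial (Fin n) ℂ) +
          havOm M (J i) • (1 - C Complex.I * X i : MvPolynomial (Fin n) ℂ)) ^ (2 * m + 4 * k)
          = map Complex.ofRealHom ((∏ i : Fin n, (1 + X i ^ 2)) ^ (2 * k)) * (b k s • E s) := by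
        intro s hs
        have e1 : ∀ J : Fin n → ℕ, 
          (∏ i : Fin n, (havOm M (J i) ^ s (Sum.inl i) * (havOm M (J i))⁻¹ ^ s (Sum.inr i))) •
          ∏ i : Fin n, ((havOm M (J i))⁻¹ • (1 + C Complex.I * X i : MvPolynomial (Fin n) ℂ) +
          havOm M (J i) • (1 - C Complex.I * X i : MvPolynomial (Fin n) ℂ)) ^ (2 * m + 4 * k)
          = ∏ i : Fin n, ((havOm M (J i) ^ s (Sum.inl i) * (havOm M (J i))⁻¹ ^ s (Sum.inr i)) •
            ((havOm M (J i))⁻¹ • (1 + C Complex.I * X i : MvPolynomial (Fin n) ℂ) +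
          havOm M (J i) • (1 - C Complex.I * X i : MvPolynomial (Fin n) ℂ)) ^ (2 * m + 4 * k)) := by
          intro J
          simp only [smul_eq_C_mul]
          rw [map_prod, ← Finset.prod_mul_distrib]
        simp only [e1]
        rw [← Finset.prod_univ_sum (fun _ : Fin n => Finset.range M) (fun i j =>
          (havOm M j ^ s (Sum.inl i) * (havOm M j)⁻¹ ^ s (Sum.inr i)) •
            ((havOm M j)⁻¹ • (1 + C Complex.I * X i : MvPolynomial (Fin n) ℂ) +
          havOm M j • (1 - C Complex.I * X i : MvPolynomial (Fin n) ℂ)) ^ (2 * m + 4 * k))]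
        simp only [hM]
        rw [Finset.prod_congr rfl fun i _ => hav_orth m k _ _ (hsupp s hs i)
          (1 + C Complex.I * X i : MvPolynomial (Fin n) ℂ) (1 - C Complex.I * X i)]
        have e2 : b k s • E s = C ((b k s : ℝ) : ℂ) * E s := by
          rw [← smul_eq_C_mul, Complex.coe_smul]
        rw [e2]
        simp only [b, E, smul_eq_C_mul, map_pow, map_prod, Complex.ofReal_prod,
          ← Finset.prod_pow, ← Finset.prod_mul_distrib]
        refine Finset.prod_congr rfl fun i _ => ?_
        have hI : (C Complex.I * C Complex.I : MvPolynomial (Fin n) ℂ) = -1 := by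
          rw [← C_mul, Complex.I_mul_I, C_neg, C_1]
        have e3 : map Complex.ofRealHom (1 + X i ^ 2 : MvPolynomial (Fin n) ℝ)
            = (1 + C Complex.I * X i) * (1 - C Complex.I * X i) := by
          simp only [map_add, map_one, map_pow, map_X]
          linear_combination (X i ^ 2) * hI
        rw [e3, mul_pow, pow_add, pow_add]
        push_cast
        ring
      simp only [G, Finset.mul_sum]
      have e4 : ∀ s ∈ P.support, map Complex.ofRealHom ((∏ i : Fin n, (1 + X i ^ 2)) ^ (2 * k)) *
          b k s • coeff s P • E s = coeff s P •
          (map Complex.ofRealHom ((∏ i : Fin n, (1 + X i ^ 2)) ^ (2 * k)) * (b k s • E s)) := by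
        intro s _
        rw [smul_comm, mul_smul_comm]
      rw [Finset.sum_congr rfl e4]
      rw [Finset.sum_congr rfl fun s hs => by rw [← e0 s hs]]
      simp only [Finset.smul_sum]
      rw [Finset.sum_comm]
      simp only [S, map_sum]
      refine Finset.sum_congr rfl fun J _ => ?_
      rw [map_mul, map_C, map_prod]
      simp only [smul_smul]
      rw [← Finset.sum_smul]
      simp only [smul_eq_mul] at hF
      rw [hF J, smul_eq_C_mul]
      simp only [map_pow, hlin, Complex.ofRealHom_eq_coe]
    rw [← havRe_map_mul, ← hmapS, havRe_map]
    exact hS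
  let W : ℕ → ℝ := fun k => ∏ _i : Fin n,
    (((2 * m + 4 * k + 1 : ℕ) : ℝ) * ((2 * m + 4 * k).choose (m + 2 * k) : ℝ))
  have hW : ∀ k, 0 < W k := fun k => Finset.prod_pos fun i _ => by
    have : 0 < (2 * m + 4 * k).choose (m + 2 * k) := Nat.choose_pos (by omega)
    positivity
  have hlim : Filter.Tendsto (fun k => φ (havRe n (G k)) / W k) Filter.atTop (nhds (φ f)) := by
    have e5 : φ f = ∑ s ∈ P.support, 1 * φ (havRe n (coeff s P • E s)) := by
      conv_lhs => rw [← havRe_map n f, ← havP_uv n m f]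
      rw [map_sum, map_sum]
      simp only [one_mul]
      rfl
    rw [e5]
    have e6 : ∀ k, φ (havRe n (G k)) / W k
        = ∑ s ∈ P.support, (b k s / W k) * φ (havRe n (coeff s P • E s)) := by
      intro k
      simp only [G, map_sum, map_smul, smul_eq_mul, Finset.sum_div]
      refine Finset.sum_congr rfl fun s _ => ?_
      ring
    simp only [e6]
    refine tendsto_finsetSum _ fun s hs => Filter.Tendsto.mul_const _ ?_
    have e7 : ∀ k, b k s / W k = ∏ i : Fin n, (((2 * m + 4 * k).choose (s (Sum.inl i) + 2 * k) : ℝ) /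
      ((2 * m + 4 * k).choose (m + 2 * k) : ℝ)) := by
      intro k
      simp only [b, W]
      rw [← Finset.prod_div_distrib]
      refine Finset.prod_congr rfl fun i _ => ?_
      rw [mul_div_mul_left]
      positivity
    simp only [e7]
    have := tendsto_finsetProd (Finset.univ : Finset (Fin n)) fun i _ =>
      hav_ratio m (s (Sum.inl i)) (by have := hsupp s hs i; omega)
    simpa using this
  exact ge_of_tendsto' hlim fun k => div_nonneg (step k) (hW k).le

open MvPolynomial MeasureTheory

/-- **Proposition `p:comm` (commutative Haviland-type theorem).** A linear functional
`φ : ℝ[t₁,…,tₙ] → ℝ` with `φ(1) = 1` comes from a Borel probability measure on `ℝⁿ`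
(with all polynomials integrable) if and only if `φ` is nonnegative on the cone `C` of
polynomials `f` such that `((1+t₁²)⋯(1+tₙ²))^(2k) * f` is a sum of squares for some `k`. -/
theorem commutative_haviland_with_denominators (n : ℕ) (hn : 1 ≤ n)
    (φ : MvPolynomial (Fin n) ℝ →ₗ[ℝ] ℝ) (hφ1 : φ 1 = 1) :
    (∃ μ : Measure (Fin n → ℝ), IsProbabilityMeasure μ ∧
      ∀ p : MvPolynomial (Fin n) ℝ,
        Integrable (fun x => eval x p) μ ∧ φ p = ∫ x, eval x p ∂μ) ↔
    (∀ f : MvPolynomial (Fin n) ℝ,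
      (∃ k : ℕ, IsSumSq ((∏ i : Fin n, (1 + X i ^ 2)) ^ (2 * k) * f)) → 0 ≤ φ f) := by
  constructor
  · rintro ⟨μ, -, hμ⟩ f ⟨k, hk⟩
    rw [(hμ f).2]
    refine integral_nonneg fun x => ?_
    have hs : ∀ p : MvPolynomial (Fin n) ℝ, IsSumSq p → 0 ≤ eval x p := by
      intro p hp
      induction hp with
      | zero => simp
      | sq_add a _ ih =>
        rw [map_add, map_mul]
        exact add_nonneg (mul_self_nonneg _) ih
    have h1 := hs _ hk
    rw [map_mul] at h1
    refine nonneg_of_mul_nonneg_right h1 ?_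
    simp only [map_pow, map_prod, map_add, map_one, eval_X]
    exact pow_pos (Finset.prod_pos fun i _ => by positivity) _
  · intro h
    exact haviland n φ hφ1 (hav_pos n φ h)
end

section
/- Let f be a symmetric, cyclically sorted element of ℝ⟨x₁,x₂⟩. Then the following are equivalent: (i) f(ξ₁,ξ₂) ≥ 0 for all (ξ₁,ξ₂) ∈ ℝ² (evaluation at pairs of real scalars); (ii) for every k ∈ ℕ and all Hermitian matrices X₁,X₂ ∈ M_k(ℂ), the trace tr(f(X₁,X₂)) is a nonnegative real number. -/
open scoped ComplexOrder

/-- The linear span of commutators `[p, q] = p*q - q*p` in the free real `*`-algebra. -/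
def thetaCommutators (n : ℕ) : Submodule ℝ (FreeAlgebra ℝ (Fin n)) :=
  Submodule.span ℝ
    {c : FreeAlgebra ℝ (Fin n) | ∃ p q : FreeAlgebra ℝ (Fin n), c = p * q - q * p}

/-- `f ∈ ℝ⟨x₁,x₂⟩` is cyclically sorted if it lies in `span{x₁^i x₂^j} + Θ`. -/
def CyclicallySorted (f : FreeAlgebra ℝ (Fin 2)) : Prop :=
  f ∈ Submodule.span ℝ
        {w : FreeAlgebra ℝ (Fin 2) |
          ∃ i j : ℕ, w = FreeAlgebra.ι ℝ (0 : Fin 2) ^ i * FreeAlgebra.ι ℝ (1 : Fin 2) ^ j} ⊔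
      thetaCommutators 2

lemma trace_spectral {k : ℕ} (X Y : Matrix (Fin k) (Fin k) ℂ) (hX : X.IsHermitian)
    (hY : Y.IsHermitian) : ∃ (l m : Fin k → ℝ) (c : Fin k → Fin k → ℝ),
      (∀ a b, 0 ≤ c a b) ∧ ∀ i j : ℕ, Matrix.trace (X ^ i * Y ^ j) =
        ((∑ a, ∑ b, c a b * (l a ^ i * m b ^ j) : ℝ) : ℂ) := by
  have key : ∀ (Z : Matrix (Fin k) (Fin k) ℂ) (hZ : Z.IsHermitian), ∀ i : ℕ,
      Z ^ i = (hZ.eigenvectorUnitary : Matrix (Fin k) (Fin k) ℂ) *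
        Matrix.diagonal (fun a => ((hZ.eigenvalues a : ℝ) : ℂ) ^ i) *
        star (hZ.eigenvectorUnitary : Matrix (Fin k) (Fin k) ℂ) := by
    intro Z hZ i
    conv_lhs => rw [hZ.spectral_theorem]
    rw [← map_pow, Matrix.diagonal_pow, Unitary.conjStarAlgAut_apply]
    rfl
  set U := (hX.eigenvectorUnitary : Matrix (Fin k) (Fin k) ℂ)
  set V := (hY.eigenvectorUnitary : Matrix (Fin k) (Fin k) ℂ)
  refine ⟨hX.eigenvalues, hY.eigenvalues, fun a b => Complex.normSq ((star U * V) a b),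
    fun a b => Complex.normSq_nonneg _, fun i j => ?_⟩
  rw [key X hX, key Y hY]
  have h1 : ∀ D E : Matrix (Fin k) (Fin k) ℂ, Matrix.trace (U * D * star U * (V * E * star V)) =
      Matrix.trace (D * (star U * V) * (E * star (star U * V))) := by
    intro D E
    rw [star_mul, star_star, mul_assoc, mul_assoc, Matrix.trace_mul_comm]
    simp only [mul_assoc]
  rw [h1]
  generalize star U * V = W
  simp only [Matrix.trace, Matrix.diag]
  push_cast
  refine Finset.sum_congr rfl fun a _ => ?_
  rw [Matrix.mul_apply]
  refine Finset.sum_congr rfl fun b _ => ?_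
  rw [Matrix.diagonal_mul, Matrix.diagonal_mul, Matrix.star_apply, Complex.normSq_eq_conj_mul_self]
  simp only [starRingEnd_apply]
  ring

lemma trace_formula {k : ℕ} (X : Fin 2 → Matrix (Fin k) (Fin k) ℂ) (l m : Fin k → ℝ)
    (c : Fin k → Fin k → ℝ)
    (h : ∀ i j : ℕ, Matrix.trace (X 0 ^ i * X 1 ^ j) =
        ((∑ a, ∑ b, c a b * (l a ^ i * m b ^ j) : ℝ) : ℂ))
    (f : FreeAlgebra ℝ (Fin 2)) (hf : CyclicallySorted f) :
    Matrix.trace (FreeAlgebra.lift ℝ X f) =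
      ((∑ a, ∑ b, c a b * FreeAlgebra.lift ℝ ![l a, m b] f : ℝ) : ℂ) := by
  let L : FreeAlgebra ℝ (Fin 2) →ₗ[ℝ] ℂ :=
    (Matrix.traceLinearMap (Fin k) ℝ ℂ).comp (FreeAlgebra.lift ℝ X).toLinearMap
  let R : FreeAlgebra ℝ (Fin 2) →ₗ[ℝ] ℂ := Complex.ofRealAm.toLinearMap.comp
    (∑ a, ∑ b, c a b • (FreeAlgebra.lift ℝ ![l a, m b]).toLinearMap)
  have hL : ∀ g, L g = Matrix.trace (FreeAlgebra.lift ℝ X g) := fun g => rfl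
  have hR : ∀ g, R g = ((∑ a, ∑ b, c a b * FreeAlgebra.lift ℝ ![l a, m b] g : ℝ) : ℂ) := by
    intro g
    simp [R, LinearMap.sum_apply]
  have hle : (Submodule.span ℝ
        {w : FreeAlgebra ℝ (Fin 2) |
          ∃ i j : ℕ, w = FreeAlgebra.ι ℝ (0 : Fin 2) ^ i * FreeAlgebra.ι ℝ (1 : Fin 2) ^ j} ⊔
      thetaCommutators 2) ≤ LinearMap.eqLocus L R := by
    refine sup_le (Submodule.span_le.2 ?_) (Submodule.span_le.2 ?_)
    · rintro _ ⟨i, j, rfl⟩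
      change L _ = R _
      rw [hL, hR]
      simpa using h i j
    · rintro _ ⟨p, q, rfl⟩
      change L _ = R _
      rw [hL, hR]
      simp only [map_sub, map_mul, Matrix.trace_sub]
      rw [Matrix.trace_mul_comm, sub_self]
      simp [mul_comm]
  have := hle hf
  change L f = R f at this
  rwa [hL, hR] at this

/-- **Part of Corollary `c:cyc`.** For a symmetric cyclically sorted `f ∈ ℝ⟨x₁,x₂⟩`,
nonnegativity of the (commutative) evaluations on `ℝ²` is equivalent to trace
nonnegativity on all tuples of Hermitian complex matrices of all sizes. -/
theorem cyclicallySorted_scalar_nonneg_iff_trace_nonneg (f : FreeAlgebra ℝ (Fin 2))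
    (hsym : star f = f) (hcyc : CyclicallySorted f) :
    (∀ ξ₁ ξ₂ : ℝ, 0 ≤ FreeAlgebra.lift ℝ ![ξ₁, ξ₂] f) ↔
    (∀ (k : ℕ) (X : Fin 2 → Matrix (Fin k) (Fin k) ℂ), (∀ i, (X i).IsHermitian) →
      0 ≤ Matrix.trace (FreeAlgebra.lift ℝ X f)) := by
  constructor
  · intro h k X hX
    obtain ⟨l, m, c, hc, ht⟩ := trace_spectral (X 0) (X 1) (hX 0) (hX 1)
    rw [trace_formula X l m c ht f hcyc]
    exact Complex.zero_le_real.2 (Finset.sum_nonneg fun a _ => Finset.sum_nonneg fun b _ =>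
      mul_nonneg (hc a b) (h _ _))
  · intro h x y
    have h1 := h 1 (fun i => algebraMap ℝ _ (![x, y] i)) (fun i => by
      rw [Matrix.IsHermitian, Matrix.algebraMap_eq_diagonal, Matrix.diagonal_conjTranspose]
      congr 1
      ext a
      simp)
    have h2 : FreeAlgebra.lift ℝ
        (fun i => algebraMap ℝ (Matrix (Fin 1) (Fin 1) ℂ) (![x, y] i)) =
        (Algebra.ofId ℝ (Matrix (Fin 1) (Fin 1) ℂ)).comp (FreeAlgebra.lift ℝ ![x, y]) := by
      apply FreeAlgebra.hom_ext
      ext i : 1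
      simp [Algebra.ofId_apply]
    rw [h2] at h1
    simpa [Algebra.ofId_apply, Matrix.algebraMap_eq_diagonal] using h1
end

section
/- Let n ≥ 1 and let f be a symmetric element of ℝ⟨x₁,…,xₙ⟩. Suppose that for every ε > 0 there exists r ∈ ℕ such that f + ε·Σ_{j=1}^n Σ_{k=0}^r (1/k!)·x_j^{2k} can be written as a sum of hermitian squares plus an element of Θ. Then for every k ∈ ℕ and all Hermitian matrices X₁,…,Xₙ ∈ M_k(ℂ), the trace tr(f(X₁,…,Xₙ)) is a nonnegative real number. -/
open scoped ComplexOrder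

theorem lift_star_aux {n k : ℕ} (X : Fin n → Matrix (Fin k) (Fin k) ℂ)
    (hX : ∀ i, (X i).IsHermitian) (a : FreeAlgebra ℝ (Fin n)) :
    FreeAlgebra.lift ℝ X (star a) = (FreeAlgebra.lift ℝ X a).conjTranspose := by
  induction a using FreeAlgebra.induction with
  | grade0 r =>
    rw [FreeAlgebra.star_algebraMap, AlgHom.commutes, Algebra.algebraMap_eq_smul_one,
      Matrix.conjTranspose_smul]
    simp
  | grade1 x => rw [FreeAlgebra.star_ι, FreeAlgebra.lift_ι_apply, (hX x).eq]
  | mul a b ha hb => rw [star_mul, map_mul, map_mul, Matrix.conjTranspose_mul, ha, hb]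
  | add a b ha hb => rw [star_add, map_add, map_add, Matrix.conjTranspose_add, ha, hb]

theorem trace_theta_aux {n k : ℕ} (X : Fin n → Matrix (Fin k) (Fin k) ℂ)
    (c : FreeAlgebra ℝ (Fin n)) (hc : c ∈ thetaCommutators n) :
    Matrix.trace (FreeAlgebra.lift ℝ X c) = 0 := by
  unfold thetaCommutators at hc
  induction hc using Submodule.span_induction with
  | mem x hx =>
    obtain ⟨p, q, rfl⟩ := hx
    rw [map_sub, map_mul, map_mul, Matrix.trace_sub, Matrix.trace_mul_comm, sub_self]
  | zero => simp
  | add x y _ _ hx hy => rw [map_add, Matrix.trace_add, hx, hy, add_zero]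
  | smul a x _ hx => rw [map_smul, Matrix.trace_smul, hx, smul_zero]

theorem trace_sohs_aux {n k : ℕ} (X : Fin n → Matrix (Fin k) (Fin k) ℂ)
    (hX : ∀ i, (X i).IsHermitian) (l : List (FreeAlgebra ℝ (Fin n))) :
    0 ≤ Matrix.trace (FreeAlgebra.lift ℝ X (l.map fun s => s * star s).sum) := by
  induction l with
  | nil => simp
  | cons a l ih =>
    rw [List.map_cons, List.sum_cons, map_add, Matrix.trace_add, map_mul, lift_star_aux X hX]
    exact add_nonneg (Matrix.posSemidef_self_mul_conjTranspose _).trace_nonneg ih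

section
attribute [local instance] Matrix.linftyOpNormedRing Matrix.linftyOpNormedAlgebra

theorem bound_aux {k : ℕ} (A : Matrix (Fin k) (Fin k) ℂ) :
    ∃ B : ℝ, ∀ r : ℕ, (Matrix.trace (∑ m ∈ Finset.range (r + 1),
      ((1 : ℝ) / (Nat.factorial m : ℝ)) • A ^ (2 * m))).re ≤ B := by
  have hs := (NormedSpace.expSeries_summable' (𝕂 := ℝ) (A ^ 2)).hasSum.tendsto_sum_nat
  have hc : Continuous fun M : Matrix (Fin k) (Fin k) ℂ => (Matrix.trace M).re :=
    Complex.continuous_re.comp continuous_id.matrix_trace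
  obtain ⟨B, hB⟩ := ((hc.tendsto _).comp hs).bddAbove_range
  refine ⟨B, fun r => ?_⟩
  have := hB ⟨r + 1, rfl⟩
  simpa only [Function.comp, one_div, pow_mul] using this

end

/-- **(ii) ⇒ (i) of Theorem `t:lass`.** If a symmetric `f ∈ ℝ⟨x₁,…,xₙ⟩` is such that for
every `ε > 0` there is `r ∈ ℕ` with `f + ε·Σ_j Σ_{k≤r} (1/k!) x_j^{2k}` a sum of hermitian
squares plus a commutator term, then `f` has nonnegative trace on every tuple of Hermitian
complex matrices. -/
theorem perturbed_sohs_implies_trace_nonneg (n : ℕ) (hn : 1 ≤ n)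
    (f : FreeAlgebra ℝ (Fin n)) (hsym : star f = f)
    (h : ∀ ε : ℝ, 0 < ε → ∃ r : ℕ,
      ∃ (l : List (FreeAlgebra ℝ (Fin n))) (c : FreeAlgebra ℝ (Fin n)),
        c ∈ thetaCommutators n ∧
        f + ε • (∑ j : Fin n, ∑ k ∈ Finset.range (r + 1),
            ((1 : ℝ) / (Nat.factorial k : ℝ)) • FreeAlgebra.ι ℝ j ^ (2 * k)) =
          (l.map fun s => s * star s).sum + c) :
    ∀ (k : ℕ) (X : Fin n → Matrix (Fin k) (Fin k) ℂ), (∀ i, (X i).IsHermitian) →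
      0 ≤ Matrix.trace (FreeAlgebra.lift ℝ X f) := by
  intro k X hX
  choose B hB using fun j => bound_aux (X j)
  have him : (Matrix.trace (FreeAlgebra.lift ℝ X f)).im = 0 := by
    have h1 := lift_star_aux X hX f
    rw [hsym] at h1
    have h2 := congrArg Matrix.trace h1
    rw [Matrix.trace_conjTranspose] at h2
    exact Complex.conj_eq_iff_im.mp h2.symm
  have key : ∀ ε : ℝ, 0 < ε →
      0 ≤ (Matrix.trace (FreeAlgebra.lift ℝ X f)).re + ε * ∑ j, B j := by
    intro ε hε
    obtain ⟨r, l, c, hc, he⟩ := h ε hε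
    have h1 := congrArg (fun a => (Matrix.trace (FreeAlgebra.lift ℝ X a)).re) he
    have h2 := (Complex.le_def.mp (trace_sohs_aux X hX l)).1
    simp only [map_add, map_smul, map_sum, map_pow, FreeAlgebra.lift_ι_apply, Matrix.trace_add,
      trace_theta_aux X c hc, add_zero, Complex.add_re, Matrix.trace_smul] at h1
    rw [Matrix.trace_sum, Complex.smul_re, Complex.re_sum, smul_eq_mul] at h1
    have h3 := Finset.sum_le_sum fun j (_ : j ∈ Finset.univ) => hB j r
    have h4 := mul_le_mul_of_nonneg_left h3 hε.le
    simp only [Complex.zero_re, map_list_sum] at h2 h1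
    linarith
  refine Complex.le_def.mpr ⟨?_, by simp [him]⟩
  have ht : Filter.Tendsto (fun ε : ℝ =>
      (Matrix.trace (FreeAlgebra.lift ℝ X f)).re + ε * ∑ j, B j) (nhdsWithin 0 (Set.Ioi 0))
      (nhds (Matrix.trace (FreeAlgebra.lift ℝ X f)).re) := by
    have : Continuous (fun ε : ℝ =>
      (Matrix.trace (FreeAlgebra.lift ℝ X f)).re + ε * ∑ j, B j) := by fun_prop
    have h0 := (this.tendsto 0).mono_left (nhdsWithin_le_nhds (s := Set.Ioi 0))
    simpa using h0
  exact ge_of_tendsto ht (eventually_nhdsWithin_of_forall fun ε hε => key ε hε)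
end

section
/- Let a₀, a₁, a₂ ≥ 0 be real numbers and let n ≥ 1 be a natural number. If a₂·a₀ⁿ ≥ nⁿ·a₁^{n+1}, then a₂ − (n+1)·a₁ + a₀ ≥ 0. -/
theorem bern_aux (x b : ℝ) (hx : 0 ≤ x) (hb : 0 ≤ b) (n : ℕ) :
    ((n : ℝ) + 1) * x * b ^ n ≤ x ^ (n + 1) + n * b ^ (n + 1) := by
  induction n with
  | zero => simp
  | succ k ih =>
    have h1 := mul_le_mul_of_nonneg_left ih hx
    have h2 : 0 ≤ ((k : ℝ) + 1) * b ^ k * (x - b) ^ 2 := by positivity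
    push_cast
    ring_nf at h1 h2 ⊢
    linarith

/-- **Lemma `l:elem`.** If `a₀, a₁, a₂ ≥ 0` and `n ≥ 1` satisfy `a₂·a₀ⁿ ≥ nⁿ·a₁^{n+1}`,
then `a₂ − (n+1)·a₁ + a₀ ≥ 0`. -/
theorem elementary_trace_lemma (a₀ a₁ a₂ : ℝ) (h₀ : 0 ≤ a₀) (h₁ : 0 ≤ a₁) (h₂ : 0 ≤ a₂)
    (n : ℕ) (hn : 1 ≤ n) (h : a₂ * a₀ ^ n ≥ (n : ℝ) ^ n * a₁ ^ (n + 1)) :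
    a₂ - ((n : ℝ) + 1) * a₁ + a₀ ≥ 0 := by
  have hn0 : (0 : ℝ) < n := by exact_mod_cast hn
  obtain ⟨b, rfl⟩ : ∃ b, a₀ = n * b := ⟨a₀ / n, by field_simp⟩
  have hb : 0 ≤ b := nonneg_of_mul_nonneg_right h₀ hn0
  have h3 : a₁ ^ (n + 1) ≤ a₂ * b ^ n := by
    have hp : (0 : ℝ) < (n : ℝ) ^ n := by positivity
    refine le_of_mul_le_mul_left ?_ hp
    rw [mul_pow] at h
    linarith
  rcases hb.eq_or_lt with hb0 | hb0
  · subst hb0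
    have : a₁ ^ (n + 1) ≤ 0 := by simpa [show n ≠ 0 by omega] using h3
    have h4 : a₁ = 0 := eq_zero_of_pow_eq_zero (le_antisymm this (by positivity))
    subst h4
    simpa using h₂
  · have h5 := bern_aux a₁ b h₁ hb n
    have hp : 0 < b ^ n := by positivity
    refine nonneg_of_mul_nonneg_left (b := b ^ n) ?_ hp
    rw [pow_succ b] at h5
    nlinarith
end

section
/- Let n ≥ 1 and let f₁,…,fₙ ∈ M_k(ℂ) be positive semidefinite matrices. Then (1/n)·tr(f₁ + ⋯ + fₙ) ≥ tr( ( (f₁^{1/2}·f₂^{1/2}·⋯·fₙ^{1/2})^* · (f₁^{1/2}·f₂^{1/2}·⋯·fₙ^{1/2}) )^{1/n} ), where both traces are real numbers. -/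
open scoped ComplexOrder

/-- For a complex matrix `M` (intended positive semidefinite) and a real exponent `α`,
`psdPow M α` is the matrix obtained by applying `t ↦ t^α` via the continuous functional
calculus (spectral calculus) for Hermitian matrices. -/
noncomputable def psdPow {k : ℕ} (M : Matrix (Fin k) (Fin k) ℂ) (α : ℝ) :
    Matrix (Fin k) (Fin k) ℂ :=
  cfc (fun t : ℝ => t ^ α) M

open Matrix in
lemma trace_psdPow {k : ℕ} {M : Matrix (Fin k) (Fin k) ℂ} (hM : M.IsHermitian) (s : ℝ) :
    Matrix.trace (psdPow M s) = ((∑ i, hM.eigenvalues i ^ s : ℝ) : ℂ) := by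
  rw [psdPow, hM.cfc_eq, Matrix.IsHermitian.cfc, Unitary.conjStarAlgAut_apply,
    Matrix.trace_mul_comm, ← mul_assoc]
  simp [Matrix.trace_diagonal]

lemma trace_psdPow_congr {k : ℕ} {M N : Matrix (Fin k) (Fin k) ℂ} (hM : M.IsHermitian)
    (hN : N.IsHermitian) (h : M.charpoly = N.charpoly) (s : ℝ) :
    Matrix.trace (psdPow M s) = Matrix.trace (psdPow N s) := by
  rw [trace_psdPow hM, trace_psdPow hN, (hM.eigenvalues_eq_eigenvalues_iff hN).2 h]

open Matrix in
lemma trace_psdPow_mul_comm {k : ℕ} (A : Matrix (Fin k) (Fin k) ℂ) (s : ℝ) :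
    Matrix.trace (psdPow (A * Aᴴ) s) = Matrix.trace (psdPow (Aᴴ * A) s) :=
  trace_psdPow_congr (isHermitian_mul_conjTranspose_self A) (isHermitian_conjTranspose_mul_self A)
    (charpoly_mul_comm _ _) s

open Matrix in
/-- Peierls-type inequality for the diagonal of a positive semidefinite matrix. -/
lemma trace_psdPow_le_diag {k : ℕ} {M : Matrix (Fin k) (Fin k) ℂ} (hM : M.PosSemidef) {s : ℝ}
    (hs0 : 0 ≤ s) (hs1 : s ≤ 1) :
    (Matrix.trace (psdPow M s)).re ≤ ∑ j, (M j j).re ^ s := by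
  have hH := hM.isHermitian
  set V : Matrix (Fin k) (Fin k) ℂ := (hH.eigenvectorUnitary : Matrix (Fin k) (Fin k) ℂ) with hV
  have hV1 : star V * V = 1 := Unitary.coe_star_mul_self hH.eigenvectorUnitary
  have hV2 : V * star V = 1 := Unitary.coe_mul_star_self hH.eigenvectorUnitary
  have row : ∀ j, ∑ i, Complex.normSq (V j i) = 1 := by
    intro j
    have := congrArg Complex.re (congrFun (congrFun hV2 j) j)
    simpa [Matrix.mul_apply, Complex.mul_conj, star_apply, -Complex.mul_re] using this
  have col : ∀ i, ∑ j, Complex.normSq (V j i) = 1 := by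
    intro i
    have := congrArg Complex.re (congrFun (congrFun hV1 i) i)
    simpa [Matrix.mul_apply, ← Complex.normSq_eq_conj_mul_self, star_apply, -Complex.mul_re]
      using this
  have hdiag : ∀ j, (M j j).re = ∑ i, Complex.normSq (V j i) * hH.eigenvalues i := by
    intro j
    have h1 : M = V * diagonal (RCLike.ofReal ∘ hH.eigenvalues) * star V := by
      conv_lhs => rw [hH.spectral_theorem, Unitary.conjStarAlgAut_apply]
    have h2 := congrFun (congrFun h1 j) j
    rw [Matrix.mul_apply] at h2
    rw [h2, Complex.re_sum]
    refine Finset.sum_congr rfl fun i _ => ?_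
    rw [mul_diagonal, star_apply, mul_right_comm, Complex.star_def, Complex.mul_conj]
    simp
  rw [trace_psdPow hH, Complex.ofReal_re]
  calc ∑ i, hH.eigenvalues i ^ s
      = ∑ i, (∑ j, Complex.normSq (V j i)) * hH.eigenvalues i ^ s := by simp [col]
    _ = ∑ j, ∑ i, Complex.normSq (V j i) * hH.eigenvalues i ^ s := by
        simp_rw [Finset.sum_mul]; exact Finset.sum_comm
    _ ≤ _ := by
        refine Finset.sum_le_sum fun j _ => ?_
        rw [hdiag]
        have := (Real.concaveOn_rpow hs0 hs1).le_map_sum (t := Finset.univ)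
          (w := fun i => Complex.normSq (V j i)) (p := hH.eigenvalues)
          (fun i _ => Complex.normSq_nonneg _) (row j) (fun i _ => hM.eigenvalues_nonneg i)
        simpa using this

lemma young_aux {m : ℕ} (hm : 1 ≤ m) {h c : ℝ} (hh : 0 ≤ h) (hc : 0 ≤ c) :
    ((m + 1 : ℕ) : ℝ) * (h * c) ^ (1 / ((m + 1 : ℕ) : ℝ)) ≤ m * h ^ (1 / (m : ℝ)) + c := by
  have hm0 : (0 : ℝ) < m := by exact_mod_cast hm
  have hm1 : (0 : ℝ) < m + 1 := by positivity
  have := Real.geom_mean_le_arith_mean2_weighted (w₁ := m / (m + 1)) (w₂ := 1 / (m + 1))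
    (p₁ := h ^ (1 / (m : ℝ))) (p₂ := c) (by positivity) (by positivity) (by positivity) hc
    (by field_simp)
  rw [← Real.rpow_mul hh, show 1 / (m : ℝ) * (m / (m + 1)) = 1 / (m + 1) by field_simp,
    ← Real.mul_rpow hh hc] at this
  push_cast
  calc _ ≤ ((m : ℝ) + 1) * (m / (m + 1) * h ^ (1 / (m : ℝ)) + 1 / (m + 1) * c) := by gcongr
    _ = _ := by field_simp

open Matrix in
lemma step_aux {k m : ℕ} (hm : 1 ≤ m) (A B : Matrix (Fin k) (Fin k) ℂ) :
    ((m + 1 : ℕ) : ℝ) *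
        (Matrix.trace (psdPow ((B * A) * (B * A)ᴴ) (1 / ((m + 1 : ℕ) : ℝ)))).re ≤
      m * (Matrix.trace (psdPow (A * Aᴴ) (1 / (m : ℝ)))).re + (Matrix.trace (Bᴴ * B)).re := by
  have hP : (A * Aᴴ).PosSemidef := posSemidef_self_mul_conjTranspose A
  have hH := hP.isHermitian
  set h := hH.eigenvalues with hh
  have h0 : ∀ i, 0 ≤ h i := hP.eigenvalues_nonneg
  set U : Matrix (Fin k) (Fin k) ℂ := (hH.eigenvectorUnitary : Matrix (Fin k) (Fin k) ℂ) with hU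
  have hU2 : U * Uᴴ = 1 := Unitary.coe_mul_star_self hH.eigenvectorUnitary
  set D : Matrix (Fin k) (Fin k) ℂ := diagonal (fun i => ((Real.sqrt (h i) : ℝ) : ℂ)) with hD
  have hDs : Dᴴ = D := by
    rw [hD, diagonal_conjTranspose]; congr 1; ext i; simp
  have hDD : D * D = diagonal (RCLike.ofReal ∘ h) := by
    rw [hD, diagonal_mul_diagonal]; congr 1; ext i
    rw [← Complex.ofReal_mul, Real.mul_self_sqrt (h0 i)]; rfl
  have hA : A * Aᴴ = (U * D) * (U * D)ᴴ := by
    rw [conjTranspose_mul, hDs]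
    conv_lhs => rw [hH.spectral_theorem, Unitary.conjStarAlgAut_apply]
    rw [← hh, ← hDD, ← hU, star_eq_conjTranspose]
    simp only [mul_assoc]
  set R := U * D with hR
  have h1 : (B * A) * (B * A)ᴴ = (B * R) * (B * R)ᴴ := by
    rw [conjTranspose_mul, conjTranspose_mul, mul_assoc, ← mul_assoc A, hA]
    simp only [mul_assoc]
  rw [h1, trace_psdPow_mul_comm]
  have h2 := trace_psdPow_le_diag (posSemidef_conjTranspose_mul_self (B * R))
    (s := 1 / ((m + 1 : ℕ) : ℝ)) (by positivity)
    (by rw [div_le_one (by positivity)]; push_cast; linarith [m.cast_nonneg (α := ℝ)])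
  set C := (B * U)ᴴ * (B * U) with hC
  have hCp : C.PosSemidef := posSemidef_conjTranspose_mul_self _
  have hCd : ∀ j, 0 ≤ (C j j).re := fun j => (Complex.le_def.1 (hCp.diag_nonneg (i := j))).1
  have hCt : (Matrix.trace (Bᴴ * B)).re = ∑ j, (C j j).re := by
    have : Matrix.trace (Bᴴ * B) = Matrix.trace C := by
      rw [hC, trace_mul_comm (B * U)ᴴ, conjTranspose_mul, mul_assoc B, ← mul_assoc U, hU2, one_mul,
        trace_mul_comm]
    rw [this, Matrix.trace, Complex.re_sum]; rfl
  have hdiag : ∀ j, (((B * R)ᴴ * (B * R)) j j).re = h j * (C j j).re := by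
    intro j
    have : (B * R)ᴴ * (B * R) = D * C * D := by
      rw [hR, hC, ← mul_assoc B, conjTranspose_mul _ D, hDs]; simp only [mul_assoc]
    rw [this, hD, mul_diagonal, diagonal_mul, mul_right_comm, ← Complex.ofReal_mul,
      Real.mul_self_sqrt (h0 j), Complex.re_ofReal_mul]
  rw [trace_psdPow hH, Complex.ofReal_re, hCt, Finset.mul_sum, ← Finset.sum_add_distrib]
  calc _ ≤ _ := mul_le_mul_of_nonneg_left h2 (by positivity)
    _ = _ := Finset.mul_sum _ _ _
    _ ≤ _ := by
      refine Finset.sum_le_sum fun j _ => ?_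
      rw [hdiag]
      exact young_aux hm (h0 j) (hCd j)

open Matrix in
lemma list_aux {k : ℕ} (L : List (Matrix (Fin k) (Fin k) ℂ)) (hL : L ≠ []) :
    (L.length : ℝ) * (Matrix.trace (psdPow (L.prod * L.prodᴴ) (1 / (L.length : ℝ)))).re ≤
      (L.map fun B => (Matrix.trace (Bᴴ * B)).re).sum := by
  induction L with
  | nil => exact absurd rfl hL
  | cons B L ih =>
    by_cases h : L = []
    · subst h
      have hH := isHermitian_mul_conjTranspose_self B
      have : Matrix.trace (Bᴴ * B) = ((∑ i, hH.eigenvalues i : ℝ) : ℂ) := by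
        rw [trace_mul_comm, hH.trace_eq_sum_eigenvalues]; simp
      simp only [List.length_singleton, List.prod_singleton, List.map_singleton,
        List.sum_singleton]
      rw [trace_psdPow hH, this]
      simp
    · have h1 := step_aux (m := L.length) (List.length_pos_iff.2 h) L.prod B
      rw [List.length_cons, List.prod_cons, List.map_cons, List.sum_cons]
      linarith [ih h]

open Matrix in
lemma psdPow_half {k : ℕ} {M : Matrix (Fin k) (Fin k) ℂ} (hM : M.PosSemidef) :
    (psdPow M (1 / 2))ᴴ * psdPow M (1 / 2) = M := by
  have hs : IsSelfAdjoint (psdPow M (1 / 2)) := cfc_predicate _ _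
  have hs' : (psdPow M (1 / 2))ᴴ = psdPow M (1 / 2) := hs
  have hH := hM.isHermitian
  rw [hs', psdPow, hH.cfc_eq, Matrix.IsHermitian.cfc, ← map_mul, diagonal_mul_diagonal]
  conv_rhs => rw [hH.spectral_theorem]
  congr 2
  ext i
  have := hM.eigenvalues_nonneg i
  simp only [Function.comp_apply]
  rw [← RCLike.ofReal_mul, ← Real.sqrt_eq_rpow, Real.mul_self_sqrt this]


/-- **Proposition `t:ag` (matrix case, tracial AM-GM inequality).** For positive
semidefinite `f₁,…,fₙ ∈ M_k(ℂ)`, both traces below are real and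
`(1/n)·tr(f₁+⋯+fₙ) ≥ tr(((f₁^{1/2}⋯fₙ^{1/2})* (f₁^{1/2}⋯fₙ^{1/2}))^{1/n})`. -/
theorem tracial_am_gm (k n : ℕ) (hn : 1 ≤ n) (f : Fin n → Matrix (Fin k) (Fin k) ℂ)
    (hf : ∀ i, (f i).PosSemidef) :
    (Matrix.trace (∑ i, f i)).im = 0 ∧
    (Matrix.trace (psdPow
        (star ((List.ofFn fun i => psdPow (f i) (1 / 2)).prod) *
          (List.ofFn fun i => psdPow (f i) (1 / 2)).prod) (1 / (n : ℝ)))).im = 0 ∧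
    (1 / (n : ℝ)) * (Matrix.trace (∑ i, f i)).re ≥
      (Matrix.trace (psdPow
        (star ((List.ofFn fun i => psdPow (f i) (1 / 2)).prod) *
          (List.ofFn fun i => psdPow (f i) (1 / 2)).prod) (1 / (n : ℝ)))).re := by
  have hn' : (0 : ℝ) < n := by exact_mod_cast hn
  set L := List.ofFn fun i => psdPow (f i) (1 / 2) with hL
  have hlen : L.length = n := by simp [hL]
  have hHs : (L.prod.conjTranspose * L.prod).IsHermitian :=
    Matrix.isHermitian_conjTranspose_mul_self _
  rw [Matrix.star_eq_conjTranspose]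
  refine ⟨?_, ?_, ?_⟩
  · have hS : (∑ i, f i).IsHermitian :=
      (Matrix.posSemidef_sum Finset.univ fun i _ => hf i).isHermitian
    rw [hS.trace_eq_sum_eigenvalues]
    simp
  · rw [trace_psdPow hHs, Complex.ofReal_im]
  · have h := list_aux L (by rintro h0; rw [h0] at hlen; simp at hlen; omega)
    rw [trace_psdPow_mul_comm, hlen] at h
    have h2 : (L.map fun B => (Matrix.trace (B.conjTranspose * B)).re).sum =
        (Matrix.trace (∑ i, f i)).re := by
      rw [hL, List.map_ofFn, List.sum_ofFn, Matrix.trace_sum, Complex.re_sum]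
      refine Finset.sum_congr rfl fun i _ => ?_
      simp only [Function.comp_apply]
      rw [psdPow_half (hf i)]
    rw [h2] at h
    rw [ge_iff_le, one_div_mul_eq_div, le_div_iff₀ hn']
    linarith
end

section
/- Let X₁, X₂, X₃ ∈ M_k(ℂ) be Hermitian matrices. Then the trace tr(X₂²X₁²X₂² + X₁²X₂²X₁² + X₃⁶ − 3·X₁X₂X₃²X₂X₁) is a nonnegative real number. -/
open scoped ComplexOrder

/-- A positive semidefinite matrix has a positive semidefinite square root `B` and a Hermitian
pseudo-inverse `G` of that root. -/
lemma exists_sqrt_pinv {k : ℕ} (A : Matrix (Fin k) (Fin k) ℂ) (hA : A.PosSemidef) :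
    ∃ B G : Matrix (Fin k) (Fin k) ℂ, B.PosSemidef ∧ G.IsHermitian ∧ B * B = A ∧
      G * A = B ∧ A * G = B := by
  have hs := hA.isHermitian.spectral_theorem
  rw [Unitary.conjStarAlgAut_apply] at hs
  have hev := hA.eigenvalues_nonneg
  generalize hA.isHermitian.eigenvalues = d at hs hev
  have hV := Unitary.coe_star_mul_self hA.isHermitian.eigenvectorUnitary
  generalize (hA.isHermitian.eigenvectorUnitary : Matrix (Fin k) (Fin k) ℂ) = V at hs hV
  have key : ∀ f g : Fin k → ℝ,
      (V * Matrix.diagonal (fun i => (f i : ℂ)) * star V) *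
        (V * Matrix.diagonal (fun i => (g i : ℂ)) * star V) =
      V * Matrix.diagonal (fun i => ((f i * g i : ℝ) : ℂ)) * star V := by
    intro f g
    calc _ = V * Matrix.diagonal (fun i => (f i : ℂ)) * (star V * V) *
          Matrix.diagonal (fun i => (g i : ℂ)) * star V := by simp only [mul_assoc]
      _ = _ := by
        rw [hV, mul_one, mul_assoc V, Matrix.diagonal_mul_diagonal]
        push_cast
        rfl
  have hs' : A = V * Matrix.diagonal (fun i => (d i : ℂ)) * star V := hs
  have e1 : ∀ x : ℝ, 0 ≤ x → (√x)⁻¹ * x = √x := by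
    intro x hx
    rcases eq_or_ne (√x) 0 with h | h
    · simp [h]
    · field_simp
      rw [Real.sq_sqrt hx]
  refine ⟨V * Matrix.diagonal (fun i => ((√(d i) : ℝ) : ℂ)) * star V,
    V * Matrix.diagonal (fun i => (((√(d i))⁻¹ : ℝ) : ℂ)) * star V, ?_, ?_, ?_, ?_, ?_⟩
  · apply Matrix.PosSemidef.mul_mul_conjTranspose_same
    rw [Matrix.posSemidef_diagonal_iff]
    intro i
    exact_mod_cast Real.sqrt_nonneg _
  · apply Matrix.isHermitian_mul_mul_conjTranspose
    rw [Matrix.IsHermitian, Matrix.diagonal_conjTranspose]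
    congr 1
    ext i
    simp
  · rw [key, hs']
    congr 3
    ext i
    rw [Real.mul_self_sqrt (hev i)]
  · rw [hs', key]
    congr 3
    ext i
    rw [e1 _ (hev i)]
  · rw [hs', key]
    congr 3
    ext i
    rw [mul_comm, e1 _ (hev i)]

/-- First inequality, as an identity: Young-type estimate for `C` and `B`. -/
lemma young_identity {k : ℕ} (B C : Matrix (Fin k) (Fin k) ℂ) :
    Matrix.trace ((C - B) * (C + 2 * B) * (C - B)) =
      Matrix.trace (C * C * C) + 2 * Matrix.trace (B * B * B) -
        3 * Matrix.trace (C * (B * B)) := by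
  have e : (C - B) * (C + 2 * B) * (C - B) =
      C * C * C + (B * B * B + B * B * B) + (C * B * C + C * B * C) - C * C * B - B * C * C
        - (C * B * B + C * B * B) - (B * B * C + B * B * C) + B * C * B := by
    noncomm_ring
  have t1 : Matrix.trace (C * B * C) = Matrix.trace (C * C * B) := by
    rw [Matrix.trace_mul_comm, mul_assoc]
  have t2 : Matrix.trace (B * C * C) = Matrix.trace (C * C * B) := by
    rw [mul_assoc, Matrix.trace_mul_comm]
  have t3 : Matrix.trace (B * B * C) = Matrix.trace (C * (B * B)) := by
    rw [Matrix.trace_mul_comm]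
  have t4 : Matrix.trace (B * C * B) = Matrix.trace (C * (B * B)) := by
    rw [mul_assoc, Matrix.trace_mul_comm, mul_assoc]
  have t5 : C * B * B = C * (B * B) := mul_assoc _ _ _
  rw [e]
  simp only [Matrix.trace_add, Matrix.trace_sub, t1, t2, t3, t4, t5]
  ring

/-- **Matrix case of Proposition `p:notclosed` (trace positivity of the lifted homogenized
Motzkin polynomial).** For Hermitian `X₁, X₂, X₃ ∈ M_k(ℂ)`, the trace
`tr(X₂²X₁²X₂² + X₁²X₂²X₁² + X₃⁶ − 3·X₁X₂X₃²X₂X₁)` is a nonnegative real number. -/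
theorem homogenized_motzkin_trace_nonneg (k : ℕ) (X₁ X₂ X₃ : Matrix (Fin k) (Fin k) ℂ)
    (h₁ : X₁.IsHermitian) (h₂ : X₂.IsHermitian) (h₃ : X₃.IsHermitian) :
    0 ≤ Matrix.trace (X₂ ^ 2 * X₁ ^ 2 * X₂ ^ 2 + X₁ ^ 2 * X₂ ^ 2 * X₁ ^ 2 + X₃ ^ 6 -
      3 * (X₁ * X₂ * X₃ ^ 2 * X₂ * X₁)) := by
  have hApos : (X₂ * X₁ * (X₁ * X₂)).PosSemidef := by
    have := Matrix.posSemidef_conjTranspose_mul_self (X₁ * X₂)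
    rwa [Matrix.conjTranspose_mul, h₁.eq, h₂.eq] at this
  obtain ⟨B, G, hB, hG, hBB, hGA, hAG⟩ := exists_sqrt_pinv _ hApos
  have hCpos : (X₃ * X₃).PosSemidef := by
    have := Matrix.posSemidef_conjTranspose_mul_self X₃
    rwa [h₃.eq] at this
  set A := X₂ * X₁ * (X₁ * X₂) with hA
  set C := X₃ * X₃ with hC
  -- the Young part
  have p1 : 0 ≤ Matrix.trace ((C - B) * (C + 2 * B) * (C - B)) := by
    have hsum : (C + 2 * B).PosSemidef := by
      rw [two_mul]
      exact hCpos.add (hB.add hB)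
    have := (hsum.conjTranspose_mul_mul_same (C - B)).trace_nonneg
    rwa [Matrix.conjTranspose_sub, hB.isHermitian.eq, hCpos.isHermitian.eq] at this
  rw [young_identity, hBB] at p1
  -- the Cauchy-Schwarz part
  have p2 : 0 ≤ Matrix.trace ((X₂ * X₁ * X₁ - G * A * X₂) * (X₁ * X₁ * X₂ - X₂ * A * G)) := by
    have := (Matrix.posSemidef_conjTranspose_mul_self (X₁ * X₁ * X₂ - X₂ * A * G)).trace_nonneg
    rwa [Matrix.conjTranspose_sub, Matrix.conjTranspose_mul, Matrix.conjTranspose_mul,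
      Matrix.conjTranspose_mul, Matrix.conjTranspose_mul, h₁.eq, h₂.eq, hG.eq,
      hApos.isHermitian.eq, ← mul_assoc, ← mul_assoc] at this
  have e2 : (X₂ * X₁ * X₁ - G * A * X₂) * (X₁ * X₁ * X₂ - X₂ * A * G) =
      X₂ * (X₁ ^ 2 * X₁ ^ 2 * X₂) - A * (A * G) - (G * A) * A
        + (G * A) * (X₂ * X₂ * (A * G)) := by
    rw [hA]
    noncomm_ring
  have t1 : Matrix.trace (X₂ * (X₁ ^ 2 * X₁ ^ 2 * X₂)) =
      Matrix.trace (X₁ ^ 2 * X₂ ^ 2 * X₁ ^ 2) := by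
    rw [Matrix.trace_mul_comm, Matrix.trace_mul_comm (X₁ ^ 2 * X₂ ^ 2)]
    simp only [pow_two, mul_assoc]
  have t2 : Matrix.trace (B * (X₂ * X₂ * B)) = Matrix.trace (X₂ ^ 2 * X₁ ^ 2 * X₂ ^ 2) := by
    rw [Matrix.trace_mul_comm, mul_assoc, hBB, hA,
      show X₂ ^ 2 * X₁ ^ 2 * X₂ ^ 2 = (X₂ * X₂ * X₁ * X₁ * X₂) * X₂ by noncomm_ring,
      Matrix.trace_mul_comm _ X₂]
    simp only [mul_assoc]
  rw [e2, hGA, hAG, Matrix.trace_add, Matrix.trace_sub, Matrix.trace_sub, t1, t2,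
    Matrix.trace_mul_comm B A] at p2
  have t3 : Matrix.trace (X₁ * X₂ * X₃ ^ 2 * X₂ * X₁) = Matrix.trace (C * A) := by
    rw [show X₁ * X₂ * X₃ ^ 2 * X₂ * X₁ = (X₁ * X₂) * (X₃ * X₃ * X₂ * X₁) by noncomm_ring,
      Matrix.trace_mul_comm]
    simp only [hC, hA, mul_assoc]
  have t4 : X₃ ^ 6 = C * C * C := by
    rw [hC]
    noncomm_ring
  have t5 : (3 : Matrix (Fin k) (Fin k) ℂ) * (X₁ * X₂ * X₃ ^ 2 * X₂ * X₁) =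
      (3 : ℂ) • (X₁ * X₂ * X₃ ^ 2 * X₂ * X₁) := by
    rw [Algebra.smul_def, map_ofNat]
  rw [t4, Matrix.trace_sub, Matrix.trace_add, Matrix.trace_add, t5, Matrix.trace_smul, t3,
    smul_eq_mul]
  have := add_nonneg p1 p2
  convert this using 1
  ring
end
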